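/- Ball–Böröczky stability of the Blaschke–Santaló inequality: for each n ≥ 3 there exist constants c_n > 0 and ε₀(n) > 0 such that if K is a convex body in ℝⁿ and 0 < ε < ε₀(n) satisfy (1+ε)·P(K) ≥ P(B₂ⁿ), then log d_BM(K, B₂ⁿ) ≤ c_n · ε^{1/(3(n+1))} · |log ε|^{2/(3(n+1))}. -/

import Mathlib

open MeasureTheory Filter
open scoped InnerProductSpace Pointwise NNReal ENNReal Topology

noncomputable section

/-- The polar of a set `K` in Euclidean space: `{y | ⟨x,y⟩ ≤ 1 for all x ∈ K}`. -/
def polarSet {n : ℕ} (K : Set (EuclideanSpace ℝ (Fin n))) : Set (EuclideanSpace ℝ (Fin n)) :=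
  {y | ∀ x ∈ K, ⟪x, y⟫_ℝ ≤ 1}

/-- A convex body: a compact convex set with nonempty interior. -/
structure IsConvexBody {n : ℕ} (K : Set (EuclideanSpace ℝ (Fin n))) : Prop where
  convex : Convex ℝ K
  isCompact : IsCompact K
  nonempty_interior : (interior K).Nonempty

/-- The volume product `P(K) = vol K * min_{z ∈ int K} vol ((K - z)*)`. -/
def volumeProduct {n : ℕ} (K : Set (EuclideanSpace ℝ (Fin n))) : ℝ≥0∞ :=
  volume K * ⨅ z : interior K, volume (polarSet ((fun x => x - (z : EuclideanSpace ℝ (Fin n))) '' K))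

/-- The Banach–Mazur distance between two convex bodies:
`inf {d > 0 : K - x ⊆ T(L - y) ⊆ d (K - x)}` over invertible linear maps `T` and points. -/
def banachMazurDist {n : ℕ} (K L : Set (EuclideanSpace ℝ (Fin n))) : ℝ :=
  sInf {d : ℝ | 0 < d ∧ ∃ (T : EuclideanSpace ℝ (Fin n) ≃ₗ[ℝ] EuclideanSpace ℝ (Fin n))
    (x y : EuclideanSpace ℝ (Fin n)),
      (fun v => v - x) '' K ⊆ T '' ((fun v => v - y) '' L) ∧
      T '' ((fun v => v - y) '' L) ⊆ d • ((fun v => v - x) '' K)}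

theorem Real.volume_add_volume_le_of_isCompact {A B : Set ℝ} (hA : IsCompact A)
    (hB : IsCompact B) (hAn : A.Nonempty) (hBn : B.Nonempty) :
    volume A + volume B ≤ volume (A + B) := by
  obtain ⟨a, haA, ha⟩ := hA.exists_isMaxOn hAn continuous_id.continuousOn
  obtain ⟨b, hbB, hb⟩ := hB.exists_isMinOn hBn continuous_id.continuousOn
  have hinter : (b +ᵥ A) ∩ (a +ᵥ B) ⊆ {a + b} := by
    rintro _ ⟨⟨x, hx, rfl⟩, ⟨y, hy, hxy⟩⟩
    have h1 : x ≤ a := ha hx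
    have h2 : b ≤ y := hb hy
    simp only [vadd_eq_add] at hxy ⊢
    simp only [Set.mem_singleton_iff]
    linarith
  have h0 : volume ((b +ᵥ A) ∩ (a +ᵥ B)) = 0 :=
    measure_mono_null hinter (by simp)
  have hm : MeasurableSet (a +ᵥ B) := (hB.vadd a).measurableSet
  calc volume A + volume B = volume (b +ᵥ A) + volume (a +ᵥ B) := by
        rw [measure_vadd, measure_vadd]
    _ = volume ((b +ᵥ A) ∪ (a +ᵥ B)) := by
        rw [← measure_union_add_inter _ hm, h0, add_zero]
    _ ≤ volume (A + B) := by
        apply measure_mono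
        rintro z (⟨x, hx, rfl⟩ | ⟨y, hy, rfl⟩)
        · simp only [vadd_eq_add]
          rw [add_comm b x]
          exact Set.add_mem_add hx hbB
        · exact Set.add_mem_add haA hy

theorem Real.volume_add_volume_le {A B C : Set ℝ} (hA : MeasurableSet A)
    (hB : MeasurableSet B) (hAn : A.Nonempty) (hBn : B.Nonempty) (hC : A + B ⊆ C) :
    volume A + volume B ≤ volume C := by
  obtain ⟨a, ha⟩ := hAn
  obtain ⟨b, hb⟩ := hBn
  rw [hA.measure_eq_iSup_isCompact, hB.measure_eq_iSup_isCompact]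
  simp only [iSup_and']
  refine ENNReal.biSup_add_biSup_le' ⟨∅, by simp⟩ ⟨∅, by simp⟩ ?_
  rintro K ⟨hKA, hK⟩ L ⟨hLB, hL⟩
  calc volume K + volume L ≤ volume (insert a K) + volume (insert b L) := by
        gcongr <;> exact Set.subset_insert _ _
    _ ≤ volume (insert a K + insert b L) :=
        Real.volume_add_volume_le_of_isCompact (hK.insert a) (hL.insert b)
          (Set.insert_nonempty _ _) (Set.insert_nonempty _ _)
    _ ≤ volume C := measure_mono <| (Set.add_subset_add (Set.insert_subset ha hKA)
          (Set.insert_subset hb hLB)).trans hC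

theorem Real.volume_combo_le {A B C : Set ℝ} {α : ℝ} (h0 : 0 < α) (h1 : α < 1)
    (hA : MeasurableSet A) (hB : MeasurableSet B) (hAn : A.Nonempty) (hBn : B.Nonempty)
    (hC : ∀ a ∈ A, ∀ b ∈ B, (1 - α) * a + α * b ∈ C) :
    ENNReal.ofReal (1 - α) * volume A + ENNReal.ofReal α * volume B ≤ volume C := by
  have h1' : 0 < 1 - α := by linarith
  have e1 : volume ((1 - α) • A) = ENNReal.ofReal (1 - α) * volume A := by
    rw [Measure.addHaar_smul]; simp [abs_of_pos h1']
  have e2 : volume (α • B) = ENNReal.ofReal α * volume B := by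
    rw [Measure.addHaar_smul]; simp [abs_of_pos h0]
  rw [← e1, ← e2]
  refine Real.volume_add_volume_le (hA.const_smul₀ _) (hB.const_smul₀ _) (hAn.smul_set)
    (hBn.smul_set) ?_
  rintro _ ⟨_, ⟨a, ha, rfl⟩, _, ⟨b, hb, rfl⟩, rfl⟩
  exact hC a ha b hb

theorem lintegral_eq_lintegral_Ioi_measure_lt {X : Type*} [MeasurableSpace X] (μ : Measure X)
    [SFinite μ] {f : X → ℝ≥0∞} (hf : Measurable f) :
    ∫⁻ x, f x ∂μ = ∫⁻ t in Set.Ioi (0 : ℝ), μ {x | ENNReal.ofReal t < f x} := by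
  have key : ∀ a : ℝ≥0∞, a = ∫⁻ t in Set.Ioi (0 : ℝ),
      Set.indicator {t : ℝ | ENNReal.ofReal t < a} 1 t := by
    intro a
    have hm : MeasurableSet {t : ℝ | ENNReal.ofReal t < a} :=
      measurableSet_lt (by fun_prop) measurable_const
    rw [lintegral_indicator_one hm, Measure.restrict_apply hm]
    by_cases ha : a = ⊤
    · have : {t : ℝ | ENNReal.ofReal t < a} ∩ Set.Ioi 0 = Set.Ioi 0 := by
        ext t; simp [ha]
      rw [this, Real.volume_Ioi, ha]
    · have : {t : ℝ | ENNReal.ofReal t < a} ∩ Set.Ioi 0 = Set.Ioo 0 a.toReal := by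
        ext t
        simp only [Set.mem_inter_iff, Set.mem_ofPred_eq, Set.mem_Ioi, Set.mem_Ioo]
        constructor
        · rintro ⟨h, h'⟩
          exact ⟨h', (ENNReal.ofReal_lt_iff_lt_toReal h'.le ha).1 h⟩
        · rintro ⟨h, h'⟩
          exact ⟨(ENNReal.ofReal_lt_iff_lt_toReal h.le ha).2 h', h⟩
      rw [this, Real.volume_Ioo, sub_zero, ENNReal.ofReal_toReal ha]
  calc ∫⁻ x, f x ∂μ = ∫⁻ x, (∫⁻ t in Set.Ioi (0 : ℝ),
        Set.indicator {t : ℝ | ENNReal.ofReal t < f x} 1 t) ∂μ :=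
        lintegral_congr fun x => key (f x)
    _ = ∫⁻ t in Set.Ioi (0 : ℝ), ∫⁻ x,
        Set.indicator {t : ℝ | ENNReal.ofReal t < f x} 1 t ∂μ := by
        apply lintegral_lintegral_swap
        apply Measurable.aemeasurable
        have hs : MeasurableSet {p : X × ℝ | ENNReal.ofReal p.2 < f p.1} :=
          measurableSet_lt (by fun_prop) (by fun_prop)
        exact (measurable_one.indicator hs)
    _ = _ := by
        refine lintegral_congr fun t => ?_
        have hs : MeasurableSet {x : X | ENNReal.ofReal t < f x} :=
          measurableSet_lt (by fun_prop) (by fun_prop)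
        rw [← lintegral_indicator_one hs]
        rfl

theorem lintegral_combo_le_of_min_le {f g h : ℝ → ℝ≥0∞} {α : ℝ} (h0 : 0 < α) (h1 : α < 1)
    (hf : Measurable f) (hg : Measurable g) (hh : Measurable h)
    (hfgh : ∀ x y, min (f x) (g y) ≤ h ((1 - α) * x + α * y))
    (hsup : ⨆ x, f x = ⨆ y, g y) :
    ENNReal.ofReal (1 - α) * (∫⁻ x, f x) + ENNReal.ofReal α * (∫⁻ x, g x) ≤ ∫⁻ x, h x := by
  have hmeas : ∀ {k : ℝ → ℝ≥0∞}, Measurable k →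
      Measurable fun t : ℝ => volume {x | ENNReal.ofReal t < k x} := by
    intro k hk
    have : Antitone fun t : ℝ => volume {x | ENNReal.ofReal t < k x} := by
      intro s t hst
      exact measure_mono fun x hx => lt_of_le_of_lt (ENNReal.ofReal_le_ofReal hst) hx
    exact this.measurable
  rw [lintegral_eq_lintegral_Ioi_measure_lt volume hf,
    lintegral_eq_lintegral_Ioi_measure_lt volume hg,
    lintegral_eq_lintegral_Ioi_measure_lt volume hh,
    ← lintegral_const_mul _ (hmeas hf), ← lintegral_const_mul _ (hmeas hg),
    ← lintegral_add_left ((hmeas hf).const_mul _)]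
  refine lintegral_mono fun t => ?_
  by_cases ht : ENNReal.ofReal t < ⨆ x, f x
  · have hA : Set.Nonempty {x | ENNReal.ofReal t < f x} := lt_iSup_iff.1 ht
    have hB : Set.Nonempty {x | ENNReal.ofReal t < g x} := lt_iSup_iff.1 (ht.trans_eq hsup)
    refine Real.volume_combo_le h0 h1 (measurableSet_lt measurable_const hf)
      (measurableSet_lt measurable_const hg) hA hB ?_
    intro a ha b hb
    exact lt_of_lt_of_le (lt_min ha hb) (hfgh a b)
  · have hA : {x | ENNReal.ofReal t < f x} = ∅ := by
      ext x
      simp only [Set.mem_ofPred_eq, Set.mem_empty_iff_false, iff_false, not_lt]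
      exact (le_iSup f x).trans (not_lt.1 ht)
    have hB : {x | ENNReal.ofReal t < g x} = ∅ := by
      ext x
      simp only [Set.mem_ofPred_eq, Set.mem_empty_iff_false, iff_false, not_lt]
      exact (le_iSup g x).trans (hsup ▸ not_lt.1 ht)
    simp [hA, hB]

theorem ENNReal.geom_mean_le_arith_mean_weighted (a b : ℝ≥0∞) {α : ℝ} (h0 : 0 < α)
    (h1 : α < 1) :
    a ^ (1 - α) * b ^ α ≤ ENNReal.ofReal (1 - α) * a + ENNReal.ofReal α * b := by
  have h1' : 0 < 1 - α := by linarith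
  by_cases ha : a = ⊤
  · rw [ha, ENNReal.mul_top (by simpa using h1'), top_add]; exact le_top
  by_cases hb : b = ⊤
  · rw [hb, ENNReal.mul_top (by simpa using h0), add_top]; exact le_top
  lift a to ℝ≥0 using ha
  lift b to ℝ≥0 using hb
  rw [← ENNReal.coe_rpow_of_nonneg _ h1'.le, ← ENNReal.coe_rpow_of_nonneg _ h0.le]
  have := NNReal.geom_mean_le_arith_mean2_weighted (1 - α).toNNReal α.toNNReal a b
    (by rw [← Real.toNNReal_add h1'.le h0.le]; simp)
  rw [Real.coe_toNNReal _ h1'.le, Real.coe_toNNReal _ h0.le] at this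
  unfold ENNReal.ofReal
  exact_mod_cast this

/-- The Prékopa–Leindler inequality with weight `α` for the measure `μ` and the operation `op`. -/
def PrekopaLeindler {X : Type*} [MeasurableSpace X] (μ : Measure X) (op : X → X → X)
    (α : ℝ) : Prop :=
  ∀ f g h : X → ℝ≥0∞, Measurable f → Measurable g → Measurable h →
    (∀ x y, f x ^ (1 - α) * g y ^ α ≤ h (op x y)) →
    (∫⁻ x, f x ∂μ) ^ (1 - α) * (∫⁻ x, g x ∂μ) ^ α ≤ ∫⁻ x, h x ∂μ

theorem lintegral_rpow_mul_le_of_bounded {f g h : ℝ → ℝ≥0∞} {α : ℝ} (h0 : 0 < α)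
    (h1 : α < 1) (hf : Measurable f) (hg : Measurable g) (hh : Measurable h)
    (hfgh : ∀ x y, f x ^ (1 - α) * g y ^ α ≤ h ((1 - α) * x + α * y))
    {N : ℝ≥0∞} (hN : N ≠ ⊤) (hfN : ∀ x, f x ≤ N) (hgN : ∀ x, g x ≤ N) :
    (∫⁻ x, f x) ^ (1 - α) * (∫⁻ x, g x) ^ α ≤ ∫⁻ x, h x := by
  have h1' : 0 < 1 - α := by linarith
  set F := ⨆ x, f x with hF
  set G := ⨆ x, g x with hG
  have hFt : F ≠ ⊤ := ne_top_of_le_ne_top hN (iSup_le hfN)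
  have hGt : G ≠ ⊤ := ne_top_of_le_ne_top hN (iSup_le hgN)
  by_cases hF0 : F = 0
  · have : ∀ x, f x = 0 := fun x => le_antisymm ((le_iSup f x).trans hF0.le) bot_le
    simp [this, h1']
  by_cases hG0 : G = 0
  · have : ∀ x, g x = 0 := fun x => le_antisymm ((le_iSup g x).trans hG0.le) bot_le
    simp [this, h0]
  set c := F ^ (1 - α) * G ^ α with hc
  have hp1 : F ^ (1 - α) ≠ 0 := by simp [hF0, hFt]
  have hp2 : G ^ α ≠ 0 := by simp [hG0, hGt]
  have hp3 : F ^ (1 - α) ≠ ⊤ := by simp [hF0, hFt]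
  have hp4 : G ^ α ≠ ⊤ := by simp [hG0, hGt]
  have hc0 : c ≠ 0 := mul_ne_zero hp1 hp2
  have hct : c ≠ ⊤ := ENNReal.mul_ne_top hp3 hp4
  have key := lintegral_combo_le_of_min_le (f := fun x => F⁻¹ * f x) (g := fun x => G⁻¹ * g x)
    (h := fun x => c⁻¹ * h x) h0 h1 (hf.const_mul _) (hg.const_mul _) (hh.const_mul _) ?_ ?_
  · rw [lintegral_const_mul _ hf, lintegral_const_mul _ hg, lintegral_const_mul _ hh] at key
    have := (ENNReal.geom_mean_le_arith_mean_weighted _ _ h0 h1).trans key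
    rw [ENNReal.mul_rpow_of_nonneg _ _ h1'.le, ENNReal.mul_rpow_of_nonneg _ _ h0.le,
      ENNReal.inv_rpow, ENNReal.inv_rpow] at this
    have e : c⁻¹ = (F ^ (1 - α))⁻¹ * (G ^ α)⁻¹ :=
      ENNReal.mul_inv (Or.inl hp1) (Or.inl hp3)
    have e2 : c⁻¹ * ((∫⁻ x, f x) ^ (1 - α) * (∫⁻ x, g x) ^ α) ≤ c⁻¹ * ∫⁻ x, h x := by
      refine le_trans (le_of_eq ?_) this
      rw [e]; ring
    have := mul_le_mul_right e2 c
    simpa only [← mul_assoc, ENNReal.mul_inv_cancel hc0 hct, one_mul] using this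
  · intro x y
    calc min (F⁻¹ * f x) (G⁻¹ * g y)
        = min (F⁻¹ * f x) (G⁻¹ * g y) ^ (1 - α) * min (F⁻¹ * f x) (G⁻¹ * g y) ^ α := by
          rw [← ENNReal.rpow_add_of_nonneg _ _ h1'.le h0.le]; simp
      _ ≤ (F⁻¹ * f x) ^ (1 - α) * (G⁻¹ * g y) ^ α := by
          gcongr
          · exact min_le_left _ _
          · exact min_le_right _ _
      _ = c⁻¹ * (f x ^ (1 - α) * g y ^ α) := by
          rw [ENNReal.mul_rpow_of_nonneg _ _ h1'.le, ENNReal.mul_rpow_of_nonneg _ _ h0.le,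
            ENNReal.inv_rpow, ENNReal.inv_rpow, hc, ENNReal.mul_inv (Or.inl hp1) (Or.inl hp3)]
          ring
      _ ≤ _ := by gcongr; exact hfgh x y
  · rw [← ENNReal.mul_iSup, ← ENNReal.mul_iSup, ← hF, ← hG,
      ENNReal.inv_mul_cancel hF0 hFt, ENNReal.inv_mul_cancel hG0 hGt]

theorem lintegral_min_natCast_tendsto {f : ℝ → ℝ≥0∞} (hf : Measurable f) :
    Tendsto (fun N : ℕ => ∫⁻ x, min (f x) N) atTop (𝓝 (∫⁻ x, f x)) := by
  refine lintegral_tendsto_of_tendsto_of_monotone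
    (fun N => (hf.min measurable_const).aemeasurable) ?_ ?_
  · refine Eventually.of_forall fun x N M hNM => ?_
    exact min_le_min le_rfl (by exact_mod_cast hNM)
  · refine Eventually.of_forall fun x => ?_
    have := (tendsto_const_nhds (x := f x)).min ENNReal.tendsto_nat_nhds_top
    simpa using this

theorem prekopaLeindler_real {α : ℝ} (h0 : 0 < α) (h1 : α < 1) :
    PrekopaLeindler (volume : Measure ℝ) (fun x y => (1 - α) * x + α * y) α := by
  intro f g h hf hg hh hfgh
  have h1' : 0 < 1 - α := by linarith
  by_cases hf0 : ∫⁻ x, f x = 0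
  · simp [hf0, h1']
  by_cases hg0 : ∫⁻ x, g x = 0
  · simp [hg0, h0]
  have hlim : Tendsto (fun N : ℕ => (∫⁻ x, min (f x) N) ^ (1 - α) * (∫⁻ x, min (g x) N) ^ α)
      atTop (𝓝 ((∫⁻ x, f x) ^ (1 - α) * (∫⁻ x, g x) ^ α)) := by
    refine ENNReal.Tendsto.mul ?_ (Or.inl ?_) ?_ (Or.inl ?_)
    · exact (ENNReal.continuous_rpow_const.tendsto _).comp (lintegral_min_natCast_tendsto hf)
    · simp [hf0, h1', not_lt.2 h1'.le]
    · exact (ENNReal.continuous_rpow_const.tendsto _).comp (lintegral_min_natCast_tendsto hg)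
    · simp [hg0, h0, not_lt.2 h0.le]
  refine le_of_tendsto hlim (Eventually.of_forall fun N => ?_)
  refine lintegral_rpow_mul_le_of_bounded h0 h1 (hf.min measurable_const)
    (hg.min measurable_const) hh (fun x y => le_trans ?_ (hfgh x y))
    (N := N) (ENNReal.natCast_ne_top N) (fun x => min_le_right _ _) (fun x => min_le_right _ _)
  gcongr
  · exact min_le_left _ _
  · exact min_le_left _ _

theorem PrekopaLeindler.prod {X Y : Type*} [MeasurableSpace X] [MeasurableSpace Y]
    {μ : Measure X} {ν : Measure Y} [SFinite μ] [SFinite ν] {op₁ : X → X → X}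
    {op₂ : Y → Y → Y} {α : ℝ} (hX : PrekopaLeindler μ op₁ α) (hY : PrekopaLeindler ν op₂ α) :
    PrekopaLeindler (μ.prod ν) (fun p q => (op₁ p.1 q.1, op₂ p.2 q.2)) α := by
  intro f g h hf hg hh hfgh
  rw [lintegral_prod _ hf.aemeasurable, lintegral_prod _ hg.aemeasurable,
    lintegral_prod _ hh.aemeasurable]
  refine hX _ _ _ hf.lintegral_prod_right' hg.lintegral_prod_right' hh.lintegral_prod_right' ?_
  intro x x'
  exact hY _ _ _ (hf.comp measurable_prodMk_left) (hg.comp measurable_prodMk_left)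
    (hh.comp measurable_prodMk_left) fun y y' => hfgh (x, y) (x', y')

theorem PrekopaLeindler.of_measurePreserving {X Y : Type*} [MeasurableSpace X]
    [MeasurableSpace Y] {μ : Measure X} {ν : Measure Y} {op₁ : X → X → X}
    {op₂ : Y → Y → Y} {α : ℝ} (e : X ≃ᵐ Y) (he : MeasurePreserving e μ ν)
    (hop : ∀ x x', e (op₁ x x') = op₂ (e x) (e x')) (hY : PrekopaLeindler ν op₂ α) :
    PrekopaLeindler μ op₁ α := by
  intro f g h hf hg hh hfgh
  have key : ∀ {k : X → ℝ≥0∞}, Measurable k → ∫⁻ x, k x ∂μ = ∫⁻ y, k (e.symm y) ∂ν := by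
    intro k hk
    exact ((he.symm e).lintegral_comp hk).symm
  rw [key hf, key hg, key hh]
  refine hY _ _ _ (hf.comp e.symm.measurable) (hg.comp e.symm.measurable)
    (hh.comp e.symm.measurable) fun y y' => ?_
  have : op₂ y y' = e (op₁ (e.symm y) (e.symm y')) := by simp [hop]
  rw [this]
  simpa using hfgh (e.symm y) (e.symm y')

theorem PrekopaLeindler.pi {μ : Measure ℝ} [SigmaFinite μ] {op : ℝ → ℝ → ℝ} {α : ℝ}
    (h : PrekopaLeindler μ op α) (m : ℕ) :
    PrekopaLeindler (Measure.pi fun _ : Fin m => μ) (fun x y i => op (x i) (y i)) α := by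
  induction m with
  | zero =>
    intro f g h hf hg hh hfgh
    have := hfgh isEmptyElim isEmptyElim
    rw [Measure.pi_of_empty (fun _ : Fin 0 => μ) isEmptyElim, lintegral_dirac' _ hf,
      lintegral_dirac' _ hg, lintegral_dirac' _ hh]
    exact this.trans_eq (congrArg h (Subsingleton.elim _ _))
  | succ m ih =>
    refine PrekopaLeindler.of_measurePreserving
      (MeasurableEquiv.piFinSuccAbove (fun _ => ℝ) 0)
      (measurePreserving_piFinSuccAbove (fun _ => μ) 0) ?_ (h.prod ih)
    intro x x'
    rfl

theorem volume_rpow_mul_volume_rpow_le {m : ℕ} {A B C : Set (Fin m → ℝ)} {α : ℝ} (h0 : 0 < α)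
    (h1 : α < 1) (hA : MeasurableSet A) (hB : MeasurableSet B) (hC : MeasurableSet C)
    (hABC : ∀ a ∈ A, ∀ b ∈ B, (1 - α) • a + α • b ∈ C) :
    volume A ^ (1 - α) * volume B ^ α ≤ volume C := by
  have h1' : 0 < 1 - α := by linarith
  have key := (prekopaLeindler_real h0 h1).pi m (A.indicator 1) (B.indicator 1)
    (C.indicator 1) (measurable_one.indicator hA) (measurable_one.indicator hB)
    (measurable_one.indicator hC) ?_
  · rw [lintegral_indicator_one hA, lintegral_indicator_one hB, lintegral_indicator_one hC] at key
    exact key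
  · intro x y
    by_cases hx : x ∈ A
    · by_cases hy : y ∈ B
      · have : (fun i => (1 - α) * x i + α * y i) ∈ C := hABC x hx y hy
        simp [hx, hy, this]
      · simp [hy, h0]
    · simp [hx, h1']

theorem lintegral_Ioi_eq_lintegral_exp (f : ℝ → ℝ≥0∞) :
    ∫⁻ t in Set.Ioi (0 : ℝ), f t = ∫⁻ x, ENNReal.ofReal (Real.exp x) * f (Real.exp x) := by
  have := lintegral_image_eq_lintegral_abs_deriv_mul (s := Set.univ) (f := Real.exp)
    (f' := Real.exp) MeasurableSet.univ (fun x _ => (Real.hasDerivAt_exp x).hasDerivWithinAt)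
    (Real.exp_injective.injOn) f
  simpa [Set.image_univ, Real.range_exp] using this

theorem lintegral_eq_lintegral_Ioi_add_neg {f : ℝ → ℝ≥0∞} (hf : Measurable f) :
    ∫⁻ x, f x = ∫⁻ x in Set.Ioi (0 : ℝ), (f x + f (-x)) := by
  rw [lintegral_add_left hf, ← lintegral_add_compl f (measurableSet_Ioi (a := (0 : ℝ)))]
  congr 1
  have h2 : (Set.Ioi (0 : ℝ))ᶜ = Set.Iic 0 := by ext; simp
  rw [h2, setLIntegral_congr (Iio_ae_eq_Iic (μ := volume) (a := (0 : ℝ))).symm]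
  have := (Measure.measurePreserving_neg (volume : Measure ℝ)).setLIntegral_comp_preimage
    (measurableSet_Iio (a := (0 : ℝ))) hf
  rw [← this]
  congr 2
  ext x
  simp

theorem sqrt_lintegral_Ioi_mul_le {f g h : ℝ → ℝ≥0∞} (hf : Measurable f) (hg : Measurable g)
    (hh : Measurable h)
    (hfgh : ∀ x > 0, ∀ y > 0, f x ^ (1 / 2 : ℝ) * g y ^ (1 / 2 : ℝ) ≤ h (√(x * y))) :
    (∫⁻ x in Set.Ioi (0 : ℝ), f x) ^ (1 / 2 : ℝ) * (∫⁻ x in Set.Ioi (0 : ℝ), g x) ^ (1 / 2 : ℝ) ≤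
      ∫⁻ x in Set.Ioi (0 : ℝ), h x := by
  rw [lintegral_Ioi_eq_lintegral_exp, lintegral_Ioi_eq_lintegral_exp,
    lintegral_Ioi_eq_lintegral_exp]
  have key := prekopaLeindler_real (α := 1 / 2) (by norm_num) (by norm_num)
    (fun x => ENNReal.ofReal (Real.exp x) * f (Real.exp x))
    (fun x => ENNReal.ofReal (Real.exp x) * g (Real.exp x))
    (fun x => ENNReal.ofReal (Real.exp x) * h (Real.exp x))
    (by fun_prop) (by fun_prop) (by fun_prop) ?_
  · convert key using 3; norm_num
  · intro x y
    have e1 : (1 - 1 / 2 : ℝ) = 1 / 2 := by norm_num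
    rw [e1]
    have hs : √(Real.exp x * Real.exp y) = Real.exp (1 / 2 * x + 1 / 2 * y) := by
      rw [← Real.exp_add, ← Real.exp_half]; congr 1; ring
    have := hfgh _ (Real.exp_pos x) _ (Real.exp_pos y)
    rw [hs] at this
    rw [ENNReal.mul_rpow_of_nonneg _ _ (by norm_num), ENNReal.mul_rpow_of_nonneg _ _ (by norm_num)]
    calc _ = (ENNReal.ofReal (Real.exp x) ^ (1 / 2 : ℝ) * ENNReal.ofReal (Real.exp y) ^ (1 / 2 : ℝ)) *
        (f (Real.exp x) ^ (1 / 2 : ℝ) * g (Real.exp y) ^ (1 / 2 : ℝ)) := by ring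
      _ ≤ _ := by
        refine mul_le_mul' (le_of_eq ?_) this
        rw [ENNReal.ofReal_rpow_of_pos (Real.exp_pos _), ENNReal.ofReal_rpow_of_pos (Real.exp_pos _),
          ← ENNReal.ofReal_mul (by positivity), ← Real.exp_mul, ← Real.exp_mul, ← Real.exp_add]
        congr 2; ring

theorem map_abs_volume : (volume : Measure ℝ).map (fun x => |x|) =
    volume.restrict (Set.Ioi 0) + volume.restrict (Set.Ioi 0) := by
  ext s hs
  have hm : Measurable (s.indicator (1 : ℝ → ℝ≥0∞)) := measurable_one.indicator hs
  rw [← lintegral_indicator_one hs, ← lintegral_indicator_one hs,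
    lintegral_map hm (by fun_prop), lintegral_add_measure,
    lintegral_eq_lintegral_Ioi_add_neg (f := fun a => s.indicator 1 |a|)
      (hm.comp (by fun_prop)), ← lintegral_add_left hm]
  refine setLIntegral_congr_fun measurableSet_Ioi fun x hx => ?_
  simp [abs_of_pos (show 0 < x from hx)]

instance : SigmaFinite ((volume : Measure ℝ).map (fun x => |x|)) := by
  rw [map_abs_volume]; infer_instance

theorem prekopaLeindler_map_abs :
    PrekopaLeindler ((volume : Measure ℝ).map (fun x => |x|)) (fun x y => √(|x| * |y|))
      (1 / 2) := by
  intro f g h hf hg hh hfgh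
  have e1 : (1 - 1 / 2 : ℝ) = 1 / 2 := by norm_num
  rw [e1] at hfgh ⊢
  have key := sqrt_lintegral_Ioi_mul_le hf hg hh (fun x hx y hy => by
    have := hfgh x y
    simpa only [abs_of_pos hx, abs_of_pos hy] using this)
  rw [map_abs_volume, lintegral_add_measure, lintegral_add_measure, lintegral_add_measure,
    ← two_mul, ← two_mul, ← two_mul, ENNReal.mul_rpow_of_nonneg _ _ (by norm_num),
    ENNReal.mul_rpow_of_nonneg _ _ (by norm_num)]
  have h2 : (2 : ℝ≥0∞) ^ (1 / 2 : ℝ) * 2 ^ (1 / 2 : ℝ) = 2 := by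
    rw [← ENNReal.rpow_add _ _ (by norm_num) (by norm_num)]; norm_num
  calc _ = ((2 : ℝ≥0∞) ^ (1 / 2 : ℝ) * 2 ^ (1 / 2 : ℝ)) *
      ((∫⁻ x in Set.Ioi (0 : ℝ), f x) ^ (1 / 2 : ℝ) *
        (∫⁻ x in Set.Ioi (0 : ℝ), g x) ^ (1 / 2 : ℝ)) := by ring
    _ ≤ _ := by rw [h2]; gcongr

/-- Negation of the `i`-th coordinate. -/
def coordFlip {ι : Type*} [DecidableEq ι] (i : ι) (x : ι → ℝ) : ι → ℝ :=
  Function.update x i (-x i)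

theorem abs_mem_of_coordFlip_mem {ι : Type*} [Fintype ι] [DecidableEq ι] {A : Set (ι → ℝ)}
    (hA : ∀ i, ∀ x ∈ A, coordFlip i x ∈ A) {x y : ι → ℝ} (hxy : ∀ i, |x i| = |y i|)
    (hx : x ∈ A) : y ∈ A := by
  suffices h : ∀ s : Finset ι, (fun i => if i ∈ s then y i else x i) ∈ A by
    simpa using h Finset.univ
  intro s
  induction s using Finset.induction_on with
  | empty => simpa using hx
  | insert a s has ih =>
    rcases abs_eq_abs.1 (hxy a) with h | h
    · convert ih using 1
      ext i
      by_cases hi : i = a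
      · subst hi; simp [has, h]
      · simp [hi]
    · convert hA a _ ih using 1
      ext i
      by_cases hi : i = a
      · subst hi; simp [coordFlip, has, h]
      · simp [coordFlip, hi]

theorem volume_mul_volume_le_of_coordFlip {m : ℕ} {A B : Set (Fin m → ℝ)} {c : ℝ}
    (hA : MeasurableSet A) (hB : MeasurableSet B)
    (hAf : ∀ i, ∀ x ∈ A, coordFlip i x ∈ A) (hBf : ∀ i, ∀ x ∈ B, coordFlip i x ∈ B)
    (hAB : ∀ x ∈ A, ∀ y ∈ B, x ⬝ᵥ y ≤ c) :
    volume A * volume B ≤ volume {x : Fin m → ℝ | ∑ i, x i ^ 2 ≤ c} ^ 2 := by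
  set C := {x : Fin m → ℝ | ∑ i, x i ^ 2 ≤ c} with hC
  have hCm : MeasurableSet C := measurableSet_le (by fun_prop) measurable_const
  have hmp : (volume : Measure (Fin m → ℝ)).map (fun x i => |x i|) =
      Measure.pi fun _ => (volume : Measure ℝ).map (fun x => |x|) :=
    Measure.pi_map_pi (μ := fun _ : Fin m => (volume : Measure ℝ))
      (f := fun _ x => |x|) fun _ => by fun_prop
  have hvol : ∀ {S : Set (Fin m → ℝ)}, MeasurableSet S → (∀ i, ∀ x ∈ S, coordFlip i x ∈ S) →
      ∫⁻ x, S.indicator 1 x ∂(Measure.pi fun _ => (volume : Measure ℝ).map (fun x => |x|)) =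
        volume S := by
    intro S hS hSf
    rw [lintegral_indicator_one hS, ← hmp, Measure.map_apply (by fun_prop) hS]
    congr 1
    ext x
    exact ⟨abs_mem_of_coordFlip_mem hSf (by simp), abs_mem_of_coordFlip_mem hSf (by simp)⟩
  have hCf : ∀ i, ∀ x ∈ C, coordFlip i x ∈ C := by
    intro i x hx
    simp only [hC, Set.mem_ofPred_eq] at hx ⊢
    refine le_of_eq_of_le (Finset.sum_congr rfl fun j _ => ?_) hx
    by_cases hj : j = i
    · subst hj; simp [coordFlip]
    · simp [coordFlip, hj]
  have key := prekopaLeindler_map_abs.pi m (A.indicator 1) (B.indicator 1) (C.indicator 1)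
    (measurable_one.indicator hA) (measurable_one.indicator hB) (measurable_one.indicator hCm) ?_
  · rw [hvol hA hAf, hvol hB hBf, hvol hCm hCf] at key
    have e1 : (1 - 1 / 2 : ℝ) = 1 / 2 := by norm_num
    rw [e1, ← ENNReal.mul_rpow_of_nonneg _ _ (by norm_num)] at key
    calc volume A * volume B = ((volume A * volume B) ^ (1 / 2 : ℝ)) ^ (2 : ℝ) := by
          rw [← ENNReal.rpow_mul]; norm_num
      _ ≤ volume C ^ (2 : ℝ) := by gcongr
      _ = _ := by norm_num
  · intro x y
    by_cases hx : x ∈ A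
    · by_cases hy : y ∈ B
      · have : (fun i => √(|x i| * |y i|)) ∈ C := by
          have h1 := hAB (fun i => |x i|) (abs_mem_of_coordFlip_mem hAf (by simp) hx)
            (fun i => |y i|) (abs_mem_of_coordFlip_mem hBf (by simp) hy)
          simp only [hC, Set.mem_ofPred_eq]
          refine le_of_eq_of_le (Finset.sum_congr rfl fun j _ => ?_) h1
          exact Real.sq_sqrt (by positivity)
        rw [Set.indicator_of_mem hx, Set.indicator_of_mem hy, Set.indicator_of_mem this]
        simp
      · simp [hy]
    · rw [Set.indicator_of_notMem hx, ENNReal.zero_rpow_of_pos (by norm_num), zero_mul]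
      exact bot_le

theorem lintegral_insertNth {m : ℕ} (i : Fin (m + 1)) {F : (Fin (m + 1) → ℝ) → ℝ≥0∞}
    (hF : Measurable F) :
    ∫⁻ x, F x = ∫⁻ t : ℝ, ∫⁻ v : Fin m → ℝ, F (i.insertNth t v) := by
  have := ((volume_preserving_piFinSuccAbove (fun _ : Fin (m + 1) => ℝ) i).symm _).lintegral_comp hF
  rw [← this, Measure.volume_eq_prod, lintegral_prod]
  · rfl
  · exact (hF.comp (MeasurableEquiv.measurable _)).aemeasurable

theorem measurable_insertNth {m : ℕ} (i : Fin (m + 1)) :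
    Measurable fun p : ℝ × (Fin m → ℝ) => (i.insertNth p.1 p.2 : Fin (m + 1) → ℝ) :=
  (MeasurableEquiv.piFinSuccAbove (fun _ : Fin (m + 1) => ℝ) i).symm.measurable

theorem dotProduct_eq_add_removeNth {m : ℕ} (i : Fin (m + 1)) (x y : Fin (m + 1) → ℝ) :
    x ⬝ᵥ y = x i * y i + i.removeNth x ⬝ᵥ i.removeNth y :=
  Fin.sum_univ_succAbove _ i

theorem volume_eq_add_coord {m : ℕ} (i : Fin (m + 1)) (S : Set (Fin (m + 1) → ℝ)) :
    volume S = volume (S ∩ {y | 0 < y i}) + volume (S ∩ {y | y i < 0}) := by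
  have hm : MeasurableSet {y : Fin (m + 1) → ℝ | 0 < y i} :=
    measurableSet_lt measurable_const (measurable_pi_apply i)
  have h0 : volume {y : Fin (m + 1) → ℝ | y i = 0} = 0 := Measure.pi_hyperplane _ i 0
  rw [← measure_inter_add_sdiff S hm]
  congr 1
  refine measure_congr ?_
  rw [measure_eq_zero_iff_ae_notMem] at h0
  filter_upwards [h0] with y hy
  have hy : y i ≠ 0 := hy
  apply propext
  show (y ∈ S ∧ ¬ 0 < y i) ↔ (y ∈ S ∧ y i < 0)
  refine and_congr_right fun _ => ?_
  rw [not_lt]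
  exact ⟨fun h => lt_of_le_of_ne h hy, le_of_lt⟩

/-- The polar of `K - z` with respect to the standard dot product. -/
def polarAt {ι : Type*} [Fintype ι] (K : Set (ι → ℝ)) (z : ι → ℝ) : Set (ι → ℝ) :=
  {y | ∀ x ∈ K, (x - z) ⬝ᵥ y ≤ 1}

theorem isClosed_polarAt {ι : Type*} [Fintype ι] (K : Set (ι → ℝ)) (z : ι → ℝ) :
    IsClosed (polarAt K z) := by
  have : polarAt K z = ⋂ x ∈ K, {y | (x - z) ⬝ᵥ y ≤ 1} := by
    ext y; simp [polarAt]
  rw [this]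
  refine isClosed_biInter fun x _ => isClosed_le ?_ continuous_const
  exact continuous_const.dotProduct continuous_id

/-- The affine slices `{η | ⟨x', η⟩ + xᵢ ≤ r for all x ∈ K}` of the epigraph of the support
function of `K`, where `x'` collects the coordinates of `x` other than `i`. -/
def supportSlice {m : ℕ} (i : Fin (m + 1)) (K : Set (Fin (m + 1) → ℝ)) (r : ℝ) :
    Set (Fin m → ℝ) :=
  {η | ∀ x ∈ K, i.removeNth x ⬝ᵥ η + x i ≤ r}

theorem isClosed_supportSlice {m : ℕ} (i : Fin (m + 1)) (K : Set (Fin (m + 1) → ℝ)) (r : ℝ) :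
    IsClosed (supportSlice i K r) := by
  have : supportSlice i K r = ⋂ x ∈ K, {η | i.removeNth x ⬝ᵥ η + x i ≤ r} := by
    ext y; simp [supportSlice]
  rw [this]
  refine isClosed_biInter fun x _ => isClosed_le ?_ continuous_const
  exact (continuous_const.dotProduct continuous_id).add continuous_const

theorem supportSlice_mono {m : ℕ} (i : Fin (m + 1)) (K : Set (Fin (m + 1) → ℝ)) :
    Monotone (supportSlice i K) :=
  fun _ _ h _ hη x hx => (hη x hx).trans h

theorem measurable_volume_supportSlice {m : ℕ} (i : Fin (m + 1)) (K : Set (Fin (m + 1) → ℝ)) :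
    Measurable fun r => volume (supportSlice i K r) :=
  Monotone.measurable fun _ _ h => measure_mono (supportSlice_mono i K h)

theorem volume_slice_polarAt {m : ℕ} (i : Fin (m + 1)) (K : Set (Fin (m + 1) → ℝ)) (τ : ℝ)
    {s : ℝ} (hs : 0 < s) :
    volume {v : Fin m → ℝ | (i.insertNth s v : Fin (m + 1) → ℝ) ∈ polarAt K (Pi.single i τ)} =
      ENNReal.ofReal s ^ m * volume (supportSlice i K (s⁻¹ + τ)) := by
  have : {v : Fin m → ℝ | (i.insertNth s v : Fin (m + 1) → ℝ) ∈ polarAt K (Pi.single i τ)} =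
      s • supportSlice i K (s⁻¹ + τ) := by
    ext v
    rw [Set.mem_smul_set_iff_inv_smul_mem₀ hs.ne']
    refine forall₂_congr fun x _ => ?_
    have hr : i.removeNth (x - Pi.single i τ) = i.removeNth x := by
      ext j
      simp [Fin.removeNth]
    rw [dotProduct_eq_add_removeNth i, hr]
    simp only [Pi.sub_apply, Pi.single_eq_same, Fin.insertNth_apply_same, Fin.removeNth_insertNth,
      dotProduct_smul, smul_eq_mul]
    have h1 : s * s⁻¹ = 1 := mul_inv_cancel₀ hs.ne'
    rw [← mul_le_mul_iff_right₀ hs (b := s⁻¹ * _ + _)]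
    have : s * (s⁻¹ * i.removeNth x ⬝ᵥ v + x i) = i.removeNth x ⬝ᵥ v + s * x i := by
      rw [mul_add, ← mul_assoc, h1, one_mul]
    rw [this, mul_add, h1]
    constructor <;> intro h <;> nlinarith
  rw [this, Measure.addHaar_smul]
  simp [abs_of_pos hs, ENNReal.ofReal_pow hs.le]

theorem lintegral_Ioi_inv (f : ℝ → ℝ≥0∞) :
    ∫⁻ s in Set.Ioi (0 : ℝ), f s = ∫⁻ r in Set.Ioi (0 : ℝ), ENNReal.ofReal r⁻¹ ^ 2 * f r⁻¹ := by
  have himg : (fun r : ℝ => r⁻¹) '' Set.Ioi 0 = Set.Ioi 0 := by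
    ext x
    simp only [Set.mem_image, Set.mem_Ioi]
    exact ⟨fun ⟨y, hy, h⟩ => h ▸ inv_pos.2 hy, fun h => ⟨x⁻¹, inv_pos.2 h, inv_inv x⟩⟩
  have := lintegral_image_eq_lintegral_abs_deriv_mul (s := Set.Ioi (0 : ℝ))
    (f := fun r => r⁻¹) (f' := fun r => -(r ^ 2)⁻¹) measurableSet_Ioi
    (fun x hx => (hasDerivAt_inv (ne_of_gt hx)).hasDerivWithinAt)
    (inv_injective.injOn) f
  rw [himg] at this
  rw [this]
  refine setLIntegral_congr_fun measurableSet_Ioi fun r hr => ?_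
  have hr' : 0 < r := hr
  rw [abs_neg, abs_of_pos (by positivity), ← ENNReal.ofReal_pow (by positivity), inv_pow]

theorem setLIntegral_polarAt_pos {m : ℕ} (i : Fin (m + 1)) (K : Set (Fin (m + 1) → ℝ)) (τ : ℝ)
    {g : ℝ → ℝ≥0∞} (hg : Measurable g) :
    ∫⁻ y in polarAt K (Pi.single i τ) ∩ {y | 0 < y i}, g (y i) =
      ∫⁻ r in Set.Ioi (0 : ℝ),
        g r⁻¹ * (ENNReal.ofReal r⁻¹ ^ (m + 2) * volume (supportSlice i K (r + τ))) := by
  have hP : MeasurableSet (polarAt K (Pi.single i τ)) := (isClosed_polarAt _ _).measurableSet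
  have hm : MeasurableSet {y : Fin (m + 1) → ℝ | 0 < y i} :=
    measurableSet_lt measurable_const (measurable_pi_apply i)
  have hgi : Measurable fun y : Fin (m + 1) → ℝ => g (y i) := by fun_prop
  rw [← lintegral_indicator (hP.inter hm), lintegral_insertNth i (hgi.indicator (hP.inter hm))]
  have h1 : ∀ t : ℝ, ∫⁻ v : Fin m → ℝ, (polarAt K (Pi.single i τ) ∩ {y | 0 < y i}).indicator
      (fun y => g (y i)) (i.insertNth t v) =
      (Set.Ioi (0 : ℝ)).indicator (fun t => g t * (ENNReal.ofReal t ^ m *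
        volume (supportSlice i K (t⁻¹ + τ)))) t := by
    intro t
    by_cases ht : 0 < t
    · have hms : MeasurableSet {v : Fin m → ℝ |
          (i.insertNth t v : Fin (m + 1) → ℝ) ∈ polarAt K (Pi.single i τ)} :=
        ((measurable_insertNth i).comp measurable_prodMk_left) hP
      rw [Set.indicator_of_mem (show t ∈ Set.Ioi (0 : ℝ) from ht), ← volume_slice_polarAt i K τ ht,
        ← lintegral_indicator_one hms, ← lintegral_const_mul _ (measurable_one.indicator hms)]
      refine lintegral_congr fun v => ?_
      by_cases hv : (i.insertNth t v : Fin (m + 1) → ℝ) ∈ polarAt K (Pi.single i τ)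
      · have hv' : (i.insertNth t v : Fin (m + 1) → ℝ) ∈
            polarAt K (Pi.single i τ) ∩ {y | 0 < y i} := ⟨hv, by simpa using ht⟩
        rw [Set.indicator_of_mem hv', Set.indicator_of_mem (by exact hv)]
        simp
      · rw [Set.indicator_of_notMem (fun h => hv h.1), Set.indicator_of_notMem (by exact hv)]
        simp
    · rw [Set.indicator_of_notMem (show t ∉ Set.Ioi (0 : ℝ) from ht)]
      refine (lintegral_congr fun v => ?_).trans lintegral_zero
      exact Set.indicator_of_notMem (fun h => ht (by simpa using h.2)) _
  rw [lintegral_congr h1, lintegral_indicator measurableSet_Ioi, lintegral_Ioi_inv]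
  refine setLIntegral_congr_fun measurableSet_Ioi fun r _ => ?_
  simp only [inv_inv]
  ring

theorem measurePreserving_coordFlip {ι : Type*} [Fintype ι] [DecidableEq ι] (i : ι) :
    MeasurePreserving (coordFlip i) (volume : Measure (ι → ℝ)) volume := by
  have : coordFlip i = fun (x : ι → ℝ) j => (if j = i then (fun t => -t) else id : ℝ → ℝ) (x j) := by
    ext x j
    by_cases h : j = i
    · subst h; simp [coordFlip]
    · simp [coordFlip, h]
  rw [this]
  refine measurePreserving_pi _ _ fun j => ?_
  by_cases h : j = i
  · simp only [h, if_true]; exact Measure.measurePreserving_neg _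
  · simp only [h, if_false]; exact MeasurePreserving.id _

theorem coordFlip_coordFlip {ι : Type*} [DecidableEq ι] (i : ι) (x : ι → ℝ) :
    coordFlip i (coordFlip i x) = x := by
  ext j
  by_cases h : j = i
  · subst h; simp [coordFlip]
  · simp [coordFlip, h]

theorem coordFlip_same {ι : Type*} [DecidableEq ι] (i : ι) (x : ι → ℝ) :
    coordFlip i x i = -x i := by simp [coordFlip]

theorem coordFlip_of_ne {ι : Type*} [DecidableEq ι] {i j : ι} (h : j ≠ i) (x : ι → ℝ) :
    coordFlip i x j = x j := by simp [coordFlip, h]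

theorem coordFlip_dotProduct {ι : Type*} [Fintype ι] [DecidableEq ι] (i : ι) (x y : ι → ℝ) :
    coordFlip i x ⬝ᵥ y = x ⬝ᵥ coordFlip i y := by
  refine Finset.sum_congr rfl fun j _ => ?_
  by_cases h : j = i
  · subst h; simp [coordFlip]
  · simp [coordFlip, h]

theorem coordFlip_sub {ι : Type*} [DecidableEq ι] (i : ι) (x y : ι → ℝ) :
    coordFlip i (x - y) = coordFlip i x - coordFlip i y := by
  ext j
  by_cases h : j = i
  · subst h; simp [coordFlip]; ring
  · simp [coordFlip, h]

theorem coordFlip_mem_polarAt {ι : Type*} [Fintype ι] [DecidableEq ι] (i : ι) (K : Set (ι → ℝ))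
    (z y : ι → ℝ) :
    coordFlip i y ∈ polarAt K z ↔ y ∈ polarAt (coordFlip i '' K) (coordFlip i z) := by
  simp only [polarAt, Set.mem_ofPred_eq, Set.forall_mem_image]
  refine forall₂_congr fun x _ => ?_
  rw [← coordFlip_sub, coordFlip_dotProduct]

theorem coordFlip_single {ι : Type*} [DecidableEq ι] (i : ι) (τ : ℝ) :
    coordFlip i (Pi.single i τ) = Pi.single i (-τ) := by
  ext j
  by_cases h : j = i
  · subst h; simp [coordFlip]
  · simp [coordFlip, h]

theorem setLIntegral_polarAt_neg {m : ℕ} (i : Fin (m + 1)) (K : Set (Fin (m + 1) → ℝ)) (τ : ℝ)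
    {g : ℝ → ℝ≥0∞} (hg : Measurable g) :
    ∫⁻ y in polarAt K (Pi.single i τ) ∩ {y | y i < 0}, g (-y i) =
      ∫⁻ r in Set.Ioi (0 : ℝ), g r⁻¹ * (ENNReal.ofReal r⁻¹ ^ (m + 2) *
        volume (supportSlice i (coordFlip i '' K) (r - τ))) := by
  have hP : MeasurableSet (polarAt K (Pi.single i τ)) := (isClosed_polarAt _ _).measurableSet
  have hm : MeasurableSet {y : Fin (m + 1) → ℝ | y i < 0} :=
    measurableSet_lt (measurable_pi_apply i) measurable_const
  have h := setLIntegral_polarAt_pos i (coordFlip i '' K) (-τ) hg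
  simp only [← sub_eq_add_neg] at h
  have hgi : Measurable fun y : Fin (m + 1) → ℝ => g (-y i) := by fun_prop
  rw [← h, ← (measurePreserving_coordFlip i).setLIntegral_comp_preimage (hP.inter hm) hgi]
  have hpre : coordFlip i ⁻¹' (polarAt K (Pi.single i τ) ∩ {y | y i < 0}) =
      polarAt (coordFlip i '' K) (Pi.single i (-τ)) ∩ {y | 0 < y i} := by
    ext y
    rw [← coordFlip_single]
    refine and_congr (coordFlip_mem_polarAt i K _ y) ?_
    simp [coordFlip_same]
  rw [hpre]
  simp [coordFlip_same]

/-- The Steiner symmetrization of `K` in the `i`-th coordinate direction. -/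
def coordSteiner {ι : Type*} [DecidableEq ι] (i : ι) (K : Set (ι → ℝ)) : Set (ι → ℝ) :=
  {x | ∃ p ∈ K, ∃ q ∈ K, (∀ j, j ≠ i → p j = q j) ∧ Function.update p i ((p i - q i) / 2) = x}

section Steiner

variable {ι : Type*} [DecidableEq ι]

theorem isCompact_coordSteiner (i : ι) {K : Set (ι → ℝ)} (hK : IsCompact K) :
    IsCompact (coordSteiner i K) := by
  have h1 : IsCompact ((K ×ˢ K) ∩ {p : (ι → ℝ) × (ι → ℝ) | ∀ j, j ≠ i → p.1 j = p.2 j}) := by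
    refine (hK.prod hK).inter_right ?_
    have : {p : (ι → ℝ) × (ι → ℝ) | ∀ j, j ≠ i → p.1 j = p.2 j} =
        ⋂ j, ⋂ (_ : j ≠ i), {p : (ι → ℝ) × (ι → ℝ) | p.1 j = p.2 j} := by
      ext p; simp
    rw [this]
    exact isClosed_iInter fun j => isClosed_iInter fun _ => isClosed_eq (by fun_prop) (by fun_prop)
  have h2 : Continuous fun p : (ι → ℝ) × (ι → ℝ) => Function.update p.1 i ((p.1 i - p.2 i) / 2) :=
    continuous_fst.update i (by fun_prop)
  convert h1.image h2 using 1
  ext x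
  constructor
  · rintro ⟨p, hp, q, hq, hpq, rfl⟩
    exact ⟨(p, q), ⟨⟨hp, hq⟩, hpq⟩, rfl⟩
  · rintro ⟨⟨p, q⟩, ⟨⟨hp, hq⟩, hpq⟩, rfl⟩
    exact ⟨p, hp, q, hq, hpq, rfl⟩

theorem convex_coordSteiner (i : ι) {K : Set (ι → ℝ)} (hK : Convex ℝ K) :
    Convex ℝ (coordSteiner i K) := by
  rintro _ ⟨p, hp, q, hq, hpq, rfl⟩ _ ⟨p', hp', q', hq', hpq', rfl⟩ a b ha hb hab
  refine ⟨a • p + b • p', hK hp hp' ha hb hab, a • q + b • q', hK hq hq' ha hb hab, ?_, ?_⟩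
  · intro j hj
    simp [hpq j hj, hpq' j hj]
  · ext j
    by_cases hj : j = i
    · subst hj; simp; ring
    · simp [hj]

theorem coordFlip_mem_coordSteiner (i : ι) {K : Set (ι → ℝ)} {x : ι → ℝ}
    (hx : x ∈ coordSteiner i K) : coordFlip i x ∈ coordSteiner i K := by
  obtain ⟨p, hp, q, hq, hpq, rfl⟩ := hx
  refine ⟨q, hq, p, hp, fun j hj => (hpq j hj).symm, ?_⟩
  ext j
  by_cases hj : j = i
  · subst hj; simp [coordFlip]; ring
  · simp [coordFlip, hj, hpq j hj]

theorem coordFlip_mem_coordSteiner_of_ne {i j : ι} (hij : j ≠ i) {K : Set (ι → ℝ)}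
    (hK : ∀ x ∈ K, coordFlip j x ∈ K) {x : ι → ℝ} (hx : x ∈ coordSteiner i K) :
    coordFlip j x ∈ coordSteiner i K := by
  obtain ⟨p, hp, q, hq, hpq, rfl⟩ := hx
  refine ⟨_, hK p hp, _, hK q hq, ?_, ?_⟩
  · intro l hl
    by_cases hlj : l = j
    · subst hlj; simp [coordFlip, hpq l hl]
    · simp [coordFlip, hlj, hpq l hl]
  · ext l
    by_cases hl : l = i
    · subst hl; simp [coordFlip, hij.symm]
    · by_cases hlj : l = j
      · subst hlj; simp [coordFlip, hl]
      · simp [coordFlip, hl, hlj]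

theorem coordSteiner_sub (i : ι) (K : Set (ι → ℝ)) {z : ι → ℝ} (hz : z i = 0) :
    coordSteiner i ((fun x => x - z) '' K) = (fun x => x - z) '' coordSteiner i K := by
  ext x
  constructor
  · rintro ⟨_, ⟨p, hp, rfl⟩, _, ⟨q, hq, rfl⟩, hpq, rfl⟩
    refine ⟨_, ⟨p, hp, q, hq, fun j hj => ?_, rfl⟩, ?_⟩
    · simpa using hpq j hj
    · ext j
      by_cases hj : j = i
      · subst hj; simp [hz]
      · simp [hj]
  · rintro ⟨_, ⟨p, hp, q, hq, hpq, rfl⟩, rfl⟩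
    refine ⟨_, ⟨p, hp, rfl⟩, _, ⟨q, hq, rfl⟩, fun j hj => ?_, ?_⟩
    · simp [hpq j hj]
    · ext j
      by_cases hj : j = i
      · subst hj; simp [hz]
      · simp [hj]

end Steiner

theorem volume_half_sub {I : Set ℝ} (hI : IsCompact I) (hc : Convex ℝ I) :
    volume {t : ℝ | ∃ p ∈ I, ∃ q ∈ I, (p - q) / 2 = t} = volume I := by
  rcases I.eq_empty_or_nonempty with rfl | hne
  · simp
  have hconn : IsConnected I := ⟨hne, hc.isPreconnected⟩
  have := eq_Icc_of_connected_compact hconn hI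
  set a := sInf I
  set b := sSup I
  have hab : a ≤ b := by
    rw [this] at hne; exact Set.nonempty_Icc.1 hne
  have e : {t : ℝ | ∃ p ∈ I, ∃ q ∈ I, (p - q) / 2 = t} = Set.Icc (-((b - a) / 2)) ((b - a) / 2) := by
    rw [this]
    ext t
    constructor
    · rintro ⟨p, hp, q, hq, rfl⟩
      constructor <;> linarith [hp.1, hp.2, hq.1, hq.2]
    · rintro ⟨h1, h2⟩
      exact ⟨(a + b) / 2 + t, ⟨by linarith, by linarith⟩, (a + b) / 2 - t,
        ⟨by linarith, by linarith⟩, by ring⟩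
  rw [e, this, Real.volume_Icc, Real.volume_Icc]
  congr 1; ring

theorem lintegral_insertNth_symm {m : ℕ} (i : Fin (m + 1)) {F : (Fin (m + 1) → ℝ) → ℝ≥0∞}
    (hF : Measurable F) :
    ∫⁻ x, F x = ∫⁻ v : Fin m → ℝ, ∫⁻ t : ℝ, F (i.insertNth t v) := by
  rw [lintegral_insertNth i hF]
  exact lintegral_lintegral_swap (hF.comp (measurable_insertNth i)).aemeasurable

theorem setLIntegral_coordSteiner {m : ℕ} {i j : Fin (m + 1)} (hij : j ≠ i)
    {K : Set (Fin (m + 1) → ℝ)} (hK : IsCompact K) (hc : Convex ℝ K) {g : ℝ → ℝ≥0∞}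
    (hg : Measurable g) :
    ∫⁻ x in coordSteiner i K, g (x j) = ∫⁻ x in K, g (x j) := by
  have hgj : Measurable fun x : Fin (m + 1) → ℝ => g (x j) := by fun_prop
  have hS := (isCompact_coordSteiner i hK).measurableSet
  rw [← lintegral_indicator hS, ← lintegral_indicator hK.measurableSet,
    lintegral_insertNth_symm i (hgj.indicator hS),
    lintegral_insertNth_symm i (hgj.indicator hK.measurableSet)]
  refine lintegral_congr fun v => ?_
  obtain ⟨l, rfl⟩ := Fin.exists_succAbove_eq hij
  have key : ∀ {L : Set (Fin (m + 1) → ℝ)}, IsCompact L →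
      ∫⁻ t : ℝ, L.indicator (fun x => g (x (i.succAbove l))) (i.insertNth t v) =
        g (v l) * volume {t : ℝ | (i.insertNth t v : Fin (m + 1) → ℝ) ∈ L} := by
    intro L hL
    have hmL : MeasurableSet {t : ℝ | (i.insertNth t v : Fin (m + 1) → ℝ) ∈ L} :=
      ((measurable_insertNth i).comp measurable_prodMk_right) hL.measurableSet
    rw [← lintegral_indicator_one hmL, ← lintegral_const_mul _ (measurable_one.indicator hmL)]
    refine lintegral_congr fun t => ?_
    by_cases ht : (i.insertNth t v : Fin (m + 1) → ℝ) ∈ L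
    · rw [Set.indicator_of_mem ht, Set.indicator_of_mem (by exact ht)]
      simp
    · rw [Set.indicator_of_notMem ht, Set.indicator_of_notMem (by exact ht)]
      simp
  rw [key (isCompact_coordSteiner i hK), key hK]
  congr 1
  have hins : Continuous fun t : ℝ => (i.insertNth t v : Fin (m + 1) → ℝ) :=
    Continuous.finInsertNth i continuous_id continuous_const
  have hI : IsCompact {t : ℝ | (i.insertNth t v : Fin (m + 1) → ℝ) ∈ K} := by
    refine Metric.isCompact_of_isClosed_isBounded (hK.isClosed.preimage hins) ?_
    obtain ⟨R, hR⟩ := hK.isBounded.exists_norm_le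
    refine isBounded_iff_forall_norm_le.2 ⟨R, fun t ht => ?_⟩
    have := (norm_le_pi_norm (i.insertNth t v : Fin (m + 1) → ℝ) i).trans (hR _ ht)
    simpa using this
  have hIc : Convex ℝ {t : ℝ | (i.insertNth t v : Fin (m + 1) → ℝ) ∈ K} := by
    intro s hs t ht a b ha hb hab
    have := hc hs ht ha hb hab
    change (i.insertNth (a • s + b • t) v : Fin (m + 1) → ℝ) ∈ K
    convert this using 1
    ext l
    refine Fin.succAboveCases i ?_ (fun l => ?_) l
    · simp
    · simp [← add_mul, hab]
  rw [← volume_half_sub hI hIc]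
  congr 1
  ext t
  constructor
  · rintro ⟨p, hp, q, hq, hpq, h⟩
    have e : ∀ l, p (i.succAbove l) = v l := fun l => by
      have := congrFun h (i.succAbove l)
      simpa using this
    refine ⟨p i, ?_, q i, ?_, ?_⟩
    · change (i.insertNth (p i) v : Fin (m + 1) → ℝ) ∈ K
      convert hp using 1
      ext l
      refine Fin.succAboveCases i ?_ (fun l => ?_) l <;> simp [e]
    · change (i.insertNth (q i) v : Fin (m + 1) → ℝ) ∈ K
      convert hq using 1
      ext l
      refine Fin.succAboveCases i ?_ (fun l => ?_) l
      · simp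
      · simp [e, ← hpq (i.succAbove l) (Fin.succAbove_ne i l)]
    · have := congrFun h i
      simpa using this
  · rintro ⟨p, hp, q, hq, rfl⟩
    refine ⟨_, hp, _, hq, fun j hj => ?_, ?_⟩
    · obtain ⟨l, rfl⟩ := Fin.exists_succAbove_eq hj
      simp
    · simp

/-- The radial density of one half of the polar of `K - τ eᵢ`. -/
def sliceDensity {m : ℕ} (i : Fin (m + 1)) (K : Set (Fin (m + 1) → ℝ)) (τ : ℝ) : ℝ → ℝ≥0∞ :=
  (Set.Ioi (0 : ℝ)).indicator
    fun r => ENNReal.ofReal r⁻¹ ^ (m + 2) * volume (supportSlice i K (r + τ))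

theorem measurable_sliceDensity {m : ℕ} (i : Fin (m + 1)) (K : Set (Fin (m + 1) → ℝ)) (τ : ℝ) :
    Measurable (sliceDensity i K τ) := by
  refine Measurable.indicator (Measurable.mul (by fun_prop) ?_) measurableSet_Ioi
  exact (measurable_volume_supportSlice i K).comp (measurable_id.add_const τ)

section SliceSup

variable {m : ℕ} {i : Fin (m + 1)} {K : Set (Fin (m + 1) → ℝ)}

theorem iSup_sliceDensity_mono : Monotone fun τ => ⨆ r, sliceDensity i K τ r := by
  intro τ τ' h
  refine iSup_mono fun r => ?_
  unfold sliceDensity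
  refine Set.indicator_le_indicator ?_
  gcongr
  exact supportSlice_mono i K (by linarith)

theorem supportSlice_eq_empty {t ρ : ℝ} (ht : Pi.single i t ∈ K) (hρ : ρ < t) :
    supportSlice i K ρ = ∅ := by
  refine Set.eq_empty_of_forall_notMem fun η hη => ?_
  have h := hη _ ht
  have h0 : i.removeNth (Pi.single i t : Fin (m + 1) → ℝ) = 0 := by
    ext j; simp [Fin.removeNth]
  rw [h0, zero_dotProduct, Pi.single_eq_same, zero_add] at h
  linarith

theorem pow_mul_iSup_sliceDensity_le {t τ τ' : ℝ} (ht : Pi.single i t ∈ K) (h : τ ≤ τ')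
    (h' : τ' < t) :
    ENNReal.ofReal (t - τ') ^ (m + 2) * (⨆ r, sliceDensity i K τ' r) ≤
      ENNReal.ofReal (t - τ) ^ (m + 2) * (⨆ r, sliceDensity i K τ r) := by
  rw [ENNReal.mul_iSup]
  refine iSup_le fun r => ?_
  by_cases hr : 0 < r
  · rw [sliceDensity, Set.indicator_of_mem (show r ∈ Set.Ioi (0 : ℝ) from hr)]
    by_cases hrt : r + τ' < t
    · simp [supportSlice_eq_empty ht hrt]
    · rw [not_lt] at hrt
      have hr2 : 0 < r + (τ' - τ) := by linarith
      refine le_trans ?_ (mul_le_mul_right (le_iSup _ (r + (τ' - τ))) _)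
      rw [sliceDensity, Set.indicator_of_mem (show r + (τ' - τ) ∈ Set.Ioi (0 : ℝ) from hr2),
        ← mul_assoc, ← mul_assoc, ← mul_pow, ← mul_pow, ← ENNReal.ofReal_mul (by linarith),
        ← ENNReal.ofReal_mul (by linarith)]
      have e : r + (τ' - τ) + τ = r + τ' := by ring
      rw [e]
      have : (t - τ') * r⁻¹ ≤ (t - τ) * (r + (τ' - τ))⁻¹ := by
        rw [← div_eq_mul_inv, ← div_eq_mul_inv, div_le_div_iff₀ hr hr2]
        nlinarith
      gcongr
  · rw [sliceDensity, Set.indicator_of_notMem (show r ∉ Set.Ioi (0 : ℝ) from hr)]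
    simp

theorem update_mem_of_closedBall_subset {t δ : ℝ}
    (hb : Metric.closedBall (Pi.single i t) δ ⊆ K) (j : Fin (m + 1)) {s : ℝ} (hs : |s| ≤ δ) :
    (Pi.single i t : Fin (m + 1) → ℝ) + Pi.single j s ∈ K := by
  apply hb
  rw [mem_closedBall_iff_norm, add_sub_cancel_left, Pi.norm_single]
  exact hs

theorem iSup_sliceDensity_lt_top {t : ℝ} (ht : Pi.single i t ∈ interior K) :
    (⨆ r, sliceDensity i K t r) < ⊤ := by
  obtain ⟨δ, hδ, hb⟩ := Metric.nhds_basis_closedBall.mem_iff.1 (mem_interior_iff_mem_nhds.1 ht)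
  refine lt_of_le_of_lt (b := ENNReal.ofReal δ⁻¹ ^ 2 * ENNReal.ofReal (2 / δ) ^ m) ?_ ?_
  · refine iSup_le fun r => ?_
    by_cases hr : 0 < r
    · rw [sliceDensity, Set.indicator_of_mem (show r ∈ Set.Ioi (0 : ℝ) from hr)]
      by_cases hrd : r < δ
      · have h1 : (Pi.single i (t + δ) : Fin (m + 1) → ℝ) ∈ K := by
          rw [Pi.single_add]
          exact update_mem_of_closedBall_subset hb i (abs_of_pos hδ).le
        rw [supportSlice_eq_empty h1 (by linarith)]
        simp
      · rw [not_lt] at hrd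
        have hsub : supportSlice i K (r + t) ⊆ Metric.closedBall 0 (r / δ) := by
          intro η hη
          rw [mem_closedBall_zero_iff, pi_norm_le_iff_of_nonneg (by positivity)]
          intro j
          have key : ∀ s : ℝ, |s| ≤ δ → s * η j ≤ r := by
            intro s hs
            have h1 := hη _ (update_mem_of_closedBall_subset hb (i.succAbove j) hs)
            have h2 : i.removeNth ((Pi.single i t : Fin (m + 1) → ℝ) +
                Pi.single (i.succAbove j) s) = Pi.single j s := by
              ext l
              by_cases hl : l = j
              · subst hl; simp [Fin.removeNth]
              · simp [Fin.removeNth, hl]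
            rw [h2, single_dotProduct] at h1
            simp at h1
            linarith
          have k1 := key δ (abs_of_pos hδ).le
          have k2 := key (-δ) (by rw [abs_neg, abs_of_pos hδ])
          rw [Real.norm_eq_abs, le_div_iff₀ hδ]
          nth_rewrite 1 [← abs_of_pos hδ]
          rw [← abs_mul]
          exact abs_le.2 ⟨by linarith, by linarith⟩
        have hv : volume (supportSlice i K (r + t)) ≤ ENNReal.ofReal (2 * (r / δ)) ^ m := by
          refine (measure_mono hsub).trans_eq ?_
          rw [Real.volume_pi_closedBall _ (by positivity), Fintype.card_fin,
            ENNReal.ofReal_pow (by positivity)]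
        calc _ ≤ ENNReal.ofReal r⁻¹ ^ (m + 2) * ENNReal.ofReal (2 * (r / δ)) ^ m := by gcongr
          _ = ENNReal.ofReal r⁻¹ ^ 2 * (ENNReal.ofReal r⁻¹ * ENNReal.ofReal (2 * (r / δ))) ^ m := by
            rw [mul_pow]; ring
          _ = ENNReal.ofReal r⁻¹ ^ 2 * ENNReal.ofReal (2 / δ) ^ m := by
            rw [← ENNReal.ofReal_mul (by positivity)]
            congr 3
            field_simp
          _ ≤ _ := by gcongr
    · rw [sliceDensity, Set.indicator_of_notMem (show r ∉ Set.Ioi (0 : ℝ) from hr)]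
      exact bot_le
  · exact ENNReal.mul_lt_top (by simp) (by simp)

theorem exists_mem_supportSlice (hc : Convex ℝ K) {t₀ t : ℝ}
    (ht₀ : Pi.single i t₀ ∈ interior K) (ht : Pi.single i t ∉ interior K) (htt : t₀ < t) :
    (supportSlice i K t).Nonempty := by
  obtain ⟨f, hf⟩ := geometric_hahn_banach_open_point hc.interior isOpen_interior ht
  have hrep : ∀ x, f x = x i * f (Pi.single i 1) + i.removeNth x ⬝ᵥ
      (fun j => f (Pi.single (i.succAbove j) 1)) := by
    intro x
    conv_lhs => rw [← Finset.univ_sum_single x]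
    rw [map_sum, Fin.sum_univ_succAbove _ i]
    have h : ∀ j, f (Pi.single j (x j)) = x j * f (Pi.single j 1) := by
      intro j
      have : (Pi.single j (x j) : Fin (m + 1) → ℝ) = x j • Pi.single j 1 := by
        rw [← Pi.single_smul]; simp
      rw [this, map_smul, smul_eq_mul]
    simp only [h]
    rfl
  have hs : ∀ s : ℝ, f (Pi.single i s) = s * f (Pi.single i 1) := by
    intro s
    have : (Pi.single i s : Fin (m + 1) → ℝ) = s • Pi.single i 1 := by
      rw [← Pi.single_smul]; simp
    rw [this, map_smul, smul_eq_mul]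
  set c := f (Pi.single i 1) with hcdef
  have hc0 : 0 < c := by
    have := hf _ ht₀
    rw [hs, hs t] at this
    by_contra h
    nlinarith
  refine ⟨fun j => c⁻¹ * f (Pi.single (i.succAbove j) 1), fun x hx => ?_⟩
  have hle : f x ≤ t * c := by
    rw [← hs]
    have hcl : x ∈ closure (interior K) := by
      rw [hc.closure_interior_eq_closure_of_nonempty_interior ⟨_, ht₀⟩]
      exact subset_closure hx
    have hclosed : IsClosed {y | f y ≤ f (Pi.single i t)} :=
      isClosed_le f.continuous continuous_const
    exact closure_minimal (fun y hy => (hf y hy).le) hclosed hcl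
  rw [hrep] at hle
  have e : (i.removeNth x ⬝ᵥ fun j => c⁻¹ * f (Pi.single (i.succAbove j) 1)) =
      c⁻¹ * (i.removeNth x ⬝ᵥ fun j => f (Pi.single (i.succAbove j) 1)) := by
    rw [← smul_eq_mul, ← dotProduct_smul]; rfl
  rw [e]
  have h1 : c⁻¹ * c = 1 := inv_mul_cancel₀ hc0.ne'
  have := mul_le_mul_of_nonneg_left hle (inv_pos.2 hc0).le
  calc _ = c⁻¹ * (x i * c + (i.removeNth x ⬝ᵥ fun j => f (Pi.single (i.succAbove j) 1))) := by
        rw [mul_add, mul_left_comm, h1]; ring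
    _ ≤ c⁻¹ * (t * c) := this
    _ = t := by rw [mul_left_comm, h1, mul_one]

theorem le_iSup_sliceDensity_of_mem {R t τ : ℝ} (hR : 0 < R)
    (hKR : ∀ x ∈ K, ∀ j, |x j| ≤ R) (h : (supportSlice i K t).Nonempty) (hτ : τ < t) :
    ENNReal.ofReal (2 * (t - τ))⁻¹ ^ 2 * ENNReal.ofReal (((m : ℝ) + 1) * R)⁻¹ ^ m ≤
      ⨆ r, sliceDensity i K τ r := by
  obtain ⟨η₀, hη₀⟩ := h
  set d := t - τ with hd
  have hd0 : 0 < d := by linarith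
  refine le_trans ?_ (le_iSup _ (2 * d))
  rw [sliceDensity, Set.indicator_of_mem (show 2 * d ∈ Set.Ioi (0 : ℝ) from by
    simp only [Set.mem_Ioi]; linarith)]
  have e : 2 * d + τ = t + d := by rw [hd]; ring
  rw [e]
  have hsub : Metric.closedBall η₀ (d / ((m + 1) * R)) ⊆ supportSlice i K (t + d) := by
    intro η hη x hx
    have h1 := hη₀ x hx
    have h2 : i.removeNth x ⬝ᵥ (η - η₀) ≤ d := by
      have hn : ∀ j, |(η - η₀) j| ≤ d / ((m + 1) * R) := by
        intro j
        rw [mem_closedBall_iff_norm] at hη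
        exact (norm_le_pi_norm (η - η₀) j).trans hη
      calc i.removeNth x ⬝ᵥ (η - η₀) ≤ ∑ _j : Fin m, R * (d / ((m + 1) * R)) := by
            refine Finset.sum_le_sum fun j _ => ?_
            refine (le_abs_self _).trans ?_
            rw [abs_mul]
            exact mul_le_mul (hKR x hx _) (hn j) (abs_nonneg _) hR.le
        _ = m * (d / (m + 1)) := by
            simp; left; field_simp
        _ ≤ d := by
            rw [mul_div_assoc', div_le_iff₀ (by positivity)]
            nlinarith
    rw [dotProduct_sub] at h2
    linarith
  calc _ = ENNReal.ofReal (2 * d)⁻¹ ^ 2 * (ENNReal.ofReal (2 * d)⁻¹ *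
        ENNReal.ofReal (2 * (d / ((m + 1) * R)))) ^ m := by
        rw [← ENNReal.ofReal_mul (by positivity)]
        congr 3
        field_simp
    _ = ENNReal.ofReal (2 * d)⁻¹ ^ (m + 2) * ENNReal.ofReal (2 * (d / ((m + 1) * R))) ^ m := by
        rw [mul_pow]; ring
    _ ≤ _ := by
        gcongr
        refine le_trans (le_of_eq ?_) (measure_mono hsub)
        rw [Real.volume_pi_closedBall _ (by positivity), Fintype.card_fin,
            ENNReal.ofReal_pow (by positivity)]

/-- The last point of `K` on the `i`-th axis. -/
theorem exists_axis_endpoint (hK : IsCompact K) (hc : Convex ℝ K) {t₀ : ℝ}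
    (ht₀ : Pi.single i t₀ ∈ interior K) :
    ∃ t, t₀ < t ∧ Pi.single i t ∈ K ∧ Pi.single i t ∉ interior K ∧
      (∀ s, Pi.single i s ∈ interior K → s < t) ∧
      ∀ s, t₀ ≤ s → s < t → Pi.single i s ∈ interior K := by
  have hcont : Continuous fun t : ℝ => (Pi.single i t : Fin (m + 1) → ℝ) :=
    continuous_single (A := fun _ : Fin (m + 1) => ℝ) i
  have hI : IsCompact {t : ℝ | (Pi.single i t : Fin (m + 1) → ℝ) ∈ K} := by
    refine Metric.isCompact_of_isClosed_isBounded (hK.isClosed.preimage hcont) ?_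
    obtain ⟨R, hR⟩ := hK.isBounded.exists_norm_le
    refine isBounded_iff_forall_norm_le.2 ⟨R, fun t ht => ?_⟩
    have := hR _ ht
    rwa [Pi.norm_single] at this
  have ht₀K : (Pi.single i t₀ : Fin (m + 1) → ℝ) ∈ K := interior_subset ht₀
  obtain ⟨t, htK, htmax⟩ := hI.exists_isMaxOn ⟨t₀, ht₀K⟩ continuous_id.continuousOn
  have hlt : ∀ s, Pi.single i s ∈ interior K → s < t := by
    intro s hs
    have hopen : IsOpen {t : ℝ | (Pi.single i t : Fin (m + 1) → ℝ) ∈ interior K} :=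
      isOpen_interior.preimage hcont
    obtain ⟨ε, hε, hb⟩ := Metric.isOpen_iff.1 hopen s hs
    have h1 : s + ε / 2 ∈ Metric.ball s ε := by
      rw [Metric.mem_ball, Real.dist_eq, add_sub_cancel_left, abs_of_pos (by linarith)]; linarith
    have h3 : (Pi.single i (s + ε / 2) : Fin (m + 1) → ℝ) ∈ K := interior_subset (hb h1)
    have h2 : s + ε / 2 ≤ t := htmax h3
    linarith
  refine ⟨t, hlt _ ht₀, htK, fun h => lt_irrefl _ (hlt _ h), hlt, fun s hs hst => ?_⟩
  rcases hs.eq_or_lt with rfl | hs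
  · exact ht₀
  · refine hc.openSegment_interior_self_subset_interior ht₀ htK ?_
    refine ⟨(t - s) / (t - t₀), (s - t₀) / (t - t₀), div_pos (by linarith) (by linarith),
      div_pos (by linarith) (by linarith), ?_, ?_⟩
    · rw [← add_div, div_eq_one_iff_eq (by linarith)]; ring
    · rw [← Pi.single_smul, ← Pi.single_smul, ← Pi.single_add]
      congr 1
      simp only [smul_eq_mul]
      have : t - t₀ ≠ 0 := by linarith
      field_simp
      ring

theorem continuousOn_iSup_sliceDensity (hK : IsCompact K) (hc : Convex ℝ K) :
    ContinuousOn (fun τ => (⨆ r, sliceDensity i K τ r).toReal)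
      {τ | Pi.single i τ ∈ interior K} := by
  intro τ hτ
  obtain ⟨t, ht, htK, -, hlt, -⟩ := exists_axis_endpoint hK hc hτ
  set S := fun τ => (⨆ r, sliceDensity i K τ r).toReal with hS
  have hmono : ∀ a b, Pi.single i b ∈ interior K → a ≤ b → S a ≤ S b := by
    intro a b hb hab
    exact ENNReal.toReal_mono (iSup_sliceDensity_lt_top hb).ne (iSup_sliceDensity_mono hab)
  have hanti : ∀ a b, Pi.single i a ∈ interior K → Pi.single i b ∈ interior K → a ≤ b →
      (t - b) ^ (m + 2) * S b ≤ (t - a) ^ (m + 2) * S a := by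
    intro a b ha hb hab
    have h := pow_mul_iSup_sliceDensity_le (K := K) (i := i) htK hab (hlt b hb)
    have h2 := ENNReal.toReal_mono (ENNReal.mul_ne_top (by simp)
      (iSup_sliceDensity_lt_top ha).ne) h
    rwa [ENNReal.toReal_mul, ENNReal.toReal_mul, ENNReal.toReal_pow, ENNReal.toReal_pow,
      ENNReal.toReal_ofReal (by linarith [hlt b hb]),
      ENNReal.toReal_ofReal (by linarith [hlt a ha])] at h2
  have hw : ContinuousAt (fun s => (t - τ) ^ (m + 2) / (t - s) ^ (m + 2) * S τ) τ := by
    refine ContinuousAt.mul (ContinuousAt.div (by fun_prop) (by fun_prop) ?_) continuousAt_const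
    have : 0 < t - τ := by linarith
    positivity
  have hval : (t - τ) ^ (m + 2) / (t - τ) ^ (m + 2) * S τ = S τ := by
    rw [div_self, one_mul]
    have : 0 < t - τ := by linarith
    positivity
  have hlim := hw.tendsto
  rw [hval] at hlim
  refine tendsto_of_tendsto_of_tendsto_of_le_of_le'
    (g := fun s => min (S τ) ((t - τ) ^ (m + 2) / (t - s) ^ (m + 2) * S τ))
    (h := fun s => max (S τ) ((t - τ) ^ (m + 2) / (t - s) ^ (m + 2) * S τ)) ?_ ?_ ?_ ?_
  · have := (tendsto_const_nhds (x := S τ)).min hlim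
    rw [min_self] at this
    exact this.mono_left nhdsWithin_le_nhds
  · have := (tendsto_const_nhds (x := S τ)).max hlim
    rw [max_self] at this
    exact this.mono_left nhdsWithin_le_nhds
  · filter_upwards [self_mem_nhdsWithin] with s hs
    have hst : 0 < (t - s) ^ (m + 2) := pow_pos (by linarith [hlt s hs]) _
    rcases le_total τ s with h | h
    · exact (min_le_left _ _).trans (hmono _ _ hs h)
    · refine (min_le_right _ _).trans ?_
      rw [div_mul_eq_mul_div, div_le_iff₀ hst, mul_comm (S s)]
      exact hanti s τ hs hτ h
  · filter_upwards [self_mem_nhdsWithin] with s hs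
    have hst : 0 < (t - s) ^ (m + 2) := pow_pos (by linarith [hlt s hs]) _
    rcases le_total τ s with h | h
    · refine le_trans ?_ (le_max_right _ _)
      rw [div_mul_eq_mul_div, le_div_iff₀ hst, mul_comm (S s)]
      exact hanti τ s hτ hs h
    · exact (hmono _ _ hτ h).trans (le_max_left _ _)

theorem exists_lt_iSup_sliceDensity (hK : IsCompact K) (hc : Convex ℝ K) {t₀ : ℝ}
    (ht₀ : Pi.single i t₀ ∈ interior K) {N : ℝ≥0∞} (hN : N ≠ ⊤) :
    ∃ τ, t₀ ≤ τ ∧ Pi.single i τ ∈ interior K ∧ N ≤ ⨆ r, sliceDensity i K τ r := by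
  obtain ⟨t, ht, htK, htn, hlt, hin⟩ := exists_axis_endpoint hK hc ht₀
  obtain ⟨R, hR0, hR⟩ := hK.isBounded.exists_pos_norm_le
  have hKR : ∀ x ∈ K, ∀ j, |x j| ≤ R := fun x hx j => (norm_le_pi_norm x j).trans (hR x hx)
  have hne := exists_mem_supportSlice hc ht₀ htn ht
  set c := ENNReal.ofReal (((m : ℝ) + 1) * R)⁻¹ ^ m with hcdef
  have hc0 : c ≠ 0 := by
    apply pow_ne_zero
    rw [ne_eq, ENNReal.ofReal_eq_zero, not_le]
    positivity
  have hlim : Tendsto (fun τ => ENNReal.ofReal (2 * (t - τ))⁻¹ ^ 2 * c) (𝓝[<] t) (𝓝 ⊤) := by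
    have h1 : Tendsto (fun τ => (2 * (t - τ))⁻¹) (𝓝[<] t) atTop := by
      apply Tendsto.inv_tendsto_nhdsGT_zero
      refine tendsto_nhdsWithin_iff.2 ⟨?_, ?_⟩
      · have : Tendsto (fun τ => 2 * (t - τ)) (𝓝 t) (𝓝 (2 * (t - t))) :=
          Continuous.tendsto (by fun_prop) t
        rw [sub_self, mul_zero] at this
        exact this.mono_left nhdsWithin_le_nhds
      · filter_upwards [self_mem_nhdsWithin] with τ hτ
        have : τ < t := hτ
        simp only [Set.mem_Ioi]; linarith
    have h2 : Tendsto (fun τ => ENNReal.ofReal (2 * (t - τ))⁻¹ ^ 2) (𝓝[<] t) (𝓝 ⊤) := by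
      have := (ENNReal.continuous_pow 2).tendsto ⊤
      rw [ENNReal.top_pow (by norm_num)] at this
      exact this.comp (ENNReal.tendsto_ofReal_atTop.comp h1)
    have := ENNReal.Tendsto.mul_const (b := c) h2 (Or.inl (by simp))
    rwa [ENNReal.top_mul hc0] at this
  have hev : ∀ᶠ τ in 𝓝[<] t, N < ENNReal.ofReal (2 * (t - τ))⁻¹ ^ 2 * c :=
    hlim.eventually (lt_mem_nhds (lt_top_iff_ne_top.2 hN))
  have hev2 : ∀ᶠ τ in 𝓝[<] t, τ ∈ Set.Ico t₀ t := by
    filter_upwards [self_mem_nhdsWithin, mem_nhdsWithin_of_mem_nhds (lt_mem_nhds ht)] with τ h1 h2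
    exact ⟨le_of_lt h2, h1⟩
  obtain ⟨τ, h1, h2⟩ := (hev.and hev2).exists
  exact ⟨τ, h2.1, hin τ h2.1 h2.2, h1.le.trans (le_iSup_sliceDensity_of_mem hR0 hKR hne h2.2)⟩

end SliceSup

theorem continuous_coordFlip {ι : Type*} [DecidableEq ι] (i : ι) :
    Continuous (coordFlip i : (ι → ℝ) → ι → ℝ) :=
  continuous_id.update i (by fun_prop)

/-- `coordFlip` as a homeomorphism. -/
def coordFlipHomeomorph {ι : Type*} [DecidableEq ι] (i : ι) : (ι → ℝ) ≃ₜ (ι → ℝ) where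
  toFun := coordFlip i
  invFun := coordFlip i
  left_inv := coordFlip_coordFlip i
  right_inv := coordFlip_coordFlip i
  continuous_toFun := continuous_coordFlip i
  continuous_invFun := continuous_coordFlip i

theorem coordFlip_mem_interior_image {ι : Type*} [DecidableEq ι] (i : ι) {K : Set (ι → ℝ)}
    {x : ι → ℝ} : coordFlip i x ∈ interior (coordFlip i '' K) ↔ x ∈ interior K := by
  have h := (coordFlipHomeomorph i).image_interior K
  change coordFlip i '' interior K = interior (coordFlip i '' K) at h
  rw [← h]
  exact ((coordFlipHomeomorph i).injective).mem_set_image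

theorem convex_image_coordFlip {ι : Type*} [DecidableEq ι] (i : ι) {K : Set (ι → ℝ)}
    (hc : Convex ℝ K) : Convex ℝ (coordFlip i '' K) := by
  rintro _ ⟨x, hx, rfl⟩ _ ⟨y, hy, rfl⟩ a b ha hb hab
  refine ⟨_, hc hx hy ha hb hab, ?_⟩
  ext j
  by_cases hj : j = i
  · subst hj; simp [coordFlip]; ring
  · simp [coordFlip, hj]

theorem volume_polarAt_single {m : ℕ} (i : Fin (m + 1)) (K : Set (Fin (m + 1) → ℝ)) (τ : ℝ) :
    volume (polarAt K (Pi.single i τ)) =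
      (∫⁻ r, sliceDensity i K τ r) + ∫⁻ r, sliceDensity i (coordFlip i '' K) (-τ) r := by
  have h1 := setLIntegral_polarAt_pos i K τ (g := 1) measurable_one
  have h2 := setLIntegral_polarAt_neg i K τ (g := 1) measurable_one
  simp only [Pi.one_apply, one_mul, setLIntegral_const, sub_eq_add_neg] at h1 h2
  unfold sliceDensity
  rw [volume_eq_add_coord i, h1, h2, lintegral_indicator measurableSet_Ioi,
    lintegral_indicator measurableSet_Ioi]

theorem exists_iSup_sliceDensity_eq {m : ℕ} {i : Fin (m + 1)} {K : Set (Fin (m + 1) → ℝ)}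
    (hK : IsCompact K) (hc : Convex ℝ K) {t₀ : ℝ} (ht₀ : Pi.single i t₀ ∈ interior K) :
    ∃ τ, Pi.single i τ ∈ interior K ∧
      ⨆ r, sliceDensity i K τ r = ⨆ r, sliceDensity i (coordFlip i '' K) (-τ) r := by
  set K' := coordFlip i '' K with hK'
  have hflip : ∀ t, Pi.single i (-t) ∈ interior K' ↔ Pi.single i t ∈ interior K := by
    intro t
    rw [← coordFlip_single]
    exact coordFlip_mem_interior_image i
  have hK'c : IsCompact K' := hK.image (continuous_coordFlip i)
  have hc' : Convex ℝ K' := convex_image_coordFlip i hc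
  set S := fun τ => ⨆ r, sliceDensity i K τ r with hS
  set T := fun τ => ⨆ r, sliceDensity i K' (-τ) r with hT
  have hSfin : ∀ τ, Pi.single i τ ∈ interior K → S τ ≠ ⊤ :=
    fun τ hτ => (iSup_sliceDensity_lt_top hτ).ne
  have hTfin : ∀ τ, Pi.single i τ ∈ interior K → T τ ≠ ⊤ :=
    fun τ hτ => (iSup_sliceDensity_lt_top ((hflip τ).2 hτ)).ne
  have hTanti : ∀ a b, a ≤ b → T b ≤ T a := fun a b hab =>
    iSup_sliceDensity_mono (i := i) (K := K') (neg_le_neg hab)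
  obtain ⟨b, hb0, hbI, hb⟩ := exists_lt_iSup_sliceDensity hK hc ht₀ (hTfin _ ht₀)
  obtain ⟨a, ha0, haI, ha⟩ := exists_lt_iSup_sliceDensity hK'c hc' ((hflip t₀).2 ht₀) (hSfin _ ht₀)
  have haI' : Pi.single i (-a) ∈ interior K := (hflip (-a)).1 (by rwa [neg_neg])
  have hbSle : T b ≤ S b := (hTanti _ _ hb0).trans hb
  have haTle : S (-a) ≤ T (-a) := by
    refine le_trans (iSup_sliceDensity_mono (i := i) (K := K) (by linarith : -a ≤ t₀)) ?_
    simp only [hT, neg_neg]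
    exact ha
  have hIconn : IsPreconnected {τ : ℝ | Pi.single i τ ∈ interior K} := by
    refine Convex.isPreconnected ?_
    intro x hx y hy u v hu hv huv
    have := hc.interior hx hy hu hv huv
    rwa [← Pi.single_smul, ← Pi.single_smul, ← Pi.single_add] at this
  have hScont : ContinuousOn (fun τ => (S τ).toReal) {τ : ℝ | Pi.single i τ ∈ interior K} :=
    continuousOn_iSup_sliceDensity hK hc
  have hTcont : ContinuousOn (fun τ => (T τ).toReal) {τ : ℝ | Pi.single i τ ∈ interior K} :=
    (continuousOn_iSup_sliceDensity hK'c hc').comp continuous_neg.continuousOn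
      fun τ hτ => (hflip τ).2 hτ
  obtain ⟨τ, hτ, hτeq⟩ := hIconn.intermediate_value₂ haI' hbI hScont hTcont
    (ENNReal.toReal_mono (hTfin _ haI') haTle) (ENNReal.toReal_mono (hSfin _ hbI) hbSle)
  exact ⟨τ, hτ, (ENNReal.toReal_eq_toReal_iff' (hSfin _ hτ) (hTfin _ hτ)).1 hτeq⟩

theorem volume_smul_supportSlice {m : ℕ} (i : Fin (m + 1)) (K : Set (Fin (m + 1) → ℝ)) (ρ : ℝ)
    {a : ℝ} (ha : 0 ≤ a) :
    volume (a • supportSlice i K ρ) = ENNReal.ofReal a ^ m * volume (supportSlice i K ρ) := by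
  rw [Measure.addHaar_smul]
  simp [abs_of_nonneg ha, ENNReal.ofReal_pow ha]

theorem sliceDensity_eq {m : ℕ} (i : Fin (m + 1)) (K : Set (Fin (m + 1) → ℝ)) (τ : ℝ) {r : ℝ}
    (hr : 0 < r) :
    sliceDensity i K τ r = ENNReal.ofReal r⁻¹ ^ 2 * volume (r⁻¹ • supportSlice i K (r + τ)) := by
  rw [sliceDensity, Set.indicator_of_mem (show r ∈ Set.Ioi (0 : ℝ) from hr),
    volume_smul_supportSlice i K _ (inv_pos.2 hr).le]
  ring

theorem add_half_mem_supportSlice_coordSteiner {m : ℕ} {i : Fin (m + 1)}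
    {K : Set (Fin (m + 1) → ℝ)} {a b : ℝ} {η η' : Fin m → ℝ} (hη : η ∈ supportSlice i K a)
    (hη' : η' ∈ supportSlice i (coordFlip i '' K) b) :
    (1 / 2 : ℝ) • (η + η') ∈ supportSlice i (coordSteiner i K) ((a + b) / 2) := by
  rintro _ ⟨p, hp, q, hq, hpq, rfl⟩
  have h1 := hη p hp
  have h2 := hη' _ ⟨q, hq, rfl⟩
  have e1 : i.removeNth (coordFlip i q) = i.removeNth p := by
    ext j
    simp [Fin.removeNth, coordFlip, hpq]
  have e2 : i.removeNth (Function.update p i ((p i - q i) / 2)) = i.removeNth p := by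
    ext j
    simp [Fin.removeNth]
  rw [e1, coordFlip_same] at h2
  rw [e2, dotProduct_smul, dotProduct_add, Function.update_self, smul_eq_mul]
  linarith

theorem min_sliceDensity_le {m : ℕ} (i : Fin (m + 1)) (K : Set (Fin (m + 1) → ℝ)) (τ r s : ℝ) :
    min (sliceDensity i K τ r) (sliceDensity i (coordFlip i '' K) (-τ) s) ≤
      sliceDensity i (coordSteiner i K) 0 ((1 - 1 / 2) * r + 1 / 2 * s) := by
  by_cases hr : 0 < r
  swap
  · have : sliceDensity i K τ r = 0 := Set.indicator_of_notMem hr _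
    simp [this]
  by_cases hs : 0 < s
  swap
  · have : sliceDensity i (coordFlip i '' K) (-τ) s = 0 := Set.indicator_of_notMem hs _
    simp [this]
  have e : (1 - 1 / 2) * r + 1 / 2 * s = (r + s) / 2 := by ring
  have hrs : 0 < (r + s) / 2 := by positivity
  rw [e, sliceDensity_eq _ _ _ hr, sliceDensity_eq _ _ _ hs, sliceDensity_eq _ _ _ hrs]
  set A := r⁻¹ • supportSlice i K (r + τ) with hA
  set B := s⁻¹ • supportSlice i (coordFlip i '' K) (s + -τ) with hB
  set C := ((r + s) / 2)⁻¹ • supportSlice i (coordSteiner i K) ((r + s) / 2 + 0) with hC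
  set β := s / (r + s) with hβ
  have hβ0 : 0 < β := by positivity
  have hβ1 : β < 1 := by rw [hβ, div_lt_one (by positivity)]; linarith
  have hβ1' : 0 < 1 - β := by linarith
  have hβ' : 1 - β = r / (r + s) := by
    rw [hβ]; field_simp; ring
  have hmeas : ∀ {L : Set (Fin (m + 1) → ℝ)} {ρ c : ℝ}, 0 < c →
      MeasurableSet (c • supportSlice i L ρ) :=
    fun hc => (isClosed_supportSlice i _ _).measurableSet.const_smul₀ _
  have hvol : volume A ^ (1 - β) * volume B ^ β ≤ volume C := by
    refine volume_rpow_mul_volume_rpow_le hβ0 hβ1 (hmeas (by positivity)) (hmeas (by positivity))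
      (hmeas (by positivity)) ?_
    rintro _ ⟨η, hη, rfl⟩ _ ⟨η', hη', rfl⟩
    refine ⟨(1 / 2 : ℝ) • (η + η'), ?_, ?_⟩
    · have := add_half_mem_supportSlice_coordSteiner hη hη'
      convert this using 2
      ring
    · simp only [hβ', smul_smul, smul_add]
      rw [hβ]
      congr 2 <;> field_simp
  have hgm : ENNReal.ofReal r⁻¹ ^ (1 - β) * ENNReal.ofReal s⁻¹ ^ β ≤
      ENNReal.ofReal ((r + s) / 2)⁻¹ := by
    refine (ENNReal.geom_mean_le_arith_mean_weighted _ _ hβ0 hβ1).trans_eq ?_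
    rw [← ENNReal.ofReal_mul hβ1'.le, ← ENNReal.ofReal_mul hβ0.le,
      ← ENNReal.ofReal_add (by positivity) (by positivity), hβ', hβ]
    congr 1
    field_simp
    ring
  set f := ENNReal.ofReal r⁻¹ ^ 2 * volume A with hf
  set g := ENNReal.ofReal s⁻¹ ^ 2 * volume B with hg
  have hpow (a : ℝ≥0∞) (x : ℝ) : (a ^ 2) ^ x = (a ^ x) ^ 2 := by
    rw [← ENNReal.rpow_natCast, ← ENNReal.rpow_natCast, ← ENNReal.rpow_mul, ← ENNReal.rpow_mul,
      mul_comm]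
  calc min f g = min f g ^ (1 - β) * min f g ^ β := by
        rw [← ENNReal.rpow_add_of_nonneg _ _ hβ1'.le hβ0.le]; simp
    _ ≤ f ^ (1 - β) * g ^ β := by
        gcongr
        · exact min_le_left _ _
        · exact min_le_right _ _
    _ = (ENNReal.ofReal r⁻¹ ^ (1 - β) * ENNReal.ofReal s⁻¹ ^ β) ^ 2 *
        (volume A ^ (1 - β) * volume B ^ β) := by
        rw [hf, hg, ENNReal.mul_rpow_of_nonneg _ _ hβ1'.le, ENNReal.mul_rpow_of_nonneg _ _ hβ0.le,
          hpow, hpow]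
        ring
    _ ≤ _ := by gcongr

theorem exists_volume_polarAt_le_coordSteiner {m : ℕ} {i : Fin (m + 1)}
    {K : Set (Fin (m + 1) → ℝ)} (hK : IsCompact K) (hc : Convex ℝ K) {t₀ : ℝ}
    (ht₀ : Pi.single i t₀ ∈ interior K) :
    ∃ τ, Pi.single i τ ∈ interior K ∧
      volume (polarAt K (Pi.single i τ)) ≤ volume (polarAt (coordSteiner i K) 0) := by
  obtain ⟨τ, hτ, hsup⟩ := exists_iSup_sliceDensity_eq hK hc ht₀
  refine ⟨τ, hτ, ?_⟩
  have hflip : coordFlip i '' coordSteiner i K = coordSteiner i K := by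
    refine Set.Subset.antisymm ?_ ?_
    · rintro _ ⟨x, hx, rfl⟩
      exact coordFlip_mem_coordSteiner i hx
    · intro x hx
      exact ⟨_, coordFlip_mem_coordSteiner i hx, coordFlip_coordFlip i x⟩
  have key := lintegral_combo_le_of_min_le (α := 1 / 2) (by norm_num) (by norm_num)
    (measurable_sliceDensity i K τ) (measurable_sliceDensity i (coordFlip i '' K) (-τ))
    (measurable_sliceDensity i (coordSteiner i K) 0) (min_sliceDensity_le i K τ) hsup
  have h0 := volume_polarAt_single i (coordSteiner i K) 0
  rw [hflip, neg_zero, Pi.single_zero] at h0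
  rw [volume_polarAt_single, h0]
  have e : (1 - 1 / 2 : ℝ) = 1 / 2 := by norm_num
  rw [e, ← mul_add] at key
  have e2 : ENNReal.ofReal (1 / 2) = 2⁻¹ := by
    rw [one_div, ENNReal.ofReal_inv_of_pos (by norm_num)]; norm_num
  rw [e2] at key
  have := mul_le_mul_right key 2
  rw [← mul_assoc, ENNReal.mul_inv_cancel (by norm_num) (by norm_num), one_mul, two_mul] at this
  exact this

theorem update_mem_interior_coordSteiner {ι : Type*} [Fintype ι] [DecidableEq ι] {i : ι}
    {K : Set (ι → ℝ)} {p : ι → ℝ} (hp : p ∈ interior K) :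
    Function.update p i 0 ∈ interior (coordSteiner i K) := by
  obtain ⟨δ, hδ, hball⟩ := Metric.mem_nhds_iff.1 (mem_interior_iff_mem_nhds.1 hp)
  refine mem_interior_iff_mem_nhds.2 (Metric.mem_nhds_iff.2 ⟨δ, hδ, fun x hx => ?_⟩)
  have hx' : ∀ j, |x j - Function.update p i 0 j| < δ := fun j =>
    (dist_pi_lt_iff hδ).1 (Metric.mem_ball.1 hx) j
  have hxi : |x i| < δ := by simpa using hx' i
  refine ⟨Function.update x i (p i + x i), hball ?_, Function.update x i (p i - x i), hball ?_,
    fun j hj => by simp [hj], ?_⟩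
  · rw [Metric.mem_ball, dist_pi_lt_iff hδ]
    intro j
    by_cases hj : j = i
    · subst hj; simpa [Real.dist_eq] using hxi
    · simpa [hj, Real.dist_eq] using hx' j
  · rw [Metric.mem_ball, dist_pi_lt_iff hδ]
    intro j
    by_cases hj : j = i
    · subst hj; simpa [Real.dist_eq] using hxi
    · simpa [hj, Real.dist_eq] using hx' j
  · ext j
    by_cases hj : j = i
    · subst hj; simp
    · simp [hj]

theorem exists_update_mem_interior {ι : Type*} [Fintype ι] [DecidableEq ι] {i : ι}
    {K : Set (ι → ℝ)} (hc : Convex ℝ K) (hi : (interior K).Nonempty) {x : ι → ℝ}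
    (hx : x ∈ interior (coordSteiner i K)) : ∃ t, Function.update x i t ∈ interior K := by
  obtain ⟨p, hp⟩ := hi
  have hcont : Continuous fun ε : ℝ => x - ε • (p - x) := by fun_prop
  have hnhds : (fun ε : ℝ => x - ε • (p - x)) ⁻¹' coordSteiner i K ∈ 𝓝 (0 : ℝ) :=
    hcont.continuousAt.preimage_mem_nhds (by simpa using mem_interior_iff_mem_nhds.1 hx)
  obtain ⟨ε, hε, hw⟩ : ∃ ε : ℝ, 0 < ε ∧ x - ε • (p - x) ∈ coordSteiner i K := by
    obtain ⟨δ, hδ, hb⟩ := Metric.mem_nhds_iff.1 hnhds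
    exact ⟨δ / 2, by positivity, hb (by simp [abs_of_pos hδ, hδ])⟩
  obtain ⟨q, hq, q', -, -, hqw⟩ := hw
  have h1 : 0 < 1 + ε := by positivity
  have hmem := hc.combo_interior_self_mem_interior hp hq (a := ε / (1 + ε)) (b := 1 / (1 + ε))
    (by positivity) (by positivity) (by field_simp; ring)
  refine ⟨((ε / (1 + ε)) • p + (1 / (1 + ε)) • q) i, ?_⟩
  convert hmem using 1
  refine Function.update_eq_iff.2 ⟨rfl, fun j hj => ?_⟩
  have : q j = x j - ε * (p j - x j) := by
    have := congrFun hqw j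
    simpa [hj] using this
  simp [this]
  field_simp
  ring

theorem polarAt_image_sub {ι : Type*} [Fintype ι] (K : Set (ι → ℝ)) (x z : ι → ℝ) :
    polarAt ((fun y => y - x) '' K) z = polarAt K (x + z) := by
  ext y
  simp only [polarAt, Set.mem_ofPred_eq, Set.forall_mem_image, sub_sub]

theorem exists_volume_polarAt_le_of_mem_interior_coordSteiner {m : ℕ} {i : Fin (m + 1)}
    {K : Set (Fin (m + 1) → ℝ)} (hK : IsCompact K) (hc : Convex ℝ K)
    (hi : (interior K).Nonempty) {x : Fin (m + 1) → ℝ} (hx : x ∈ interior (coordSteiner i K))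
    (hxi : x i = 0) :
    ∃ z ∈ interior K, (∀ j, j ≠ i → z j = x j) ∧
      volume (polarAt K z) ≤ volume (polarAt (coordSteiner i K) x) := by
  obtain ⟨t, ht⟩ := exists_update_mem_interior hc hi hx
  have hint : ∀ L : Set (Fin (m + 1) → ℝ),
      interior ((fun y => y - x) '' L) = (fun y => y - x) '' interior L := fun L =>
    ((Homeomorph.subRight x).image_interior L).symm
  have hK' : IsCompact ((fun y => y - x) '' K) := hK.image (by fun_prop)
  have hc' : Convex ℝ ((fun y => y - x) '' K) := by
    have e : (fun y => y - x) = fun y => -x + y := by ext y; simp [sub_eq_neg_add]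
    rw [e]
    exact hc.translate (-x)
  obtain ⟨τ, hτ, hle⟩ := exists_volume_polarAt_le_coordSteiner (i := i) (t₀ := t) hK' hc' (by
    rw [hint]
    refine ⟨_, ht, ?_⟩
    ext j
    by_cases hj : j = i
    · subst hj; simp [hxi]
    · simp [hj])
  rw [hint] at hτ
  obtain ⟨z, hz, hzτ⟩ := hτ
  have hz' : z = x + Pi.single i τ := by rw [← hzτ]; simp
  refine ⟨z, hz, fun j hj => by simp [hz', hj], ?_⟩
  rwa [polarAt_image_sub, coordSteiner_sub i K hxi, polarAt_image_sub, add_zero, ← hz'] at hle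

theorem image_eval_coordSteiner {ι : Type*} [DecidableEq ι] {i j : ι} (hij : j ≠ i)
    (K : Set (ι → ℝ)) : (fun x => x j) '' coordSteiner i K = (fun x => x j) '' K := by
  refine Set.Subset.antisymm ?_ ?_
  · rintro _ ⟨_, ⟨p, hp, q, -, -, rfl⟩, rfl⟩
    exact ⟨p, hp, by simp [hij]⟩
  · rintro _ ⟨p, hp, rfl⟩
    exact ⟨_, ⟨p, hp, p, hp, fun _ _ => rfl, rfl⟩, by simp [hij]⟩

/-- Successive Steiner symmetrizations in all coordinate directions but the first preserve the
distribution of the first coordinate, and do not increase polar volumes. -/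
theorem exists_coordFlip_invariant {m : ℕ} {K : Set (Fin (m + 1) → ℝ)} (hK : IsCompact K)
    (hc : Convex ℝ K) (hi : (interior K).Nonempty) :
    ∃ M : Set (Fin (m + 1) → ℝ), IsCompact M ∧ Convex ℝ M ∧ (interior M).Nonempty ∧
      (∀ j, j ≠ 0 → ∀ x ∈ M, coordFlip j x ∈ M) ∧
      (∀ g : ℝ → ℝ≥0∞, Measurable g → ∫⁻ x in M, g (x 0) = ∫⁻ x in K, g (x 0)) ∧
      (fun x => x 0) '' M = (fun x => x 0) '' K ∧
      ∀ ζ : ℝ, Pi.single 0 ζ ∈ interior M →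
        ∃ z ∈ interior K, volume (polarAt K z) ≤ volume (polarAt M (Pi.single 0 ζ)) := by
  suffices h : ∀ s : Finset (Fin (m + 1)), 0 ∉ s →
      ∃ M : Set (Fin (m + 1) → ℝ), IsCompact M ∧ Convex ℝ M ∧ (interior M).Nonempty ∧
      (∀ j ∈ s, ∀ x ∈ M, coordFlip j x ∈ M) ∧
      (∀ g : ℝ → ℝ≥0∞, Measurable g → ∫⁻ x in M, g (x 0) = ∫⁻ x in K, g (x 0)) ∧
      (fun x => x 0) '' M = (fun x => x 0) '' K ∧
      ∀ x ∈ interior M, (∀ j ∈ s, x j = 0) →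
        ∃ z ∈ interior K, volume (polarAt K z) ≤ volume (polarAt M x) by
    obtain ⟨M, h1, h2, h3, h4, h5, h5', h6⟩ := h (Finset.univ.erase 0) (by simp)
    exact ⟨M, h1, h2, h3, fun j hj => h4 j (by simp [hj]), h5, h5', fun ζ hζ =>
      h6 _ hζ fun j hj => by simp [Finset.ne_of_mem_erase hj]⟩
  intro s
  induction s using Finset.induction_on with
  | empty => exact fun _ => ⟨K, hK, hc, hi, by simp, fun _ _ => rfl, rfl, fun x hx _ => ⟨x, hx, le_rfl⟩⟩
  | insert i s his ih =>
    intro h0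
    have h0i : (0 : Fin (m + 1)) ≠ i := fun h => h0 (by simp [h])
    obtain ⟨M, h1, h2, h3, h4, h5, h5', h6⟩ := ih fun h => h0 (Finset.mem_insert_of_mem h)
    refine ⟨coordSteiner i M, isCompact_coordSteiner i h1, convex_coordSteiner i h2,
      h3.elim fun p hp => ⟨_, update_mem_interior_coordSteiner hp⟩, ?_, ?_, ?_, ?_⟩
    · intro j hj x hx
      by_cases hji : j = i
      · exact hji ▸ coordFlip_mem_coordSteiner i hx
      · exact coordFlip_mem_coordSteiner_of_ne hji
          (h4 j ((Finset.mem_insert.1 hj).resolve_left hji)) hx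
    · intro g hg
      rw [setLIntegral_coordSteiner h0i h1 h2 hg, h5 g hg]
    · rw [image_eval_coordSteiner h0i, h5']
    · intro x hx hxs
      obtain ⟨z, hz, hzx, hle⟩ := exists_volume_polarAt_le_of_mem_interior_coordSteiner h1 h2 h3 hx
        (hxs i (Finset.mem_insert_self i s))
      obtain ⟨w, hw, hle'⟩ := h6 z hz fun j hj => by
        rw [hzx j (ne_of_mem_of_not_mem hj his), hxs j (Finset.mem_insert_of_mem hj)]
      exact ⟨w, hw, hle'.trans hle⟩

theorem single_mem_interior_of_coordFlip {m : ℕ} {M : Set (Fin (m + 1) → ℝ)} (hc : Convex ℝ M)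
    (hf : ∀ j, j ≠ 0 → ∀ x ∈ M, coordFlip j x ∈ M) {p : Fin (m + 1) → ℝ} (hp : p ∈ interior M) :
    Pi.single 0 (p 0) ∈ interior M := by
  have hflip : ∀ j, j ≠ 0 → ∀ x ∈ interior M, Function.update x j 0 ∈ interior M := by
    intro j hj x hx
    have h1 : coordFlip j x ∈ interior M := by
      have : coordFlip j '' interior M ⊆ interior M := by
        refine interior_maximal ?_ ((coordFlipHomeomorph j).isOpenMap _ isOpen_interior)
        rintro _ ⟨y, hy, rfl⟩
        exact hf j hj y (interior_subset hy)
      exact this ⟨x, hx, rfl⟩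
    convert hc.interior hx h1 (a := 1 / 2) (b := 1 / 2) (by norm_num) (by norm_num) (by norm_num)
      using 1
    refine Function.update_eq_iff.2 ⟨by simp [coordFlip], fun k hk => ?_⟩
    simp [coordFlip, hk]; ring
  have h : ∀ s : Finset (Fin (m + 1)), 0 ∉ s → s.piecewise 0 p ∈ interior M := by
    intro s
    induction s using Finset.induction_on with
    | empty => simpa using hp
    | insert i s his ih =>
      intro h0
      rw [Finset.piecewise_insert]
      exact hflip i (fun h => h0 (by simp [h])) _ (ih fun h => h0 (Finset.mem_insert_of_mem h))
  convert h (Finset.univ.erase 0) (by simp) using 1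
  ext j
  by_cases hj : j = 0
  · subst hj; simp
  · simp [hj]

/-- A pair of probability measures on `(0, ∞)` which almost attains equality in the functional
Blaschke–Santaló inequality relative to the probability measure `lam` on `(0, 1)`. -/
structure SantaloPair (δ : ℝ) (lam μ ν : Measure ℝ) : Prop where
  prob_ref : IsProbabilityMeasure lam
  prob_left : IsProbabilityMeasure μ
  prob_right : IsProbabilityMeasure ν
  ref_mem : ∀ᵐ r ∂lam, 0 < r ∧ r < 1
  left_mem : ∃ R, ∀ᵐ t ∂μ, 0 < t ∧ t ≤ R
  right_mem : ∃ R, ∀ᵐ s ∂ν, 0 < s ∧ s ≤ R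
  lintegral_mul_le : ∀ a b q : ℝ → ℝ≥0∞, Measurable a → Measurable b → Measurable q →
    (∀ t > 0, ∀ s > 0, a t * b s ≤ q √(t * s) ^ 2) →
    (∫⁻ t, a t ∂μ) * (∫⁻ s, b s ∂ν) ≤ ENNReal.ofReal (1 + δ) * (∫⁻ r, q r ∂lam) ^ 2

theorem integrable_of_ae_mem {μ : Measure ℝ} [IsFiniteMeasure μ] {R : ℝ}
    (hμ : ∀ᵐ t ∂μ, 0 < t ∧ t ≤ R) {f : ℝ → ℝ} (hf : Continuous f) : Integrable f μ := by
  obtain ⟨C, hC⟩ := (isCompact_Icc (a := 0) (b := R)).exists_bound_of_continuousOn hf.continuousOn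
  exact Integrable.of_bound hf.aestronglyMeasurable C
    (hμ.mono fun t ht => hC t ⟨ht.1.le, ht.2⟩)

theorem exp_integral_le_lintegral_exp {μ : Measure ℝ} [IsProbabilityMeasure μ] {f : ℝ → ℝ}
    (hf : Integrable f μ) :
    ENNReal.ofReal (Real.exp (∫ t, f t ∂μ)) ≤ ∫⁻ t, ENNReal.ofReal (Real.exp (f t)) ∂μ := by
  set I := ∫ t, f t ∂μ
  have hint : Integrable (fun t => Real.exp I * (1 + (f t - I))) μ := by fun_prop
  have h1 : ∫ t, Real.exp I * (1 + (f t - I)) ∂μ = Real.exp I := by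
    rw [integral_const_mul, integral_add (by fun_prop) (by fun_prop),
      integral_sub hf (by fun_prop)]
    simp [I]
  calc ENNReal.ofReal (Real.exp I)
      = ENNReal.ofReal (∫ t, Real.exp I * (1 + (f t - I)) ∂μ) := by rw [h1]
    _ ≤ ∫⁻ t, ENNReal.ofReal (Real.exp I * (1 + (f t - I))) ∂μ := by
        rw [integral_eq_lintegral_pos_part_sub_lintegral_neg_part hint]
        refine ENNReal.ofReal_le_of_le_toReal (sub_le_self _ ENNReal.toReal_nonneg)
    _ ≤ _ := by
        refine lintegral_mono fun t => ENNReal.ofReal_le_ofReal ?_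
        have := Real.add_one_le_exp (f t - I)
        calc Real.exp I * (1 + (f t - I)) ≤ Real.exp I * Real.exp (f t - I) := by
              gcongr; linarith
          _ = _ := by rw [← Real.exp_add]; congr 1; ring

namespace SantaloPair

variable {δ : ℝ} {lam μ ν : Measure ℝ}

theorem symm (h : SantaloPair δ lam μ ν) : SantaloPair δ lam ν μ where
  prob_ref := h.prob_ref
  prob_left := h.prob_right
  prob_right := h.prob_left
  ref_mem := h.ref_mem
  left_mem := h.right_mem
  right_mem := h.left_mem
  lintegral_mul_le a b q ha hb hq hab := by
    rw [mul_comm]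
    refine h.lintegral_mul_le b a q hb ha hq fun t ht s hs => ?_
    rw [mul_comm, mul_comm t]
    exact hab s hs t ht

theorem scale (h : SantaloPair δ lam μ ν) {α : ℝ} (hα : 0 < α) :
    SantaloPair δ lam (μ.map fun t => α⁻¹ * t) (ν.map fun s => α * s) where
  prob_ref := h.prob_ref
  prob_left := have := h.prob_left; Measure.isProbabilityMeasure_map (by fun_prop)
  prob_right := have := h.prob_right; Measure.isProbabilityMeasure_map (by fun_prop)
  ref_mem := h.ref_mem
  left_mem := by
    obtain ⟨R, hR⟩ := h.left_mem
    refine ⟨α⁻¹ * R, (ae_map_iff (by fun_prop) (by measurability)).2 (hR.mono fun t ht => ?_)⟩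
    exact ⟨by have := ht.1; positivity, by have := ht.2; gcongr⟩
  right_mem := by
    obtain ⟨R, hR⟩ := h.right_mem
    refine ⟨α * R, (ae_map_iff (by fun_prop) (by measurability)).2 (hR.mono fun t ht => ?_)⟩
    exact ⟨by have := ht.1; positivity, by have := ht.2; gcongr⟩
  lintegral_mul_le a b q ha hb hq hab := by
    rw [lintegral_map ha (by fun_prop), lintegral_map hb (by fun_prop)]
    refine h.lintegral_mul_le (fun t => a (α⁻¹ * t)) (fun s => b (α * s)) q (by fun_prop)
      (by fun_prop) hq fun t ht s hs => ?_
    have := hab (α⁻¹ * t) (by positivity) (α * s) (by positivity)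
    have e : α⁻¹ * t * (α * s) = t * s := by field_simp
    rwa [e] at this

theorem integral_add_integral_le (h : SantaloPair δ lam μ ν) {f g b : ℝ → ℝ}
    (hf : Continuous f) (hg : Continuous g) (hb : Continuous b)
    (hfg : ∀ t > 0, ∀ s > 0, √(t * s) < 1 → f t + g s ≤ 2 * b √(t * s))
    (hb2 : ∀ r, 0 < r → r < 1 → |b r| ≤ 2) {η : ℝ} (hη : 0 ≤ η) (hη2 : η ≤ 1 / 2) :
    η * ((∫ t, f t ∂μ) + ∫ s, g s ∂ν) ≤ δ + 2 * (η * (∫ r, b r ∂lam) + 4 * η ^ 2) := by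
  have := h.prob_ref
  have := h.prob_left
  have := h.prob_right
  obtain ⟨R, hR⟩ := h.left_mem
  obtain ⟨S, hS⟩ := h.right_mem
  have hfi := integrable_of_ae_mem hR hf
  have hgi := integrable_of_ae_mem hS hg
  have hbi := integrable_of_ae_mem (h.ref_mem.mono fun r hr => ⟨hr.1, hr.2.le⟩) hb
  set q : ℝ → ℝ≥0∞ := fun r => if r < 1 then ENNReal.ofReal (Real.exp (η * b r)) else ⊤ with hq
  have hqm : Measurable q :=
    Measurable.ite measurableSet_Iio (by fun_prop) measurable_const
  have key := h.lintegral_mul_le (fun t => ENNReal.ofReal (Real.exp (η * f t)))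
    (fun s => ENNReal.ofReal (Real.exp (η * g s))) q (by fun_prop) (by fun_prop) hqm
    fun t ht s hs => by
      by_cases hr : √(t * s) < 1
      · simp only [hq, if_pos hr]
        rw [← ENNReal.ofReal_mul (Real.exp_pos _).le, ← ENNReal.ofReal_pow (Real.exp_pos _).le,
          ← Real.exp_add, ← Real.exp_nat_mul]
        refine ENNReal.ofReal_le_ofReal (Real.exp_le_exp.2 ?_)
        have := mul_le_mul_of_nonneg_left (hfg t ht s hs hr) hη
        push_cast
        linarith
      · simp [hq, if_neg hr]
  have hqle : ∫⁻ r, q r ∂lam ≤ ENNReal.ofReal (Real.exp (η * (∫ r, b r ∂lam) + 4 * η ^ 2)) := by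
    calc ∫⁻ r, q r ∂lam ≤ ∫⁻ r, ENNReal.ofReal (1 + η * b r + 4 * η ^ 2) ∂lam := by
          refine lintegral_mono_ae (h.ref_mem.mono fun r hr => ?_)
          simp only [hq, if_pos hr.2]
          refine ENNReal.ofReal_le_ofReal ?_
          have hbr := abs_le.1 (hb2 r hr.1 hr.2)
          have h1 : |η * b r| ≤ 1 := by
            rw [abs_mul, abs_of_nonneg hη]
            nlinarith [hb2 r hr.1 hr.2, abs_nonneg (b r)]
          have h2 := abs_le.1 (Real.abs_exp_sub_one_sub_id_le h1)
          have h3 : (η * b r) ^ 2 ≤ 4 * η ^ 2 := by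
            have : b r ^ 2 ≤ 4 := by nlinarith
            nlinarith [sq_nonneg η]
          linarith [h2.2]
      _ = ENNReal.ofReal (∫ r, (1 + η * b r + 4 * η ^ 2) ∂lam) := by
          refine (ofReal_integral_eq_lintegral_ofReal (by fun_prop)
            (h.ref_mem.mono fun r hr => ?_)).symm
          have hbr := abs_le.1 (hb2 r hr.1 hr.2)
          change (0 : ℝ) ≤ 1 + η * b r + 4 * η ^ 2
          nlinarith [sq_nonneg η]
      _ ≤ _ := by
          refine ENNReal.ofReal_le_ofReal ?_
          rw [integral_add (by fun_prop) (by fun_prop), integral_add (by fun_prop) (by fun_prop),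
            integral_const_mul]
          have := Real.add_one_le_exp (η * (∫ r, b r ∂lam) + 4 * η ^ 2)
          simp
          linarith
  have h3 := (mul_le_mul' (exp_integral_le_lintegral_exp (hfi.const_mul η))
    (exp_integral_le_lintegral_exp (hgi.const_mul η))).trans
    (key.trans (mul_le_mul' (ENNReal.ofReal_le_ofReal (add_comm δ 1 ▸ Real.add_one_le_exp δ))
      (pow_le_pow_left' hqle 2)))
  rw [← ENNReal.ofReal_pow (Real.exp_pos _).le, ← ENNReal.ofReal_mul (Real.exp_pos _).le,
    ← ENNReal.ofReal_mul (Real.exp_pos _).le, ← Real.exp_nat_mul, ← Real.exp_add, ← Real.exp_add,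
    ENNReal.ofReal_le_ofReal_iff (Real.exp_pos _).le, Real.exp_le_exp, integral_const_mul,
    integral_const_mul] at h3
  push_cast at h3
  linarith

theorem integral_mul_integral_le (h : SantaloPair δ lam μ ν) (hδ : 0 ≤ δ) :
    (∫ t, t ∂μ) * (∫ s, s ∂ν) ≤ (1 + δ) * (∫ r, r ∂lam) ^ 2 := by
  have := h.prob_ref
  have := h.prob_left
  have := h.prob_right
  obtain ⟨R, hR⟩ := h.left_mem
  obtain ⟨S, hS⟩ := h.right_mem
  have key := h.lintegral_mul_le ENNReal.ofReal ENNReal.ofReal ENNReal.ofReal (by fun_prop)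
    (by fun_prop) (by fun_prop) fun t ht s hs => by
      rw [← ENNReal.ofReal_mul ht.le, ← ENNReal.ofReal_pow (by positivity),
        Real.sq_sqrt (by positivity)]
  have hr := h.ref_mem.mono fun r hr => And.intro hr.1 hr.2.le
  rw [← ofReal_integral_eq_lintegral_ofReal (f := fun t => t)
      (integrable_of_ae_mem hR continuous_id) (hR.mono fun t ht => ht.1.le),
    ← ofReal_integral_eq_lintegral_ofReal (f := fun t => t)
      (integrable_of_ae_mem hS continuous_id) (hS.mono fun t ht => ht.1.le),
    ← ofReal_integral_eq_lintegral_ofReal (f := fun t => t)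
      (integrable_of_ae_mem hr continuous_id) (hr.mono fun t ht => ht.1.le)] at key
  have h1 : 0 ≤ ∫ t, t ∂μ := integral_nonneg_of_ae (hR.mono fun t ht => ht.1.le)
  have h2 : 0 ≤ ∫ t, t ∂lam := integral_nonneg_of_ae (hr.mono fun t ht => ht.1.le)
  rwa [← ENNReal.ofReal_mul h1, ← ENNReal.ofReal_pow h2, ← ENNReal.ofReal_mul (by linarith),
    ENNReal.ofReal_le_ofReal_iff (by positivity)] at key

theorem integral_ref_mem (h : SantaloPair δ lam μ ν) :
    0 < ∫ r, r ∂lam ∧ ∫ r, r ∂lam ≤ 1 := by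
  have := h.prob_ref
  have hr := h.ref_mem.mono fun r hr => And.intro hr.1 hr.2.le
  have hi := integrable_of_ae_mem hr continuous_id
  constructor
  · refine (integral_pos_iff_support_of_nonneg_ae (hr.mono fun t ht => ht.1.le) hi).2 ?_
    have : Function.support (fun r : ℝ => r) =ᵐ[lam] Set.univ :=
      hr.mono fun t ht => by
        apply propext
        exact ⟨fun _ => trivial, fun _ => ht.1.ne'⟩
    rw [measure_congr this]; simp
  · calc ∫ r, r ∂lam ≤ ∫ r, (1 : ℝ) ∂lam :=
        integral_mono_ae hi (by fun_prop) (hr.mono fun t ht => ht.2)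
      _ = 1 := by simp

end SantaloPair

namespace SantaloPair

variable {δ : ℝ} {lam μ ν : Measure ℝ}

theorem integral_add_two_mul_le (h : SantaloPair δ lam μ ν) (hδ : 0 < δ) (hδ4 : δ ≤ 1 / 4)
    {c b : ℝ → ℝ} (hc : Continuous c) (hb : Continuous b)
    (hcb : ∀ t > 0, ∀ s > 0, √(t * s) < 1 → c t ≤ t + s - 2 * √(t * s) + b √(t * s))
    (hb2 : ∀ r, 0 < r → r < 1 → |b r| ≤ 2) :
    (∫ t, c t ∂μ) + 2 * ∫ r, r ∂lam ≤
      (∫ t, t ∂μ) + (∫ s, s ∂ν) + (∫ r, b r ∂lam) + 9 * √δ := by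
  have := h.prob_ref
  have := h.prob_left
  have := h.prob_right
  obtain ⟨R, hR⟩ := h.left_mem
  obtain ⟨S, hS⟩ := h.right_mem
  have hr := h.ref_mem.mono fun r hr => And.intro hr.1 hr.2.le
  have hη : 0 < √δ := Real.sqrt_pos.2 hδ
  have hη2 : √δ ≤ 1 / 2 := by
    rw [Real.sqrt_le_left (by norm_num)]; norm_num at hδ4 ⊢; exact hδ4
  have hsq : √δ ^ 2 = δ := Real.sq_sqrt hδ.le
  have key := h.integral_add_integral_le (f := fun t => c t - t) (g := fun s => -s)
    (b := fun r => b r / 2 - r) (by fun_prop) (by fun_prop) (by fun_prop)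
    (fun t ht s hs hts => by have := hcb t ht s hs hts; linarith)
    (fun r h0 h1 => by
      have := abs_le.1 (hb2 r h0 h1)
      exact abs_le.2 ⟨by linarith, by linarith⟩) hη.le hη2
  have hci := integrable_of_ae_mem hR hc
  have hti : Integrable (fun t => t) μ := integrable_of_ae_mem hR continuous_id
  have hbi := integrable_of_ae_mem hr hb
  have hri : Integrable (fun r => r) lam := integrable_of_ae_mem hr continuous_id
  rw [integral_sub hci hti, integral_neg, integral_sub (hbi.div_const 2) hri, integral_div] at key
  have e : δ = √δ * √δ := by linarith
  nth_rewrite 2 [e] at key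
  nlinarith [key, hsq]

theorem integral_left_add_integral_right_le (h : SantaloPair δ lam μ ν) (hδ : 0 < δ)
    (hμ : ∫ t, t ∂μ = ∫ r, r ∂lam) : ∫ s, s ∂ν ≤ (∫ r, r ∂lam) + δ := by
  obtain ⟨h0, h1⟩ := h.integral_ref_mem
  have := h.integral_mul_integral_le hδ.le
  rw [hμ] at this
  have h3 : ∫ s, s ∂ν ≤ (1 + δ) * ∫ r, r ∂lam := by
    refine le_of_mul_le_mul_left ?_ h0
    linarith
  nlinarith

theorem integral_ref_le_integral_right (h : SantaloPair δ lam μ ν) (hδ : 0 < δ) (hδ4 : δ ≤ 1 / 4)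
    (hμ : ∫ t, t ∂μ = ∫ r, r ∂lam) : (∫ r, r ∂lam) - 9 * √δ ≤ ∫ s, s ∂ν := by
  have := h.integral_add_two_mul_le hδ hδ4 (c := fun _ => 0) (b := fun _ => 0) continuous_const
    continuous_const (fun t ht s hs _ => by
      have := sq_nonneg (√t - √s)
      rw [sub_sq, Real.sq_sqrt ht.le, Real.sq_sqrt hs.le, mul_assoc, ← Real.sqrt_mul ht.le] at this
      linarith) (by simp)
  simp at this
  linarith

theorem integral_le_integral_ref (h : SantaloPair δ lam μ ν) (hδ : 0 < δ) (hδ4 : δ ≤ 1 / 4)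
    (hE : (∫ t, t ∂μ) + ∫ s, s ∂ν ≤ 2 * (∫ r, r ∂lam) + √δ) {c b : ℝ → ℝ} (hc : Continuous c)
    (hb : Continuous b)
    (hcb : ∀ t > 0, ∀ r > 0, r < 1 → c t ≤ (t - r) ^ 2 / t + b r)
    (hb2 : ∀ r, 0 < r → r < 1 → |b r| ≤ 2) :
    ∫ t, c t ∂μ ≤ (∫ r, b r ∂lam) + 10 * √δ := by
  have := h.integral_add_two_mul_le hδ hδ4 hc hb (fun t ht s hs hts => by
    have hr : 0 < √(t * s) := by positivity
    have e : (t - √(t * s)) ^ 2 / t = t + s - 2 * √(t * s) := by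
      rw [sub_sq, Real.sq_sqrt (by positivity)]
      field_simp
      ring
    have := hcb t ht _ hr hts
    linarith) hb2
  linarith

theorem tail_le (h : SantaloPair δ lam μ ν) (hδ : 0 < δ) (hδ4 : δ ≤ 1 / 4)
    (hE : (∫ t, t ∂μ) + ∫ s, s ∂ν ≤ 2 * (∫ r, r ∂lam) + √δ) {r₀ : ℝ} (hr₀ : 0 < r₀)
    (hr₀4 : r₀ ≤ 1 / 4) :
    2 * r₀ * ∫ t, max (t - 1 - r₀) 0 ∂μ ≤ 10 * √δ := by
  have := h.integral_le_integral_ref hδ hδ4 hE (c := fun t => 2 * r₀ * max (t - 1 - r₀) 0)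
    (b := fun _ => 0) (by fun_prop) (by fun_prop) (fun t ht r hr hr1 => by
      rw [add_zero]
      rcases le_total (t - 1 - r₀) 0 with h0 | h0
      · rw [max_eq_right h0, mul_zero]; positivity
      · rw [max_eq_left h0, le_div_iff₀ ht]
        have h1 : (t - 1) ^ 2 ≤ (t - r) ^ 2 := by nlinarith
        refine le_trans ?_ h1
        nlinarith [sq_nonneg ((t - 1) - 3 / 2 * r₀), sq_nonneg (t - 1 - r₀), mul_pos hr₀ hr₀,
          mul_nonneg hr₀.le h0, mul_nonneg (mul_nonneg hr₀.le h0) h0])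
    (by simp)
  rw [integral_const_mul] at this
  simpa using this

theorem abs_integral_min_sq_sub_le (h : SantaloPair δ lam μ ν) (hδ : 0 < δ) (hδ4 : δ ≤ 1 / 4)
    (hE : (∫ t, t ∂μ) + ∫ s, s ∂ν ≤ 2 * (∫ r, r ∂lam) + √δ) {κ : ℝ} (hκ : 0 < κ)
    (hκ8 : κ ≤ 1 / 8) :
    |(∫ t, min t 2 ^ 2 ∂μ) - ∫ r, r ^ 2 ∂lam| ≤ 5 * κ + 10 * √δ / κ := by
  have := h.prob_ref
  have hri : Integrable (fun r : ℝ => r ^ 2) lam :=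
    integrable_of_ae_mem (h.ref_mem.mono fun r hr => ⟨hr.1, hr.2.le⟩) (by fun_prop)
  have aux : ∀ t > 0, ∀ r > 0, r < 1 →
      κ * |min t 2 ^ 2 - r ^ 2| ≤ (t - r) ^ 2 / t + 5 * κ ^ 2 := by
    intro t ht r hr hr1
    rcases le_total t 2 with h2 | h2
    · rw [min_eq_left h2, sq_sub_sq, abs_mul, abs_of_pos (by positivity)]
      have h3 : |t - r| ^ 2 / 2 ≤ (t - r) ^ 2 / t := by rw [sq_abs]; gcongr
      have h4 : (t + r) * |t - r| ≤ 3 * |t - r| := by gcongr; linarith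
      nlinarith [sq_nonneg (|t - r| - 3 * κ), abs_nonneg (t - r)]
    · rw [min_eq_right h2, abs_of_nonneg (by nlinarith)]
      have h3 : 1 / 2 ≤ (t - r) ^ 2 / t := by
        rw [le_div_iff₀ ht]; nlinarith
      nlinarith [sq_nonneg r, sq_nonneg κ]
  have h1 := h.integral_le_integral_ref hδ hδ4 hE (c := fun t => κ * min t 2 ^ 2)
    (b := fun r => κ * r ^ 2 + 5 * κ ^ 2) (by fun_prop) (by fun_prop) (fun t ht r hr hr1 => by
      have := aux t ht r hr hr1
      have := mul_le_mul_of_nonneg_left (le_abs_self (min t 2 ^ 2 - r ^ 2)) hκ.le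
      linarith) (fun r hr hr1 => abs_le.2 ⟨by nlinarith [sq_nonneg r, sq_nonneg κ], by
        nlinarith [sq_nonneg κ]⟩)
  have h2 := h.integral_le_integral_ref hδ hδ4 hE (c := fun t => -(κ * min t 2 ^ 2))
    (b := fun r => -(κ * r ^ 2) + 5 * κ ^ 2) (by fun_prop) (by fun_prop) (fun t ht r hr hr1 => by
      have := aux t ht r hr hr1
      have := mul_le_mul_of_nonneg_left (neg_abs_le (min t 2 ^ 2 - r ^ 2)) hκ.le
      linarith) (fun r hr hr1 => abs_le.2 ⟨by nlinarith [sq_nonneg r, sq_nonneg κ], by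
        nlinarith [sq_nonneg κ]⟩)
  rw [integral_const_mul, integral_add (hri.const_mul κ) (by fun_prop), integral_const_mul,
    integral_const] at h1
  rw [integral_neg, integral_const_mul, integral_add (by fun_prop) (by fun_prop),
    integral_neg, integral_const_mul, integral_const] at h2
  simp at h1 h2
  have e : 5 * κ + 10 * √δ / κ = (5 * κ ^ 2 + 10 * √δ) / κ := by field_simp
  rw [e, le_div_iff₀ hκ]
  rw [← abs_of_pos hκ, ← abs_mul, abs_of_pos hκ]
  exact abs_le.2 ⟨by linarith, by linarith⟩

theorem extent_le (h : SantaloPair δ lam μ ν) (hδ : 0 < δ) (hδ4 : δ ≤ 1 / 4)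
    (hE : (∫ t, t ∂μ) + ∫ s, s ∂ν ≤ 2 * (∫ r, r ∂lam) + √δ) {r₀ : ℝ} (hr₀ : 0 < r₀)
    (hr₀4 : r₀ ≤ 1 / 4) {n : ℕ} (hn : 10 * √δ < r₀ ^ 2 * (r₀ / 3) ^ n) {σ : ℝ}
    (hσ : ∀ θ, 0 ≤ θ → θ ≤ 1 → θ ^ n ≤ μ.real (Set.Ici ((1 - θ) * σ))) : σ ≤ 1 + 2 * r₀ := by
  have := h.prob_left
  obtain ⟨R, hR⟩ := h.left_mem
  by_contra! hlt
  have hσ0 : 0 < σ := by linarith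
  set θ := 1 - (1 + 3 / 2 * r₀) / σ with hθ
  have hθr : r₀ / 3 ≤ θ := by
    have : (1 + 3 / 2 * r₀) / σ ≤ 1 - r₀ / 3 := by
      rw [div_le_iff₀ hσ0]; nlinarith
    linarith
  have hθ1 : θ ≤ 1 := by
    have : 0 ≤ (1 + 3 / 2 * r₀) / σ := by positivity
    linarith
  have h1 := hσ θ (by linarith) hθ1
  have e : (1 - θ) * σ = 1 + 3 / 2 * r₀ := by rw [hθ]; field_simp; ring
  rw [e] at h1
  have h2 := mul_meas_ge_le_integral_of_nonneg (μ := μ) (f := fun t => max (t - 1 - r₀) 0)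
    (ae_of_all _ fun t => le_max_right _ _) (integrable_of_ae_mem hR (by fun_prop)) (r₀ / 2)
  have h3 : μ.real (Set.Ici (1 + 3 / 2 * r₀)) ≤ μ.real {x | r₀ / 2 ≤ max (x - 1 - r₀) 0} := by
    refine measureReal_mono fun x hx => ?_
    have : 1 + 3 / 2 * r₀ ≤ x := hx
    have h : r₀ / 2 ≤ x - 1 - r₀ := by linarith
    exact le_max_of_le_left h
  have h4 := h.tail_le hδ hδ4 hE hr₀ hr₀4
  have h5 : (r₀ / 3) ^ n ≤ θ ^ n := by gcongr
  have h6 : r₀ / 2 * (r₀ / 3) ^ n ≤ ∫ t, max (t - 1 - r₀) 0 ∂μ :=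
    le_trans (by gcongr; linarith) h2
  nlinarith

end SantaloPair

theorem SantaloPair.stability {δ : ℝ} {lam μ ν : Measure ℝ} (h : SantaloPair δ lam μ ν)
    (hδ : 0 < δ) (hδ4 : δ ≤ 1 / 4) {α : ℝ} (hα : 0 < α) (hμα : ∫ t, t ∂μ = α * ∫ r, r ∂lam)
    {r₀ : ℝ} (hr₀ : 0 < r₀) (hr₀4 : r₀ ≤ 1 / 4) {n : ℕ}
    (hn : 10 * √δ < r₀ ^ 2 * (r₀ / 3) ^ n) {κ : ℝ} (hκ : 0 < κ) (hκ8 : κ ≤ 1 / 8) {σ : ℝ}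
    (hμσ : ∀ᵐ t ∂μ, t ≤ σ)
    (hσ : ∀ θ, 0 ≤ θ → θ ≤ 1 → θ ^ n ≤ μ.real (Set.Ici ((1 - θ) * σ)))
    (hσ' : ∀ θ, 0 ≤ θ → θ ≤ 1 → θ ^ n ≤ ν.real (Set.Ici ((1 - θ) * σ⁻¹))) :
    σ ≤ α * (1 + 2 * r₀) ∧ σ⁻¹ ≤ α⁻¹ * (1 + 2 * r₀) ∧
      |(∫ s, s ∂ν) - α⁻¹ * ∫ r, r ∂lam| ≤ α⁻¹ * (9 * √δ) ∧
      |(∫ t, t ^ 2 ∂μ) - α ^ 2 * ∫ r, r ^ 2 ∂lam| ≤ α ^ 2 * (5 * κ + 10 * √δ / κ) := by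
  have h' := h.scale hα
  set μ' := μ.map fun t => α⁻¹ * t with hμ'
  set ν' := ν.map fun s => α * s with hν'
  have e1 : ∫ t, t ∂μ' = ∫ r, r ∂lam := by
    rw [hμ', integral_map (by fun_prop) (by fun_prop), integral_const_mul, hμα]
    field_simp
  have e2 : ∫ s, s ∂ν' = α * ∫ s, s ∂ν := by
    rw [hν', integral_map (by fun_prop) (by fun_prop), integral_const_mul]
  have hδs : δ ≤ √δ := by
    rw [Real.le_sqrt' hδ]; nlinarith
  have h1 := h'.integral_left_add_integral_right_le hδ e1
  have h2 := h'.integral_ref_le_integral_right hδ hδ4 e1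
  have hE : (∫ t, t ∂μ') + ∫ s, s ∂ν' ≤ 2 * (∫ r, r ∂lam) + √δ := by linarith
  have h3 : α⁻¹ * σ ≤ 1 + 2 * r₀ := h'.extent_le hδ hδ4 hE hr₀ hr₀4 hn fun θ h0 h1 => by
    rw [hμ', map_measureReal_apply (by fun_prop) measurableSet_Ici]
    refine (hσ θ h0 h1).trans (le_of_eq ?_)
    congr 1
    ext t
    simp only [Set.mem_preimage, Set.mem_Ici]
    rw [mul_left_comm, mul_le_mul_iff_right₀ (by positivity)]
  have h4 : α * σ⁻¹ ≤ 1 + 2 * r₀ := h'.symm.extent_le hδ hδ4 (by linarith) hr₀ hr₀4 hn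
    fun θ h0 h1 => by
    rw [hν', map_measureReal_apply (by fun_prop) measurableSet_Ici]
    refine (hσ' θ h0 h1).trans (le_of_eq ?_)
    congr 1
    ext t
    simp only [Set.mem_preimage, Set.mem_Ici]
    rw [mul_left_comm, mul_le_mul_iff_right₀ (by positivity)]
  have h5 := h'.abs_integral_min_sq_sub_le hδ hδ4 hE hκ hκ8
  have e3 : ∫ t, min t 2 ^ 2 ∂μ' = (α ^ 2)⁻¹ * ∫ t, t ^ 2 ∂μ := by
    rw [hμ', integral_map (by fun_prop) (by fun_prop), ← integral_const_mul]
    refine integral_congr_ae (hμσ.mono fun t ht => ?_)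
    have : α⁻¹ * t ≤ 2 := by
      have : α⁻¹ * t ≤ α⁻¹ * σ := by gcongr
      linarith
    simp only [min_eq_left this]
    rw [mul_pow, inv_pow]
  have hpos : 0 < α⁻¹ := by positivity
  refine ⟨?_, ?_, ?_, ?_⟩
  · rwa [inv_mul_le_iff₀ hα] at h3
  · rw [inv_mul_eq_div, le_div_iff₀ hα]; linarith
  · rw [e2] at h1 h2
    have : (∫ s, s ∂ν) - α⁻¹ * ∫ r, r ∂lam = α⁻¹ * (α * (∫ s, s ∂ν) - ∫ r, r ∂lam) := by
      field_simp
    rw [this, abs_mul, abs_of_pos hpos]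
    gcongr
    have := Real.sqrt_nonneg δ
    exact abs_le.2 ⟨by linarith, by linarith⟩
  · have : (∫ t, t ^ 2 ∂μ) - α ^ 2 * ∫ r, r ^ 2 ∂lam =
        α ^ 2 * ((α ^ 2)⁻¹ * (∫ t, t ^ 2 ∂μ) - ∫ r, r ^ 2 ∂lam) := by field_simp
    rw [this, abs_mul, abs_of_pos (by positivity)]
    rw [e3] at h5
    gcongr

/-- The distribution of the first coordinate on the half of `L` where it is positive. -/
def axisLaw {m : ℕ} (L : Set (Fin (m + 1) → ℝ)) : Measure ℝ :=
  (volume.restrict (L ∩ {x | 0 < x 0})).map fun x => x 0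

section AxisLaw

variable {m : ℕ} {L M P : Set (Fin (m + 1) → ℝ)}

theorem lintegral_axisLaw {g : ℝ → ℝ≥0∞} (hg : Measurable g) :
    ∫⁻ t, g t ∂axisLaw L = ∫⁻ x in L ∩ {x | 0 < x 0}, g (x 0) :=
  lintegral_map hg (measurable_pi_apply 0)

theorem axisLaw_apply {s : Set ℝ} (hs : MeasurableSet s) :
    axisLaw L s = volume (L ∩ {x | 0 < x 0} ∩ {x | x 0 ∈ s}) := by
  rw [axisLaw, Measure.map_apply (measurable_pi_apply 0) hs,
    Measure.restrict_apply (measurable_pi_apply 0 hs), Set.inter_comm]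
  rfl

theorem axisLaw_univ : axisLaw L Set.univ = volume (L ∩ {x | 0 < x 0}) := by
  simp [axisLaw_apply]

theorem measurableSet_zero_lt_eval : MeasurableSet {x : Fin (m + 1) → ℝ | 0 < x 0} :=
  measurableSet_lt measurable_const (measurable_pi_apply 0)

theorem measurable_volume_insertNth (hL : MeasurableSet L) :
    Measurable fun t : ℝ =>
      volume {v : Fin m → ℝ | ((0 : Fin (m + 1)).insertNth t v : Fin (m + 1) → ℝ) ∈ L} :=
  measurable_measure_prodMk_left (measurable_insertNth 0 hL)

theorem lintegral_axisLaw_eq (hL : MeasurableSet L) {g : ℝ → ℝ≥0∞} (hg : Measurable g) :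
    ∫⁻ t, g t ∂axisLaw L = ∫⁻ t in Set.Ioi (0 : ℝ), g t *
      volume {v : Fin m → ℝ | ((0 : Fin (m + 1)).insertNth t v : Fin (m + 1) → ℝ) ∈ L} := by
  have hm := hL.inter (measurableSet_zero_lt_eval (m := m))
  have hg0 : Measurable fun x : Fin (m + 1) → ℝ => g (x 0) := by fun_prop
  rw [lintegral_axisLaw hg, ← lintegral_indicator hm, lintegral_insertNth 0 (hg0.indicator hm),
    ← lintegral_indicator measurableSet_Ioi]
  refine lintegral_congr fun t => ?_
  have hmt : MeasurableSet
      {v : Fin m → ℝ | ((0 : Fin (m + 1)).insertNth t v : Fin (m + 1) → ℝ) ∈ L} :=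
    ((measurable_insertNth 0).comp measurable_prodMk_left) hL
  by_cases ht : 0 < t
  · rw [Set.indicator_of_mem (by exact ht), ← lintegral_indicator_one hmt,
      ← lintegral_const_mul _ (measurable_one.indicator hmt)]
    refine lintegral_congr fun v => ?_
    by_cases hv : ((0 : Fin (m + 1)).insertNth t v : Fin (m + 1) → ℝ) ∈ L
    · have hv' : ((0 : Fin (m + 1)).insertNth t v : Fin (m + 1) → ℝ) ∈ L ∩ {x | 0 < x 0} :=
        ⟨hv, by simpa using ht⟩
      rw [Set.indicator_of_mem hv', Set.indicator_of_mem (by exact hv)]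
      simp
    · rw [Set.indicator_of_notMem fun h => hv h.1, Set.indicator_of_notMem (by exact hv)]
      simp
  · rw [Set.indicator_of_notMem (by exact ht)]
    refine lintegral_eq_zero_of_ae_eq_zero (ae_of_all _ fun v => ?_)
    exact Set.indicator_of_notMem (fun h => ht (by simpa using h.2)) _

theorem coordFlip_insertNth_zero (j : Fin m) (t : ℝ) (v : Fin m → ℝ) :
    coordFlip ((0 : Fin (m + 1)).succAbove j)
      ((0 : Fin (m + 1)).insertNth t v : Fin (m + 1) → ℝ) =
    (0 : Fin (m + 1)).insertNth t (coordFlip j v) := by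
  ext k
  refine Fin.succAboveCases 0 ?_ (fun l => ?_) k
  · rw [coordFlip_of_ne (Fin.succAbove_ne 0 j).symm]; simp
  · by_cases h : l = j
    · subst h; simp [coordFlip_same]
    · rw [coordFlip_of_ne (fun h' => h (Fin.succAbove_right_injective h'))]
      simp [coordFlip_of_ne h]

/-- The Euclidean unit ball in coordinates. -/
def coordBall (k : ℕ) : Set (Fin k → ℝ) := {x | ∑ i, x i ^ 2 ≤ 1}

theorem isClosed_coordBall (k : ℕ) : IsClosed (coordBall k) :=
  isClosed_le (by fun_prop) continuous_const

theorem lintegral_axisLaw_mul_le (hM : MeasurableSet M) (hP : MeasurableSet P)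
    (hMf : ∀ j, j ≠ 0 → ∀ x ∈ M, coordFlip j x ∈ M)
    (hPf : ∀ j, j ≠ 0 → ∀ x ∈ P, coordFlip j x ∈ P)
    (hMP : ∀ x ∈ M, ∀ y ∈ P, x ⬝ᵥ y ≤ 1) {a b q : ℝ → ℝ≥0∞} (ha : Measurable a)
    (hb : Measurable b) (hq : Measurable q)
    (hab : ∀ t > 0, ∀ s > 0, a t * b s ≤ q √(t * s) ^ 2) :
    (∫⁻ t, a t ∂axisLaw M) * (∫⁻ s, b s ∂axisLaw P) ≤
      (∫⁻ r, q r ∂axisLaw (coordBall (m + 1))) ^ 2 := by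
  have hD := (isClosed_coordBall (m + 1)).measurableSet
  rw [lintegral_axisLaw_eq hM ha, lintegral_axisLaw_eq hP hb, lintegral_axisLaw_eq hD hq]
  have hsq : ∀ x : ℝ≥0∞, (x ^ (1 / 2 : ℝ)) ^ 2 = x := fun x => by
    rw [← ENNReal.rpow_natCast, ← ENNReal.rpow_mul]; norm_num
  have hhalf : ∀ x : ℝ≥0∞, (x ^ 2) ^ (1 / 2 : ℝ) = x := fun x => by
    rw [← ENNReal.rpow_natCast, ← ENNReal.rpow_mul]; norm_num
  rw [← hsq (∫⁻ t in Set.Ioi 0, a t * _), ← hsq (∫⁻ t in Set.Ioi 0, b t * _), ← mul_pow]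
  refine pow_le_pow_left' (sqrt_lintegral_Ioi_mul_le (ha.mul (measurable_volume_insertNth hM))
    (hb.mul (measurable_volume_insertNth hP)) (hq.mul (measurable_volume_insertNth hD))
    fun t ht s hs => ?_) 2
  simp only [Pi.mul_apply]
  rw [← ENNReal.mul_rpow_of_nonneg _ _ (by norm_num), ← hhalf (q _ * _)]
  refine ENNReal.rpow_le_rpow ?_ (by norm_num)
  rw [mul_mul_mul_comm, mul_pow]
  refine mul_le_mul' (hab t ht s hs) ?_
  have hts : √(t * s) ^ 2 = t * s := Real.sq_sqrt (by positivity)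
  refine (volume_mul_volume_le_of_coordFlip (c := 1 - t * s) ?_ ?_ ?_ ?_ ?_).trans ?_
  · exact ((measurable_insertNth 0).comp measurable_prodMk_left) hM
  · exact ((measurable_insertNth 0).comp measurable_prodMk_left) hP
  · intro j v hv
    have := hMf _ (Fin.succAbove_ne 0 j) _ hv
    rwa [coordFlip_insertNth_zero] at this
  · intro j v hv
    have := hPf _ (Fin.succAbove_ne 0 j) _ hv
    rwa [coordFlip_insertNth_zero] at this
  · intro v hv w hw
    have := hMP _ hv _ hw
    rw [dotProduct_eq_add_removeNth 0] at this
    simp only [Fin.insertNth_apply_same, Fin.removeNth_insertNth] at this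
    linarith
  · refine pow_le_pow_left' (measure_mono fun v hv => ?_) 2
    have hv' : ∑ i, v i ^ 2 ≤ 1 - t * s := hv
    change ∑ i, ((0 : Fin (m + 1)).insertNth (√(t * s)) v : Fin (m + 1) → ℝ) i ^ 2 ≤ 1
    rw [Fin.sum_univ_succAbove _ 0]
    simp only [Fin.insertNth_apply_same, Fin.insertNth_apply_succAbove, hts]
    linarith

theorem axisLaw_univ_ne_top (hL : Bornology.IsBounded L) : axisLaw L Set.univ ≠ ⊤ := by
  rw [axisLaw_univ]
  exact (hL.subset Set.inter_subset_left).measure_lt_top.ne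

theorem isBounded_coordBall (k : ℕ) : Bornology.IsBounded (coordBall k) := by
  refine isBounded_iff_forall_norm_le.2 ⟨1, fun x hx => ?_⟩
  refine (pi_norm_le_iff_of_nonneg zero_le_one).2 fun i => ?_
  have h : ∑ i, x i ^ 2 ≤ 1 := hx
  have h2 := Finset.single_le_sum (f := fun i => x i ^ 2) (fun i _ => sq_nonneg (x i))
    (Finset.mem_univ i)
  rw [Real.norm_eq_abs, ← sq_le_one_iff_abs_le_one]
  exact h2.trans h

theorem ae_axisLaw {s : Set ℝ} (hs : MeasurableSet s) (h : ∀ x ∈ L, 0 < x 0 → x 0 ∈ s) :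
    ∀ᵐ t ∂axisLaw L, t ∈ s := by
  rw [ae_iff]
  change axisLaw L sᶜ = 0
  rw [axisLaw_apply hs.compl, ← measure_empty (μ := (volume : Measure (Fin (m + 1) → ℝ)))]
  congr 1
  exact Set.eq_empty_iff_forall_notMem.2 fun x hx => hx.2 (h x hx.1.1 hx.1.2)

theorem ae_axisLaw_ne (c : ℝ) : ∀ᵐ t ∂axisLaw L, t ≠ c := by
  rw [ae_iff]
  simp only [ne_eq, not_not]
  rw [show {a : ℝ | a = c} = {c} from rfl, axisLaw_apply (measurableSet_singleton c)]
  exact measure_mono_null Set.inter_subset_right (Measure.pi_hyperplane (fun _ : Fin (m + 1) => (volume : Measure ℝ)) 0 c)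

/-- The normalization of a finite measure to a probability measure. -/
def normalizeMeasure (μ : Measure ℝ) : Measure ℝ := (μ Set.univ)⁻¹ • μ

theorem isProbabilityMeasure_normalizeMeasure {μ : Measure ℝ} (h0 : μ Set.univ ≠ 0)
    (h1 : μ Set.univ ≠ ⊤) : IsProbabilityMeasure (normalizeMeasure μ) :=
  ⟨by simp [normalizeMeasure, ENNReal.inv_mul_cancel h0 h1]⟩

theorem ae_normalizeMeasure {μ : Measure ℝ} {p : ℝ → Prop} (h : ∀ᵐ t ∂μ, p t) :
    ∀ᵐ t ∂normalizeMeasure μ, p t :=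
  Measure.ae_smul_measure h _

theorem exists_ae_axisLaw_le (hL : Bornology.IsBounded L) :
    ∃ R, ∀ᵐ t ∂normalizeMeasure (axisLaw L), 0 < t ∧ t ≤ R := by
  obtain ⟨R, hR⟩ := hL.exists_norm_le
  refine ⟨R, ae_normalizeMeasure (ae_axisLaw (s := Set.Ioc 0 R) measurableSet_Ioc fun x hx h0 => ?_)⟩
  exact ⟨h0, (le_abs_self _).trans ((norm_le_pi_norm x 0).trans (hR x hx))⟩

theorem santaloPair_axisLaw {δ : ℝ} (hM : MeasurableSet M) (hP : MeasurableSet P)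
    (hMb : Bornology.IsBounded M) (hPb : Bornology.IsBounded P)
    (hMf : ∀ j, j ≠ 0 → ∀ x ∈ M, coordFlip j x ∈ M)
    (hPf : ∀ j, j ≠ 0 → ∀ x ∈ P, coordFlip j x ∈ P)
    (hMP : ∀ x ∈ M, ∀ y ∈ P, x ⬝ᵥ y ≤ 1)
    (hD0 : axisLaw (coordBall (m + 1)) Set.univ ≠ 0)
    (hvol : axisLaw (coordBall (m + 1)) Set.univ ^ 2 ≤
      ENNReal.ofReal (1 + δ) * (axisLaw M Set.univ * axisLaw P Set.univ)) :
    SantaloPair δ (normalizeMeasure (axisLaw (coordBall (m + 1))))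
      (normalizeMeasure (axisLaw M)) (normalizeMeasure (axisLaw P)) := by
  set D := axisLaw (coordBall (m + 1)) Set.univ with hD
  have hDt : D ≠ ⊤ := axisLaw_univ_ne_top (isBounded_coordBall _)
  have hMt : axisLaw M Set.univ ≠ ⊤ := axisLaw_univ_ne_top hMb
  have hPt : axisLaw P Set.univ ≠ ⊤ := axisLaw_univ_ne_top hPb
  have h0 : axisLaw M Set.univ ≠ 0 ∧ axisLaw P Set.univ ≠ 0 := by
    constructor <;> intro h <;> simp [h, hD0] at hvol
  refine ⟨isProbabilityMeasure_normalizeMeasure hD0 hDt,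
    isProbabilityMeasure_normalizeMeasure h0.1 hMt,
    isProbabilityMeasure_normalizeMeasure h0.2 hPt, ?_, exists_ae_axisLaw_le hMb,
    exists_ae_axisLaw_le hPb, ?_⟩
  · refine ae_normalizeMeasure ?_
    filter_upwards [ae_axisLaw_ne (L := coordBall (m + 1)) 1,
      ae_axisLaw (L := coordBall (m + 1)) (s := Set.Ioc 0 1) measurableSet_Ioc fun x hx h0 => by
        have h : ∑ i, x i ^ 2 ≤ 1 := hx
        have h2 := Finset.single_le_sum (f := fun i => x i ^ 2) (fun i _ => sq_nonneg (x i))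
          (Finset.mem_univ 0)
        exact ⟨h0, by nlinarith⟩] with t h1 h2
    exact ⟨h2.1, lt_of_le_of_ne h2.2 h1⟩
  · intro a b q ha hb hq hab
    have key := lintegral_axisLaw_mul_le hM hP hMf hPf hMP ha hb hq hab
    simp only [normalizeMeasure, lintegral_smul_measure, smul_eq_mul]
    rw [← hD]
    set A := ∫⁻ t, a t ∂axisLaw M
    set B := ∫⁻ t, b t ∂axisLaw P
    set Q := ∫⁻ t, q t ∂axisLaw (coordBall (m + 1))
    set u := axisLaw M Set.univ
    set v := axisLaw P Set.univ
    have huv : (u * v)⁻¹ ≤ ENNReal.ofReal (1 + δ) * (D ^ 2)⁻¹ := by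
      rw [← div_eq_mul_inv, ENNReal.le_div_iff_mul_le (by simp [hD0]) (by simp [hDt]), mul_comm,
        ← div_eq_mul_inv, ENNReal.div_le_iff (by simp [h0]) (by finiteness)]
      exact hvol
    calc u⁻¹ * A * (v⁻¹ * B) = (u * v)⁻¹ * (A * B) := by
          rw [ENNReal.mul_inv (by simp [h0]) (by simp [h0])]; ring
      _ ≤ ENNReal.ofReal (1 + δ) * (D ^ 2)⁻¹ * Q ^ 2 := mul_le_mul' huv key
      _ = _ := by rw [mul_pow, ENNReal.inv_pow]; ring

/-- Homothety estimate for the part of a convex set close to one of its points. -/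
theorem pow_le_normalizeMeasure_axisLaw (hL : Convex ℝ L)
    (hLb : Bornology.IsBounded L) (h0 : axisLaw L Set.univ ≠ 0) {p : Fin (m + 1) → ℝ} (hp : p ∈ L)
    (hp0 : 0 < p 0) {θ : ℝ} (hθ : 0 ≤ θ) (hθ1 : θ ≤ 1) :
    θ ^ (m + 1) ≤ (normalizeMeasure (axisLaw L)).real (Set.Ici ((1 - θ) * p 0)) := by
  have hLt := axisLaw_univ_ne_top hLb
  have h1 : ENNReal.ofReal (θ ^ (m + 1)) * axisLaw L Set.univ ≤
      axisLaw L (Set.Ici ((1 - θ) * p 0)) := by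
    rw [axisLaw_univ, axisLaw_apply measurableSet_Ici]
    have e : ENNReal.ofReal (θ ^ (m + 1)) * volume (L ∩ {x | 0 < x 0}) =
        volume (AffineMap.homothety p θ '' (L ∩ {x | 0 < x 0})) := by
      rw [Measure.addHaar_image_homothety, Module.finrank_fin_fun, abs_of_nonneg (by positivity)]
    rw [e]
    rcases hθ.eq_or_lt with rfl | hθ0
    · rw [← e]; simp
    refine measure_mono ?_
    rintro _ ⟨x, ⟨hx, hx0⟩, rfl⟩
    have hx0' : 0 < x 0 := hx0
    have e2 : AffineMap.homothety p θ x = (1 - θ) • p + θ • x := by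
      ext i; simp [AffineMap.homothety_apply]; ring
    have e3 : AffineMap.homothety p θ x 0 = (1 - θ) * p 0 + θ * x 0 := by rw [e2]; simp
    have h4 : 0 < θ * x 0 := by positivity
    have h5 : 0 ≤ (1 - θ) * p 0 := mul_nonneg (by linarith) hp0.le
    refine ⟨⟨e2 ▸ hL hp hx (by linarith) hθ (by ring), ?_⟩, ?_⟩
    · change 0 < AffineMap.homothety p θ x 0
      linarith
    · change (1 - θ) * p 0 ≤ AffineMap.homothety p θ x 0
      linarith
  rw [normalizeMeasure, measureReal_def, Measure.smul_apply, smul_eq_mul,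
    ← ENNReal.ofReal_le_iff_le_toReal]
  · rw [mul_comm, ← div_eq_mul_inv, ENNReal.le_div_iff_mul_le (Or.inl h0) (Or.inl hLt)]
    exact h1
  · exact ENNReal.mul_ne_top (by simp [h0])
      (measure_ne_top_of_subset (Set.subset_univ _) hLt)

end AxisLaw

section Median

variable {m : ℕ} {L : Set (Fin (m + 1) → ℝ)}

theorem measurableSet_lt_eval (t : ℝ) : MeasurableSet {x : Fin (m + 1) → ℝ | t < x 0} :=
  measurableSet_lt measurable_const (measurable_pi_apply 0)

theorem exists_median (hL : Bornology.IsBounded L) :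
    ∃ ζ, 2 * volume (L ∩ {x | ζ < x 0}) = volume L ∧ 2 * volume (L ∩ {x | x 0 < ζ}) = volume L := by
  obtain ⟨R₀, hR₀⟩ := hL.exists_norm_le
  set R := max R₀ 0 with hRdef
  have hR : ∀ x ∈ L, ∀ i, |x i| ≤ R := fun x hx i =>
    (norm_le_pi_norm x i).trans ((hR₀ x hx).trans (le_max_left _ _))
  have hR0 : 0 ≤ R := le_max_right _ _
  have hfin : ∀ S : Set (Fin (m + 1) → ℝ), volume (L ∩ S) ≠ ⊤ := fun S =>
    (hL.subset Set.inter_subset_left).measure_lt_top.ne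
  set F : ℝ → ℝ := fun t => volume.real (L ∩ {x | t < x 0}) with hF
  have hstep : ∀ s t, s ≤ t → F s ≤ F t + (2 * R) ^ m * (t - s) := by
    intro s t hst
    set B : Fin (m + 1) → Set ℝ :=
      Fin.cons (α := fun _ => Set ℝ) (Set.Ioc s t) fun _ => Set.Icc (-R) R with hB
    have hbox : volume.real (Set.univ.pi B) = (t - s) * (2 * R) ^ m := by
      rw [measureReal_def, volume_pi_pi, Fin.prod_univ_succ]
      simp [hB, ENNReal.toReal_mul, ENNReal.toReal_ofReal, hst, hR0, ← two_mul]
    have hsub : L ∩ {x | s < x 0} ⊆ (L ∩ {x | t < x 0}) ∪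
        Set.univ.pi B := by
      rintro x ⟨hx, hxs⟩
      by_cases hxt : t < x 0
      · exact Or.inl ⟨hx, hxt⟩
      · refine Or.inr fun i _ => ?_
        refine Fin.cases ?_ (fun j => ?_) i
        · exact ⟨hxs, not_lt.1 hxt⟩
        · exact abs_le.1 (hR x hx j.succ)
    have hbt : volume (Set.univ.pi B) ≠ ⊤ := by
      rw [volume_pi_pi, Fin.prod_univ_succ]
      simp only [hB, Fin.cons_zero, Fin.cons_succ, Real.volume_Ioc, Real.volume_Icc]
      exact ENNReal.mul_ne_top ENNReal.ofReal_ne_top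
        (ENNReal.prod_ne_top fun _ _ => ENNReal.ofReal_ne_top)
    have h1 := measureReal_mono (μ := volume) hsub (measure_union_ne_top (hfin _) hbt)
    have h2 := measureReal_union_le (μ := volume) (L ∩ {x | t < x 0})
      (Set.univ.pi B)
    rw [hbox] at h2
    calc F s ≤ _ := h1
      _ ≤ _ := h2
      _ = _ := by rw [mul_comm]
  have hanti : Antitone F := fun s t hst =>
    measureReal_mono (Set.inter_subset_inter_right _ fun x hx => lt_of_le_of_lt hst hx) (hfin _)
  have hcont : Continuous F := by
    refine (LipschitzWith.of_dist_le_mul (K := ⟨(2 * R) ^ m, by positivity⟩) fun s t => ?_).continuous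
    change |F s - F t| ≤ (2 * R) ^ m * |s - t|
    rcases le_total s t with h | h
    · rw [abs_of_nonneg (sub_nonneg.2 (hanti h)), abs_sub_comm, abs_of_nonneg (sub_nonneg.2 h)]
      linarith [hstep s t h]
    · rw [abs_sub_comm, abs_of_nonneg (sub_nonneg.2 (hanti h)), abs_of_nonneg (sub_nonneg.2 h)]
      linarith [hstep t s h]
  have hlo : F (-(R + 1)) = volume.real L := by
    simp only [hF]
    congr 1
    refine Set.inter_eq_left.2 fun x hx => ?_
    have := (abs_le.1 (hR x hx 0)).1
    change -(R + 1) < x 0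
    linarith
  have hhi : F (R + 1) = 0 := by
    simp only [hF]
    rw [show L ∩ {x | R + 1 < x 0} = ∅ from ?_, measureReal_empty]
    refine Set.eq_empty_iff_forall_notMem.2 fun x hx => ?_
    have := (abs_le.1 (hR x hx.1 0)).2
    have h2 : R + 1 < x 0 := hx.2
    linarith
  obtain ⟨ζ, -, hζ⟩ := intermediate_value_Icc' (show -(R + 1) ≤ R + 1 by linarith) hcont.continuousOn
    (show volume.real L / 2 ∈ Set.Icc (F (R + 1)) (F (-(R + 1))) by
      rw [hlo, hhi]
      have : 0 ≤ volume.real L := measureReal_nonneg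
      constructor <;> linarith)
  have h1 : 2 * volume (L ∩ {x | ζ < x 0}) = volume L := by
    rw [← ENNReal.toReal_eq_toReal_iff' (ENNReal.mul_ne_top (by norm_num) (hfin _))
      hL.measure_lt_top.ne, ENNReal.toReal_mul]
    change (2 : ℝ≥0∞).toReal * F ζ = volume.real L
    rw [hζ]
    simp
    ring
  refine ⟨ζ, h1, ?_⟩
  have h2 : volume (L ∩ {x | ζ < x 0}) + volume (L ∩ {x | x 0 < ζ}) = volume L := by
    rw [← measure_inter_add_sdiff L (measurableSet_lt_eval ζ)]
    congr 1
    refine measure_congr ?_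
    have : volume {x : Fin (m + 1) → ℝ | x 0 = ζ} = 0 :=
      Measure.pi_hyperplane (fun _ : Fin (m + 1) => (volume : Measure ℝ)) 0 ζ
    filter_upwards [measure_eq_zero_iff_ae_notMem.1 this] with x hx
    apply propext
    have hx' : x 0 ≠ ζ := hx
    constructor
    · rintro ⟨ha, hb⟩
      exact ⟨ha, fun h => lt_asymm (α := ℝ) hb h⟩
    · rintro ⟨ha, hb⟩
      exact ⟨ha, lt_of_le_of_ne (not_lt.1 hb) hx'⟩
  have hne := hfin {x | ζ < x 0}
  rw [← h1, two_mul] at h2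
  rw [(ENNReal.add_right_inj hne).1 h2, h1]

end Median

/-- Symmetrization of a convex body about the first coordinate axis, centred at the median of the
first coordinate. -/
theorem exists_centered_coordFlip_invariant {m : ℕ} {K : Set (Fin (m + 1) → ℝ)} (hK : IsCompact K)
    (hc : Convex ℝ K) (hi : (interior K).Nonempty) :
    ∃ (ζ : ℝ) (M : Set (Fin (m + 1) → ℝ)), IsCompact M ∧ Convex ℝ M ∧ 0 ∈ interior M ∧
      (∀ j, j ≠ 0 → ∀ x ∈ M, coordFlip j x ∈ M) ∧
      (∀ g : ℝ → ℝ≥0∞, Measurable g → ∫⁻ x in M, g (x 0) = ∫⁻ x in K, g (x 0 - ζ)) ∧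
      (fun x => x 0) '' M = (fun x => x 0 - ζ) '' K ∧
      2 * volume (M ∩ {x | 0 < x 0}) = volume K ∧ 2 * volume (M ∩ {x | x 0 < 0}) = volume K ∧
      ∀ z : ℝ, Pi.single 0 z ∈ interior M →
        ∃ w ∈ interior K, volume (polarAt K w) ≤ volume (polarAt M (Pi.single 0 z)) := by
  obtain ⟨M, h1, h2, h3, h4, h5, h6, h7⟩ := exists_coordFlip_invariant hK hc hi
  obtain ⟨ζ, hζ1, hζ2⟩ := exists_median h1.isBounded
  have hvol : volume M = volume K := by
    have := h5 (fun _ => 1) measurable_const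
    simpa using this
  have hpos : volume M ≠ 0 := ((isOpen_interior.measure_pos _ h3).trans_le
    (measure_mono interior_subset)).ne'
  have hex : ∀ S : Set (Fin (m + 1) → ℝ), 2 * volume (M ∩ S) = volume M →
      ∃ p ∈ interior M, p ∈ S := by
    intro S hS
    by_contra! hcon
    have : M ∩ S ⊆ frontier M := fun x hx =>
      ⟨subset_closure hx.1, fun h => hcon x h hx.2⟩
    have h0 := measure_mono_null this (h2.addHaar_frontier volume)
    rw [h0, mul_zero] at hS
    exact hpos hS.symm
  obtain ⟨p, hp, hpζ⟩ := hex _ hζ1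
  obtain ⟨q, hq, hqζ⟩ := hex _ hζ2
  have hp' := single_mem_interior_of_coordFlip h2 h4 hp
  have hq' := single_mem_interior_of_coordFlip h2 h4 hq
  have hpζ' : ζ < p 0 := hpζ
  have hqζ' : q 0 < ζ := hqζ
  have hpq : 0 < p 0 - q 0 := by linarith
  have hζM : Pi.single 0 ζ ∈ interior M := by
    convert h2.interior hp' hq' (a := (ζ - q 0) / (p 0 - q 0)) (b := (p 0 - ζ) / (p 0 - q 0))
      (div_nonneg (by linarith) hpq.le) (div_nonneg (by linarith) hpq.le)
      (by field_simp; ring) using 1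
    rw [← Pi.single_smul, ← Pi.single_smul, ← Pi.single_add]
    congr 1
    simp only [smul_eq_mul]
    field_simp
    ring
  have hint : interior ((fun y => y - Pi.single 0 ζ) '' M) =
      (fun y => y - Pi.single 0 ζ) '' interior M :=
    ((Homeomorph.subRight (Pi.single 0 ζ : Fin (m + 1) → ℝ)).image_interior M).symm
  have hinj : Function.Injective fun y : Fin (m + 1) → ℝ => y - Pi.single 0 ζ := sub_left_injective
  have hmp : MeasurePreserving (fun y : Fin (m + 1) → ℝ => y - Pi.single 0 ζ) volume volume :=
    measurePreserving_sub_right volume _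
  have hme : MeasurableEmbedding fun y : Fin (m + 1) → ℝ => y - Pi.single 0 ζ :=
    measurableEmbedding_subRight _
  have himg : ∀ S T : Set (Fin (m + 1) → ℝ), (fun y => y - Pi.single 0 ζ) ⁻¹' T = S →
      volume (((fun y => y - Pi.single 0 ζ) '' M) ∩ T) = volume (M ∩ S) := by
    intro S T hST
    rw [← hmp.measure_preimage_emb hme, Set.preimage_inter, Set.preimage_image_eq _ hinj, hST]
  refine ⟨ζ, (fun y => y - Pi.single 0 ζ) '' M, h1.image (by fun_prop), ?_, ?_, ?_, ?_, ?_, ?_, ?_,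
    ?_⟩
  · have e : (fun y : Fin (m + 1) → ℝ => y - Pi.single 0 ζ) = fun y => -Pi.single 0 ζ + y := by
      ext y; simp [sub_eq_neg_add]
    rw [e]
    exact h2.translate _
  · rw [hint]
    exact ⟨_, hζM, sub_self _⟩
  · rintro j hj _ ⟨x, hx, rfl⟩
    refine ⟨_, h4 j hj x hx, ?_⟩
    have h0 : coordFlip j (Pi.single 0 ζ : Fin (m + 1) → ℝ) = Pi.single 0 ζ := by
      ext k
      by_cases hk : k = j
      · subst hk; simp [coordFlip_same, hj]
      · rw [coordFlip_of_ne hk]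
    simp only [coordFlip_sub, h0]
  · intro g hg
    have hg' : Measurable fun t => g (t - ζ) := by fun_prop
    rw [← h5 _ hg', ← hmp.setLIntegral_comp_preimage_emb hme, Set.preimage_image_eq _ hinj]
    simp
  · rw [Set.image_image]
    simp only [Pi.sub_apply, Pi.single_eq_same]
    have := congrArg (fun S => (fun t => t - ζ) '' S) h6
    simpa [Set.image_image] using this
  · rw [himg {x | ζ < x 0}, hζ1, hvol]
    ext x; simp
  · rw [himg {x | x 0 < ζ}, hζ2, hvol]
    ext x; simp
  · intro z hz
    rw [polarAt_image_sub, ← Pi.single_add]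
    refine h7 _ ?_
    rw [hint] at hz
    obtain ⟨y, hy, hyz⟩ := hz
    have : y = Pi.single 0 (ζ + z) := by
      rw [Pi.single_add, ← hyz]; simp
    rwa [← this]

section PolarShift

variable {m : ℕ} {i : Fin (m + 1)} {K : Set (Fin (m + 1) → ℝ)}

theorem volume_polarAt_single_pos {t z : ℝ} (ht : Pi.single i t ∈ K) (ht0 : 0 < t) (hzt : z < t) :
    volume (polarAt K (Pi.single i z) ∩ {y | 0 < y i}) =
      ∫⁻ y in polarAt K 0 ∩ {y | 0 < y i}, ENNReal.ofReal (1 - z * y i)⁻¹ ^ (m + 2) := by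
  have h1 := setLIntegral_polarAt_pos i K z (g := fun _ => 1) measurable_const
  have h2 := setLIntegral_polarAt_pos i K 0
    (g := fun s => ENNReal.ofReal (1 - z * s)⁻¹ ^ (m + 2)) (by fun_prop)
  rw [Pi.single_zero] at h2
  simp only [lintegral_one, Measure.restrict_apply_univ, one_mul] at h1
  rw [h2, h1, ← lintegral_indicator measurableSet_Ioi, ← lintegral_indicator measurableSet_Ioi,
    ← lintegral_sub_right_eq_self (μ := volume) _ z]
  refine lintegral_congr fun r => ?_
  by_cases hr : r < t
  · have he := supportSlice_eq_empty ht hr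
    simp [Set.indicator_apply, he]
  · have hr0 : 0 < r := by linarith
    have hrz : 0 < r - z := by linarith
    rw [Set.indicator_of_mem (show r - z ∈ Set.Ioi (0 : ℝ) from hrz),
      Set.indicator_of_mem (show r ∈ Set.Ioi (0 : ℝ) from hr0), ← mul_assoc, ← mul_pow,
      ← ENNReal.ofReal_mul' (by positivity), sub_add_cancel, add_zero]
    congr 3
    rw [← mul_inv]
    congr 1
    field_simp

theorem volume_polarAt_single_eq {t t' z : ℝ} (ht : Pi.single i t ∈ K) (ht0 : 0 < t) (hzt : z < t)
    (ht' : Pi.single i (-t') ∈ K) (ht0' : 0 < t') (hzt' : -t' < z) :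
    volume (polarAt K (Pi.single i z)) =
      ∫⁻ y in polarAt K 0, ENNReal.ofReal (1 - z * y i)⁻¹ ^ (m + 2) := by
  set f : (Fin (m + 1) → ℝ) → ℝ≥0∞ := fun y => ENNReal.ofReal (1 - z * y i)⁻¹ ^ (m + 2) with hf
  have hneg : volume (polarAt K (Pi.single i z) ∩ {y | y i < 0}) =
      ∫⁻ y in polarAt K 0 ∩ {y | y i < 0}, f y := by
    have h := volume_polarAt_single_pos (i := i) (K := coordFlip i '' K) (t := t') (z := -z)
      ⟨_, ht', by rw [coordFlip_single, neg_neg]⟩ ht0' (by linarith)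
    have hset : ∀ w w' : ℝ, w' = -w → coordFlip i ⁻¹' (polarAt K (Pi.single i w) ∩ {y | y i < 0}) =
        polarAt (coordFlip i '' K) (Pi.single i w') ∩ {y | 0 < y i} := by
      rintro w _ rfl
      ext y
      rw [← coordFlip_single]
      refine and_congr (coordFlip_mem_polarAt i K _ y) ?_
      simp [coordFlip_same]
    have hm : ∀ w, MeasurableSet (polarAt K (Pi.single i w) ∩ {y | y i < 0}) := fun w =>
      (isClosed_polarAt _ _).measurableSet.inter
        (measurableSet_lt (measurable_pi_apply i) measurable_const)
    have h0 : (0 : Fin (m + 1) → ℝ) = Pi.single i 0 := (Pi.single_zero i).symm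
    rw [← hset z _ rfl, (measurePreserving_coordFlip i).measure_preimage (hm z).nullMeasurableSet,
      h0, ← hset 0 _ (by simp)] at h
    rw [h, h0, ← (measurePreserving_coordFlip i).setLIntegral_comp_preimage (hm 0)
      (by fun_prop)]
    simp [hf, coordFlip_same]
  have hsplit : ∫⁻ y in polarAt K 0, f y = (∫⁻ y in polarAt K 0 ∩ {y | 0 < y i}, f y) +
      ∫⁻ y in polarAt K 0 ∩ {y | y i < 0}, f y := by
    have hm : MeasurableSet {y : Fin (m + 1) → ℝ | 0 < y i} :=
      measurableSet_lt measurable_const (measurable_pi_apply i)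
    rw [← lintegral_inter_add_sdiff f (polarAt K 0) hm]
    congr 1
    have h0 : volume {y : Fin (m + 1) → ℝ | y i = 0} = 0 := Measure.pi_hyperplane _ i 0
    refine setLIntegral_congr ?_
    filter_upwards [measure_eq_zero_iff_ae_notMem.1 h0] with y hy
    have hy : y i ≠ 0 := hy
    apply propext
    change (y ∈ polarAt K 0 ∧ ¬ 0 < y i) ↔ (y ∈ polarAt K 0 ∧ y i < 0)
    refine and_congr_right fun _ => ?_
    rw [not_lt]
    exact ⟨fun h => lt_of_le_of_ne h hy, le_of_lt⟩
  rw [volume_eq_add_coord i, hsplit, hneg, volume_polarAt_single_pos ht ht0 hzt]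

end PolarShift

theorem exists_inv_one_sub_pow_le (k : ℕ) :
    ∃ C : ℝ, 0 ≤ C ∧ ∀ x : ℝ, |x| ≤ 1 / 2 → (1 - x)⁻¹ ^ k ≤ 1 + k * x + C * x ^ 2 := by
  induction k with
  | zero => exact ⟨0, le_rfl, fun x _ => by simp⟩
  | succ k ih =>
    obtain ⟨C, hC, h⟩ := ih
    refine ⟨2 * C + 2 * k + 2, by positivity, fun x hx => ?_⟩
    obtain ⟨hx1, hx2⟩ := abs_le.1 hx
    have hpos : 0 < 1 - x := by linarith
    have h1 : (1 - x)⁻¹ ≤ 1 + x + 2 * x ^ 2 := by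
      rw [inv_le_iff_one_le_mul₀ hpos]
      nlinarith [sq_nonneg x]
    have h2 := h x hx
    have h3 : 0 ≤ (1 - x)⁻¹ ^ k := by positivity
    rw [pow_succ]
    have h4 : (0 : ℝ) ≤ 1 + x + 2 * x ^ 2 := by nlinarith [sq_nonneg x]
    calc _ ≤ (1 + k * x + C * x ^ 2) * (1 + x + 2 * x ^ 2) :=
          mul_le_mul h2 h1 (by positivity) (h3.trans h2)
      _ = 1 + (k + 1) * x + (2 + k + C + 2 * k * x + C * x + 2 * C * x ^ 2) * x ^ 2 := by ring
      _ ≤ 1 + (k + 1) * x + (2 * C + 2 * k + 2) * x ^ 2 := by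
          refine add_le_add_right (mul_le_mul_of_nonneg_right ?_ (sq_nonneg x)) _
          have : x ^ 2 ≤ 1 / 4 := by nlinarith
          have : (k : ℝ) * x ≤ k * (1 / 2) := by gcongr
          have : C * x ≤ C * (1 / 2) := by gcongr
          have : C * x ^ 2 ≤ C * (1 / 4) := by gcongr
          linarith
      _ = _ := by push_cast; ring

theorem two_mul_volume_coordBall_inter {m : ℕ} :
    2 * axisLaw (coordBall (m + 1)) Set.univ = volume (coordBall (m + 1)) := by
  rw [axisLaw_univ, two_mul, volume_eq_add_coord 0 (coordBall (m + 1))]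
  congr 1
  have : coordFlip 0 ⁻¹' (coordBall (m + 1) ∩ {y | y 0 < 0}) =
      coordBall (m + 1) ∩ {y | 0 < y 0} := by
    ext y
    refine and_congr ?_ (by simp [coordFlip_same])
    change ∑ i, coordFlip 0 y i ^ 2 ≤ 1 ↔ ∑ i, y i ^ 2 ≤ 1
    have : ∀ i, coordFlip 0 y i ^ 2 = y i ^ 2 := fun i => by
      by_cases h : i = 0
      · rw [h, coordFlip_same, neg_sq]
      · rw [coordFlip_of_ne h]
    simp only [this]
  rw [← this, (measurePreserving_coordFlip 0).measure_preimage]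
  exact ((isClosed_coordBall _).measurableSet.inter
    (measurableSet_lt (measurable_pi_apply 0) measurable_const)).nullMeasurableSet

/-- A convex body which is invariant under all coordinate reflections other than the first one, is
bisected by the hyperplane `x 0 = 0`, and almost attains equality in the Blaschke–Santaló inequality
for all centres on the first coordinate axis. -/
structure IsBisectedBody {m : ℕ} (ε : ℝ) (M : Set (Fin (m + 1) → ℝ)) : Prop where
  isCompact : IsCompact M
  convex : Convex ℝ M
  zero_mem : 0 ∈ interior M
  coordFlip_mem : ∀ j, j ≠ 0 → ∀ x ∈ M, coordFlip j x ∈ M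
  two_mul_axisLaw : 2 * axisLaw M Set.univ = volume M
  two_mul_axisLaw_flip : 2 * axisLaw (coordFlip 0 '' M) Set.univ = volume M
  volume_sq_le : ∀ z : ℝ, Pi.single 0 z ∈ interior M → volume (coordBall (m + 1)) ^ 2 ≤
    ENNReal.ofReal (1 + ε) * (volume M * volume (polarAt M (Pi.single 0 z)))

namespace IsBisectedBody

variable {m : ℕ} {ε : ℝ} {M : Set (Fin (m + 1) → ℝ)}

theorem volume_image_coordFlip (i : Fin (m + 1)) (hM : MeasurableSet M) :
    volume (coordFlip i '' M) = volume M := by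
  rw [← (measurePreserving_coordFlip i).measure_preimage
    (s := M) hM.nullMeasurableSet]
  congr 1
  ext x
  constructor
  · rintro ⟨y, hy, rfl⟩
    change coordFlip i (coordFlip i y) ∈ M
    rwa [coordFlip_coordFlip]
  · intro h
    exact ⟨_, h, coordFlip_coordFlip i x⟩

theorem image_coordFlip_image_coordFlip (i : Fin (m + 1)) (M : Set (Fin (m + 1) → ℝ)) :
    coordFlip i '' (coordFlip i '' M) = M := by
  simp [Set.image_image, coordFlip_coordFlip]

theorem volume_polarAt_image_coordFlip (i : Fin (m + 1)) (M : Set (Fin (m + 1) → ℝ))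
    (z : Fin (m + 1) → ℝ) :
    volume (polarAt (coordFlip i '' M) (coordFlip i z)) = volume (polarAt M z) := by
  rw [← (measurePreserving_coordFlip i).measure_preimage
    (isClosed_polarAt M z).measurableSet.nullMeasurableSet]
  congr 1
  ext y
  exact (coordFlip_mem_polarAt i M z y).symm

theorem flip (h : IsBisectedBody ε M) : IsBisectedBody ε (coordFlip 0 '' M) where
  isCompact := h.isCompact.image (continuous_coordFlip 0)
  convex := convex_image_coordFlip 0 h.convex
  zero_mem := by
    have := (coordFlip_mem_interior_image 0).2 h.zero_mem
    rwa [show coordFlip 0 (0 : Fin (m + 1) → ℝ) = 0 by ext k; simp [coordFlip]] at this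
  coordFlip_mem := by
    rintro j hj _ ⟨x, hx, rfl⟩
    refine ⟨_, h.coordFlip_mem j hj x hx, ?_⟩
    ext k
    by_cases hk : k = 0 <;> by_cases hkj : k = j <;>
      simp_all [coordFlip]
  two_mul_axisLaw := by
    rw [h.two_mul_axisLaw_flip, volume_image_coordFlip 0 h.isCompact.measurableSet]
  two_mul_axisLaw_flip := by
    rw [image_coordFlip_image_coordFlip, h.two_mul_axisLaw,
      volume_image_coordFlip 0 h.isCompact.measurableSet]
  volume_sq_le z hz := by
    rw [volume_image_coordFlip 0 h.isCompact.measurableSet]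
    have : (Pi.single 0 z : Fin (m + 1) → ℝ) = coordFlip 0 (Pi.single 0 (-z)) := by
      rw [coordFlip_single, neg_neg]
    rw [this, volume_polarAt_image_coordFlip]
    refine h.volume_sq_le _ ?_
    rwa [this, coordFlip_mem_interior_image] at hz

theorem isBounded_polarAt (h : IsBisectedBody ε M) : Bornology.IsBounded (polarAt M 0) := by
  obtain ⟨r, hr, hb⟩ := Metric.isOpen_iff.1 isOpen_interior _ h.zero_mem
  have hmem : ∀ (i : Fin (m + 1)) (t : ℝ), |t| < r → Pi.single i t ∈ M := by
    intro i t ht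
    refine interior_subset (hb ?_)
    rw [mem_ball_zero_iff, pi_norm_lt_iff hr]
    intro j
    by_cases hj : j = i
    · subst hj; simpa using ht
    · simpa [hj] using hr
  refine isBounded_iff_forall_norm_le.2 ⟨2 / r, fun y hy => ?_⟩
  refine (pi_norm_le_iff_of_nonneg (by positivity)).2 fun i => abs_le.2 ?_
  have h1 := hy _ (hmem i (r / 2) (by rw [abs_of_pos (by positivity)]; linarith))
  have h2 := hy _ (hmem i (-(r / 2)) (by rw [abs_neg, abs_of_pos (by positivity)]; linarith))
  rw [sub_zero, single_dotProduct] at h1 h2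
  constructor
  · rw [← neg_div, div_le_iff₀ hr]; linarith
  · rw [le_div_iff₀ hr]; linarith

theorem convex_polarAt {ι : Type*} [Fintype ι] (K : Set (ι → ℝ)) (z : ι → ℝ) :
    Convex ℝ (polarAt K z) := by
  intro x hx y hy a b ha hb hab w hw
  rw [dotProduct_add, dotProduct_smul, dotProduct_smul, smul_eq_mul, smul_eq_mul]
  nlinarith [hx w hw, hy w hw]

theorem coordFlip_mem_polarAt_zero (h : IsBisectedBody ε M) (j : Fin (m + 1)) (hj : j ≠ 0)
    (y : Fin (m + 1) → ℝ) (hy : y ∈ polarAt M 0) : coordFlip j y ∈ polarAt M 0 := by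
  intro x hx
  rw [sub_zero, ← coordFlip_dotProduct, ← sub_zero (coordFlip j x)]
  exact hy _ (h.coordFlip_mem j hj x hx)

theorem volume_polarAt_zero (M : Set (Fin (m + 1) → ℝ)) :
    volume (polarAt M 0) =
      axisLaw (polarAt M 0) Set.univ + axisLaw (polarAt (coordFlip 0 '' M) 0) Set.univ := by
  rw [axisLaw_univ, axisLaw_univ, volume_eq_add_coord 0]
  congr 1
  rw [← (measurePreserving_coordFlip 0).measure_preimage
    ((isClosed_polarAt _ _).measurableSet.inter
    (measurableSet_lt (measurable_pi_apply 0) measurable_const)).nullMeasurableSet]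
  congr 1
  ext y
  have := coordFlip_mem_polarAt 0 M 0 y
  rw [show coordFlip 0 (0 : Fin (m + 1) → ℝ) = 0 by ext k; simp [coordFlip]] at this
  exact and_congr this (by simp [coordFlip_same])

theorem axisLaw_mul_axisLaw_le (h : IsBisectedBody ε M) :
    axisLaw M Set.univ * axisLaw (polarAt M 0) Set.univ ≤
      axisLaw (coordBall (m + 1)) Set.univ ^ 2 := by
  have := lintegral_axisLaw_mul_le (a := fun _ => 1) (b := fun _ => 1) (q := fun _ => 1)
    h.isCompact.measurableSet (isClosed_polarAt M 0).measurableSet h.coordFlip_mem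
    h.coordFlip_mem_polarAt_zero (fun x hx y hy => by simpa using hy x hx) measurable_const
    measurable_const measurable_const (by simp)
  simpa using this

theorem axisLaw_flip (h : IsBisectedBody ε M) :
    axisLaw (coordFlip 0 '' M) Set.univ = axisLaw M Set.univ := by
  have := h.two_mul_axisLaw.trans h.two_mul_axisLaw_flip.symm
  exact ((ENNReal.mul_right_inj (by norm_num) (by norm_num)).1 this).symm

theorem volume_ne_zero (h : IsBisectedBody ε M) : volume M ≠ 0 :=
  ((isOpen_interior.measure_pos _ ⟨_, h.zero_mem⟩).trans_le (measure_mono interior_subset)).ne'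

theorem axisLaw_ne_zero (h : IsBisectedBody ε M) : axisLaw M Set.univ ≠ 0 := fun h0 =>
  h.volume_ne_zero (by rw [← h.two_mul_axisLaw, h0, mul_zero])

theorem axisLaw_coordBall_sq_le (h : IsBisectedBody ε M) (hε : 0 < ε) (hε' : ε ≤ 1 / 2) :
    axisLaw (coordBall (m + 1)) Set.univ ^ 2 ≤ ENNReal.ofReal (1 + 4 * ε) *
      (axisLaw M Set.univ * axisLaw (polarAt M 0) Set.univ) := by
  have h1 := h.volume_sq_le 0 (by rw [Pi.single_zero]; exact h.zero_mem)
  have h2 := h.flip.axisLaw_mul_axisLaw_le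
  rw [h.axisLaw_flip] at h2
  rw [Pi.single_zero, volume_polarAt_zero, ← h.two_mul_axisLaw,
    ← two_mul_volume_coordBall_inter] at h1
  have hD := axisLaw_univ_ne_top (isBounded_coordBall (m + 1))
  have hA := axisLaw_univ_ne_top h.isCompact.isBounded
  have hP := axisLaw_univ_ne_top h.isBounded_polarAt
  have hP' := axisLaw_univ_ne_top h.flip.isBounded_polarAt
  lift axisLaw (coordBall (m + 1)) Set.univ to ℝ≥0 using hD with D
  lift axisLaw M Set.univ to ℝ≥0 using hA with A
  lift axisLaw (polarAt M 0) Set.univ to ℝ≥0 using hP with P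
  lift axisLaw (polarAt (coordFlip 0 '' M) 0) Set.univ to ℝ≥0 using hP' with P'
  rw [ENNReal.ofReal] at h1 ⊢
  norm_cast at h1 h2 ⊢
  rw [← NNReal.coe_le_coe] at h1 h2 ⊢
  push_cast [Real.coe_toNNReal _ (show 0 ≤ 1 + ε by linarith),
    Real.coe_toNNReal _ (show 0 ≤ 1 + 4 * ε by linarith)] at h1 h2 ⊢
  have hX : 0 ≤ (A : ℝ) * P := by positivity
  set X := (A : ℝ) * P
  set Y := (A : ℝ) * P'
  have h1' : 4 * (D : ℝ) ^ 2 ≤ (1 + ε) * (2 * (X + Y)) := by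
    calc _ = (2 * (D : ℝ)) ^ 2 := by ring
      _ ≤ _ := h1
      _ = _ := by ring
  have h3 : (1 + ε) * Y ≤ (1 + ε) * (D : ℝ) ^ 2 := by gcongr
  have h4 : (1 - ε) * (D : ℝ) ^ 2 ≤ (1 + ε) * X := by linarith
  have h5 : (1 - ε) * (D : ℝ) ^ 2 ≤ (1 - ε) * ((1 + 4 * ε) * X) := by
    refine h4.trans ?_
    nlinarith [mul_nonneg hε.le hX]
  exact le_of_mul_le_mul_left h5 (by linarith)

theorem axisLaw_coordBall_ne_zero : axisLaw (coordBall (m + 1)) Set.univ ≠ 0 := by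
  intro h0
  have h1 := two_mul_volume_coordBall_inter (m := m)
  rw [h0, mul_zero] at h1
  have : (Metric.ball (0 : Fin (m + 1) → ℝ) (1 / (m + 1))) ⊆ coordBall (m + 1) := by
    intro x hx
    rw [mem_ball_zero_iff, pi_norm_lt_iff (by positivity)] at hx
    have hs : ∀ i ∈ Finset.univ, x i ^ 2 ≤ 1 / ((m : ℝ) + 1) := fun i _ => by
      have h2 := (hx i).le
      rw [Real.norm_eq_abs] at h2
      have h3 : 1 / ((m : ℝ) + 1) ≤ 1 := by
        rw [div_le_one (by positivity)]; linarith [(Nat.cast_nonneg m : (0 : ℝ) ≤ m)]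
      rw [← sq_abs]
      nlinarith [abs_nonneg (x i)]
    have := Finset.sum_le_sum hs
    change ∑ i, x i ^ 2 ≤ 1
    refine this.trans_eq ?_
    simp
    field_simp
  exact (Metric.measure_ball_pos volume (0 : Fin (m + 1) → ℝ) (by positivity)).ne'
    (measure_mono_null this h1.symm)

theorem santaloPair (h : IsBisectedBody ε M) (hε : 0 < ε) (hε' : ε ≤ 1 / 2) :
    SantaloPair (4 * ε) (normalizeMeasure (axisLaw (coordBall (m + 1))))
      (normalizeMeasure (axisLaw M)) (normalizeMeasure (axisLaw (polarAt M 0))) :=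
  santaloPair_axisLaw h.isCompact.measurableSet (isClosed_polarAt M 0).measurableSet
    h.isCompact.isBounded h.isBounded_polarAt h.coordFlip_mem h.coordFlip_mem_polarAt_zero
    (fun x hx y hy => by simpa using hy x hx) axisLaw_coordBall_ne_zero
    (h.axisLaw_coordBall_sq_le hε hε')

theorem single_mem (h : IsBisectedBody ε M) {p : Fin (m + 1) → ℝ} (hp : p ∈ M) :
    Pi.single 0 (p 0) ∈ M := by
  have h1 : ∀ t : ℝ, 0 < t → t ≤ 1 → Pi.single 0 ((1 - t) * p 0) ∈ M := by
    intro t ht ht1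
    have := h.convex.combo_interior_self_mem_interior h.zero_mem hp ht
      (show 0 ≤ 1 - t by linarith) (by ring)
    rw [smul_zero, zero_add] at this
    exact interior_subset (single_mem_interior_of_coordFlip h.convex h.coordFlip_mem this)
  have hcont : Continuous fun t : ℝ => (Pi.single 0 ((1 - t) * p 0) : Fin (m + 1) → ℝ) :=
    (continuous_single (A := fun _ : Fin (m + 1) => ℝ) 0).comp (by fun_prop)
  have h2 : Tendsto (fun t : ℝ => (Pi.single 0 ((1 - t) * p 0) : Fin (m + 1) → ℝ)) (𝓝[>] 0)
      (𝓝 (Pi.single 0 (p 0))) := by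
    have := hcont.tendsto 0
    rw [sub_zero, one_mul] at this
    exact this.mono_left nhdsWithin_le_nhds
  refine h.isCompact.isClosed.mem_of_tendsto h2 ?_
  filter_upwards [Ioc_mem_nhdsGT (show (0 : ℝ) < 1 by norm_num)] with t ht
  exact h1 t ht.1 ht.2

theorem exists_single_mem_max (h : IsBisectedBody ε M) :
    ∃ σ : ℝ, 0 < σ ∧ Pi.single 0 σ ∈ M ∧ ∀ x ∈ M, x 0 ≤ σ := by
  obtain ⟨p, hp, hmax⟩ := h.isCompact.exists_isMaxOn ⟨0, interior_subset h.zero_mem⟩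
    (continuous_apply (0 : Fin (m + 1))).continuousOn
  refine ⟨p 0, ?_, h.single_mem hp, fun x hx => hmax hx⟩
  by_contra! hle
  refine h.axisLaw_ne_zero ?_
  rw [axisLaw_univ, show M ∩ {x | 0 < x 0} = ∅ from ?_, measure_empty]
  refine Set.eq_empty_iff_forall_notMem.2 fun x hx => ?_
  have h1 : x 0 ≤ p 0 := hmax hx.1
  have h2 : 0 < x 0 := hx.2
  linarith

end IsBisectedBody

namespace IsBisectedBody

variable {m : ℕ} {ε : ℝ} {M : Set (Fin (m + 1) → ℝ)}

theorem axisLaw_polarAt_ne_zero (h : IsBisectedBody ε M) (hε : 0 < ε) (hε' : ε ≤ 1 / 2) :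
    axisLaw (polarAt M 0) Set.univ ≠ 0 := by
  intro h0
  have := h.axisLaw_coordBall_sq_le hε hε'
  rw [h0, mul_zero, mul_zero, nonpos_iff_eq_zero, pow_eq_zero_iff two_ne_zero] at this
  exact axisLaw_coordBall_ne_zero this

/-- Stability on the half space `0 < x 0`: up to a scaling, `M` and its polar look like the unit
ball along the first coordinate axis. -/
theorem exists_scale (h : IsBisectedBody ε M) (hε : 0 < ε) {r : ℝ} (hr : 0 < r)
    (hr' : r ≤ 1 / 240) (hεr : √ε ≤ r ^ (m + 3)) {lam : Measure ℝ}
    (hlam : lam = normalizeMeasure (axisLaw (coordBall (m + 1)))) :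
    ∃ σ α : ℝ, 0 < σ ∧ 0 < α ∧ Pi.single 0 σ ∈ M ∧ (∀ x ∈ M, x 0 ≤ σ) ∧
      ∫ t, t ∂normalizeMeasure (axisLaw M) = α * ∫ t, t ∂lam ∧
      σ ≤ α * (1 + 120 * r) ∧ σ⁻¹ ≤ α⁻¹ * (1 + 120 * r) ∧
      |(∫ s, s ∂normalizeMeasure (axisLaw (polarAt M 0))) - α⁻¹ * ∫ t, t ∂lam| ≤
        α⁻¹ * (18 * √ε) ∧
      |(∫ t, t ^ 2 ∂normalizeMeasure (axisLaw M)) - α ^ 2 * ∫ t, t ^ 2 ∂lam| ≤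
        α ^ 2 * (25 * r) := by
  obtain ⟨σ, hσ, hσM, hMσ⟩ := h.exists_single_mem_max
  have hεr2 : √ε ≤ r ^ 2 :=
    hεr.trans (pow_le_pow_of_le_one hr.le (by linarith) (by omega))
  have hε16 : ε ≤ 1 / 16 := by
    have h0 := Real.sqrt_nonneg ε
    have h1 := Real.sq_sqrt hε.le
    have h2 : r ^ 2 ≤ 1 / 4 := by nlinarith
    nlinarith
  have hS := h.santaloPair hε (by linarith)
  rw [← hlam] at hS
  have hρ := hS.integral_ref_mem.1
  have := hS.prob_left
  have hμpos : 0 < ∫ t, t ∂normalizeMeasure (axisLaw M) := by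
    obtain ⟨R, hR⟩ := hS.left_mem
    rw [integral_pos_iff_support_of_nonneg_ae (hR.mono fun t ht => ht.1.le)
      (integrable_of_ae_mem hR continuous_id)]
    have : Function.support (fun t : ℝ => t) =ᵐ[normalizeMeasure (axisLaw M)] Set.univ :=
      hR.mono fun t ht => by
        apply propext
        exact ⟨fun _ => trivial, fun _ => ht.1.ne'⟩
    rw [measure_congr this]
    simp
  have h4 : √(4 * ε) = 2 * √ε := by
    rw [Real.sqrt_mul (by norm_num), show (4 : ℝ) = 2 ^ 2 by norm_num, Real.sqrt_sq (by norm_num)]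
  have hpolar : (Pi.single 0 σ⁻¹ : Fin (m + 1) → ℝ) ∈ polarAt M 0 := by
    intro x hx
    rw [sub_zero, dotProduct_single, ← div_eq_mul_inv, div_le_one hσ]
    exact hMσ x hx
  have hstab := hS.stability (by positivity) (by linarith)
    (α := (∫ t, t ∂normalizeMeasure (axisLaw M)) / ∫ t, t ∂lam) (by positivity)
    (by field_simp) (r₀ := 60 * r) (by positivity) (by linarith) (n := m + 1) (by
      rw [h4]
      have e : (60 * r) ^ 2 * (60 * r / 3) ^ (m + 1) = 3600 * 20 ^ (m + 1) * r ^ (m + 3) := by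
        rw [show 60 * r / 3 = 20 * r by ring, mul_pow, mul_pow, show m + 3 = m + 1 + 2 by ring,
          pow_add r]
        ring
      rw [e]
      have h20 : (1 : ℝ) ≤ 20 ^ (m + 1) := one_le_pow₀ (by norm_num)
      have hp : 0 < r ^ (m + 3) := by positivity
      nlinarith) (κ := r) hr (by linarith) (σ := σ)
    (ae_normalizeMeasure (ae_axisLaw (s := Set.Iic σ) measurableSet_Iic fun x hx _ => hMσ x hx))
    (fun θ hθ hθ1 => by
      simpa using pow_le_normalizeMeasure_axisLaw h.convex h.isCompact.isBounded h.axisLaw_ne_zero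
        hσM (by simpa using hσ) hθ hθ1)
    (fun θ hθ hθ1 => by
      simpa using pow_le_normalizeMeasure_axisLaw (convex_polarAt M 0) h.isBounded_polarAt
        (h.axisLaw_polarAt_ne_zero hε (by linarith)) hpolar (by simpa using hσ) hθ hθ1)
  set α := (∫ t, t ∂normalizeMeasure (axisLaw M)) / ∫ t, t ∂lam with hα
  have hα0 : 0 < α := by positivity
  obtain ⟨s1, s2, s3, s4⟩ := hstab
  refine ⟨σ, α, hσ, hα0, hσM, hMσ, by rw [hα]; field_simp, s1.trans_eq (by ring),
    s2.trans_eq (by ring), s3.trans_eq (by rw [h4]; ring), s4.trans ?_⟩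
  gcongr
  rw [h4]
  have : 10 * (2 * √ε) / r ≤ 20 * r := by
    rw [div_le_iff₀ hr]; nlinarith
  linarith

end IsBisectedBody

theorem measureReal_univ_mul_integral_normalizeMeasure (μ : Measure ℝ) [IsFiniteMeasure μ]
    (f : ℝ → ℝ) : μ.real Set.univ * ∫ t, f t ∂normalizeMeasure μ = ∫ t, f t ∂μ := by
  by_cases h0 : μ Set.univ = 0
  · rw [Measure.measure_univ_eq_zero.1 h0]
    simp
  · rw [normalizeMeasure, integral_smul_measure, smul_eq_mul, ← mul_assoc, ENNReal.toReal_inv,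
      measureReal_def, mul_inv_cancel₀, one_mul]
    exact ENNReal.toReal_ne_zero.2 ⟨h0, measure_ne_top _ _⟩

theorem setIntegral_eval_zero {m : ℕ} {L : Set (Fin (m + 1) → ℝ)}
    (hb : Bornology.IsBounded L) {f : ℝ → ℝ} (hf : Continuous f) :
    ∫ x in L, f (x 0) =
      (axisLaw L).real Set.univ * ∫ t, f t ∂normalizeMeasure (axisLaw L) +
      (axisLaw (coordFlip 0 '' L)).real Set.univ *
        ∫ t, f (-t) ∂normalizeMeasure (axisLaw (coordFlip 0 '' L)) := by
  have hb' : Bornology.IsBounded (coordFlip 0 '' L) := by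
    obtain ⟨R, hR⟩ := hb.exists_norm_le
    refine isBounded_iff_forall_norm_le.2 ⟨R, ?_⟩
    rintro _ ⟨x, hx, rfl⟩
    refine le_trans ?_ (hR x hx)
    refine (pi_norm_le_iff_of_nonneg (norm_nonneg _)).2 fun i => ?_
    by_cases hi : i = 0
    · rw [hi, coordFlip_same, norm_neg]; exact norm_le_pi_norm x 0
    · rw [coordFlip_of_ne hi]; exact norm_le_pi_norm x i
  have : IsFiniteMeasure (axisLaw L) := ⟨(axisLaw_univ_ne_top hb).lt_top⟩
  have : IsFiniteMeasure (axisLaw (coordFlip 0 '' L)) := ⟨(axisLaw_univ_ne_top hb').lt_top⟩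
  have hint : ∀ (L : Set (Fin (m + 1) → ℝ)) (f : ℝ → ℝ), Continuous f →
      ∫ t, f t ∂axisLaw L = ∫ x in L ∩ {x | 0 < x 0}, f (x 0) := fun L f hf => by
    rw [axisLaw, integral_map (measurable_pi_apply 0).aemeasurable hf.aestronglyMeasurable]
  rw [measureReal_univ_mul_integral_normalizeMeasure,
    measureReal_univ_mul_integral_normalizeMeasure, hint _ _ hf, hint _ _ (by fun_prop)]
  have hfi : IntegrableOn (fun x : Fin (m + 1) → ℝ => f (x 0)) L := by
    have : Continuous fun x : Fin (m + 1) → ℝ => f (x 0) := by fun_prop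
    exact (this.continuousOn.integrableOn_compact hb.isCompact_closure).mono_set subset_closure
  rw [← integral_inter_add_sdiff measurableSet_zero_lt_eval hfi]
  congr 1
  have h1 : coordFlip 0 ⁻¹' ((coordFlip 0 '' L) ∩ {x | 0 < x 0}) = L ∩ {x | x 0 < 0} := by
    ext y
    refine and_congr ?_ (by simp [coordFlip_same])
    exact (Function.LeftInverse.injective (coordFlip_coordFlip 0)).mem_set_image
  have h2 := (measurePreserving_coordFlip (0 : Fin (m + 1))).setIntegral_preimage_emb
    (coordFlipHomeomorph 0).measurableEmbedding (fun x => f (-x 0))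
    ((coordFlip 0 '' L) ∩ {x | 0 < x 0})
  rw [h1] at h2
  rw [← h2]
  simp only [coordFlip_same, neg_neg]
  refine setIntegral_congr_set ?_
  have h0 : volume {y : Fin (m + 1) → ℝ | y 0 = 0} = 0 := Measure.pi_hyperplane _ 0 0
  filter_upwards [measure_eq_zero_iff_ae_notMem.1 h0] with y hy
  have hy : y 0 ≠ 0 := hy
  apply propext
  change (y ∈ L ∧ ¬ 0 < y 0) ↔ (y ∈ L ∧ y 0 < 0)
  refine and_congr_right fun _ => ?_
  rw [not_lt]
  exact ⟨fun h => lt_of_le_of_ne h hy, le_of_lt⟩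

namespace IsBisectedBody

variable {m : ℕ} {ε : ℝ} {M : Set (Fin (m + 1) → ℝ)}

theorem single_mul_mem_interior (h : IsBisectedBody ε M) {t c : ℝ} (ht : Pi.single 0 t ∈ M)
    (hc : 0 ≤ c) (hc1 : c < 1) : Pi.single 0 (c * t) ∈ interior M := by
  have := h.convex.combo_interior_self_mem_interior h.zero_mem ht (show 0 < 1 - c by linarith)
    hc (by ring)
  rwa [smul_zero, zero_add, ← Pi.single_smul, smul_eq_mul] at this

theorem polarAt_image_coordFlip (M : Set (Fin (m + 1) → ℝ)) :
    polarAt (coordFlip 0 '' M) 0 = coordFlip 0 '' polarAt M 0 := by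
  have h0 : coordFlip 0 (0 : Fin (m + 1) → ℝ) = 0 := by ext k; simp [coordFlip]
  ext y
  have := coordFlip_mem_polarAt 0 M 0 y
  rw [h0] at this
  rw [← this]
  exact ⟨fun h => ⟨_, h, coordFlip_coordFlip 0 y⟩, by
    rintro ⟨x, hx, rfl⟩; rwa [coordFlip_coordFlip]⟩

theorem integrableOn_polarAt (h : IsBisectedBody ε M) {f : (Fin (m + 1) → ℝ) → ℝ}
    (hf : Continuous f) : IntegrableOn f (polarAt M 0) :=
  hf.continuousOn.integrableOn_compact
    (Metric.isCompact_of_isClosed_isBounded (isClosed_polarAt M 0) h.isBounded_polarAt)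

/-- A second order expansion of the volume of the polar body in terms of the centre. -/
theorem volume_polarAt_single_le (h : IsBisectedBody ε M) {C : ℝ}
    (hC : ∀ x : ℝ, |x| ≤ 1 / 2 → (1 - x)⁻¹ ^ (m + 2) ≤ 1 + (m + 2 : ℕ) * x + C * x ^ 2)
    (hC0 : 0 ≤ C) {S z : ℝ} (hS : ∀ y ∈ polarAt M 0, |y 0| ≤ S) (hz : |z| * S ≤ 1 / 2)
    (hzM : Pi.single 0 z ∈ interior M) :
    volume (polarAt M (Pi.single 0 z)) ≤ ENNReal.ofReal
      ((1 + C * (z * S) ^ 2) * volume.real (polarAt M 0) +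
        (m + 2 : ℕ) * z * ∫ y in polarAt M 0, y 0) := by
  obtain ⟨σ, hσ, hσM, hMσ⟩ := h.exists_single_mem_max
  obtain ⟨σ', hσ', hσM', hMσ'⟩ := h.flip.exists_single_mem_max
  have hlt : ∀ {M : Set (Fin (m + 1) → ℝ)} {σ z : ℝ}, (∀ x ∈ M, x 0 ≤ σ) →
      Pi.single 0 z ∈ interior M → z < σ := by
    intro M σ z hMσ hz
    have hmem : ∀ᶠ t in 𝓝[>] z, (Pi.single 0 t : Fin (m + 1) → ℝ) ∈ M := by
      have := (continuous_single (A := fun _ : Fin (m + 1) => ℝ) 0).tendsto z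
      exact (this.mono_left nhdsWithin_le_nhds) (mem_interior_iff_mem_nhds.1 hz)
    obtain ⟨t, ht, hzt⟩ := (hmem.and self_mem_nhdsWithin).exists
    have h1 := hMσ _ ht
    rw [Pi.single_eq_same] at h1
    exact lt_of_lt_of_le hzt h1
  have h1 : z < σ := hlt hMσ hzM
  have h2 : -z < σ' := hlt hMσ' (by
    rwa [← coordFlip_single, coordFlip_mem_interior_image])
  have h3 : Pi.single 0 (-σ') ∈ M := by
    obtain ⟨x, hx, hxσ⟩ := hσM'
    rw [← coordFlip_single, ← hxσ, coordFlip_coordFlip]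
    exact hx
  rw [volume_polarAt_single_eq hσM hσ h1 h3 hσ' (by linarith)]
  have hzy : ∀ y ∈ polarAt M 0, |z * y 0| ≤ |z| * S := fun y hy => by
    rw [abs_mul]
    exact mul_le_mul_of_nonneg_left (hS y hy) (abs_nonneg z)
  have hbd : ∀ y ∈ polarAt M 0, (1 - z * y 0)⁻¹ ^ (m + 2) ≤
      1 + (m + 2 : ℕ) * (z * y 0) + C * (z * S) ^ 2 := fun y hy => by
    refine (hC _ ((hzy y hy).trans hz)).trans ?_
    gcongr 1 + _ + C * ?_
    rw [← sq_abs (z * y 0), ← sq_abs (z * S), abs_mul z S]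
    have hS0 : 0 ≤ S := (abs_nonneg _).trans (hS y hy)
    rw [abs_of_nonneg hS0]
    exact pow_le_pow_left₀ (abs_nonneg _) (hzy y hy) 2
  have hpos : ∀ y ∈ polarAt M 0, 0 ≤ (1 - z * y 0)⁻¹ := fun y hy => by
    have := (abs_le.1 ((hzy y hy).trans hz)).2
    exact inv_nonneg.2 (by linarith)
  have hmeas := (isClosed_polarAt M 0).measurableSet
  have hi0 : IntegrableOn (fun y : Fin (m + 1) → ℝ => y 0) (polarAt M 0) :=
    h.integrableOn_polarAt (by fun_prop)
  have hvol : volume (polarAt M 0) ≠ ⊤ := h.isBounded_polarAt.measure_lt_top.ne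
  calc ∫⁻ y in polarAt M 0, ENNReal.ofReal (1 - z * y 0)⁻¹ ^ (m + 2)
      ≤ ∫⁻ y in polarAt M 0, ENNReal.ofReal
          (1 + (m + 2 : ℕ) * (z * y 0) + C * (z * S) ^ 2) := by
        refine setLIntegral_mono' hmeas fun y hy => ?_
        rw [← ENNReal.ofReal_pow (hpos y hy)]
        exact ENNReal.ofReal_le_ofReal (hbd y hy)
    _ = ENNReal.ofReal (∫ y in polarAt M 0,
          (1 + (m + 2 : ℕ) * (z * y 0) + C * (z * S) ^ 2)) := by
        refine (ofReal_integral_eq_lintegral_ofReal (h.integrableOn_polarAt (by fun_prop)) ?_).symm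
        filter_upwards [self_mem_ae_restrict hmeas] with y hy
        exact (pow_nonneg (hpos y hy) _).trans (hbd y hy)
    _ ≤ _ := by
        refine ENNReal.ofReal_le_ofReal (le_of_eq ?_)
        have hi1 : ∀ c : ℝ, IntegrableOn (fun _ : Fin (m + 1) → ℝ => c) (polarAt M 0) :=
          fun c => integrableOn_const hvol
        have hi2 : IntegrableOn (fun y : Fin (m + 1) → ℝ => ((m + 2 : ℕ) : ℝ) * (z * y 0))
          (polarAt M 0) := (hi0.const_mul z).const_mul _
        have hi3 : IntegrableOn (fun y : Fin (m + 1) → ℝ => 1 + ((m + 2 : ℕ) : ℝ) * (z * y 0))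
          (polarAt M 0) := (hi1 1).add hi2
        rw [integral_add hi3 (hi1 _), integral_add (hi1 1) hi2,
          integral_const_mul, integral_const_mul, setIntegral_const, setIntegral_const,
          smul_eq_mul, smul_eq_mul]
        ring

end IsBisectedBody

namespace IsBisectedBody

variable {m : ℕ} {ε : ℝ} {M : Set (Fin (m + 1) → ℝ)}

/-- The two halves of the polar body have almost the same mean, by optimality of the centre. -/
theorem abs_integral_sub_integral_le (h : IsBisectedBody ε M) (hε : 0 < ε) (hε' : ε ≤ 1 / 4)
    {C : ℝ}
    (hC : ∀ x : ℝ, |x| ≤ 1 / 2 → (1 - x)⁻¹ ^ (m + 2) ≤ 1 + (m + 2 : ℕ) * x + C * x ^ 2)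
    (hC0 : 0 ≤ C) {S : ℝ} (hS0 : 0 < S) (hS : ∀ y ∈ polarAt M 0, |y 0| ≤ S) :
    |(∫ s, s ∂normalizeMeasure (axisLaw (polarAt M 0))) -
      ∫ s, s ∂normalizeMeasure (axisLaw (polarAt (coordFlip 0 '' M) 0))| ≤
      (12 + C) * √ε * S := by
  obtain ⟨σ, hσ, hσM, hMσ⟩ := h.exists_single_mem_max
  obtain ⟨σ', hσ', hσM', hMσ'⟩ := h.flip.exists_single_mem_max
  have hσM'' : Pi.single 0 (-σ') ∈ M := by
    obtain ⟨x, hx, hxσ⟩ := hσM'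
    rw [← coordFlip_single, ← hxσ, coordFlip_coordFlip]
    exact hx
  have hSσ : 1 ≤ S * σ := by
    have := hS (Pi.single 0 σ⁻¹) fun x hx => by
      rw [sub_zero, dotProduct_single, ← div_eq_mul_inv, div_le_one hσ]
      exact hMσ x hx
    rw [Pi.single_eq_same, abs_of_pos (by positivity)] at this
    rwa [← div_le_iff₀ hσ, one_div]
  have hSσ' : 1 ≤ S * σ' := by
    have := hS (Pi.single 0 (-σ'⁻¹)) fun x hx => by
      have h1 := hMσ' _ ⟨x, hx, rfl⟩
      rw [coordFlip_same] at h1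
      rw [sub_zero, dotProduct_single, mul_neg, ← neg_mul, ← div_eq_mul_inv, div_le_one hσ']
      exact h1
    rw [Pi.single_eq_same, abs_neg, abs_of_pos (by positivity)] at this
    rwa [← div_le_iff₀ hσ', one_div]
  set A := ∫ y in polarAt M 0, y 0 with hA
  set sp := ∫ s, s ∂normalizeMeasure (axisLaw (polarAt M 0)) with hsp
  set sm := ∫ s, s ∂normalizeMeasure (axisLaw (polarAt (coordFlip 0 '' M) 0)) with hsm
  set vp := (axisLaw (polarAt M 0)).real Set.univ with hvp
  set vm := (axisLaw (polarAt (coordFlip 0 '' M) 0)).real Set.univ with hvm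
  set a := (axisLaw M).real Set.univ with ha
  set D := (axisLaw (coordBall (m + 1))).real Set.univ with hD
  have hAeq : A = vp * sp - vm * sm := by
    have := setIntegral_eval_zero h.isBounded_polarAt continuous_id
    rw [← polarAt_image_coordFlip] at this
    simp only [id] at this
    rw [hA, this, integral_neg, mul_neg, ← sub_eq_add_neg]
  have hDfin := axisLaw_univ_ne_top (isBounded_coordBall (m + 1))
  have hafin := axisLaw_univ_ne_top h.isCompact.isBounded
  have hpfin := axisLaw_univ_ne_top h.isBounded_polarAt
  have hmfin := axisLaw_univ_ne_top h.flip.isBounded_polarAt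
  have hD0 : 0 < D := ENNReal.toReal_pos axisLaw_coordBall_ne_zero hDfin
  have ha0 : 0 < a := ENNReal.toReal_pos h.axisLaw_ne_zero hafin
  have hp1 : a * vp ≤ D ^ 2 := by
    have := ENNReal.toReal_mono (by finiteness) h.axisLaw_mul_axisLaw_le
    rwa [ENNReal.toReal_mul, ENNReal.toReal_pow] at this
  have hm1 : a * vm ≤ D ^ 2 := by
    have := ENNReal.toReal_mono (by finiteness) h.flip.axisLaw_mul_axisLaw_le
    rwa [ENNReal.toReal_mul, ENNReal.toReal_pow, h.axisLaw_flip] at this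
  have hp2 : D ^ 2 ≤ (1 + 4 * ε) * (a * vp) := by
    have := ENNReal.toReal_mono (by finiteness) (h.axisLaw_coordBall_sq_le hε (by linarith))
    rwa [ENNReal.toReal_mul, ENNReal.toReal_pow, ENNReal.toReal_mul,
      ENNReal.toReal_ofReal (by linarith)] at this
  have hm2 : D ^ 2 ≤ (1 + 4 * ε) * (a * vm) := by
    have := ENNReal.toReal_mono (by rw [h.axisLaw_flip]; finiteness)
      (h.flip.axisLaw_coordBall_sq_le hε (by linarith))
    rwa [ENNReal.toReal_mul, ENNReal.toReal_pow, ENNReal.toReal_mul, h.axisLaw_flip,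
      ENNReal.toReal_ofReal (by linarith)] at this
  have hvol : volume.real (polarAt M 0) = vp + vm := by
    rw [measureReal_def, volume_polarAt_zero, ENNReal.toReal_add hpfin hmfin]; rfl
  have hmono : ∀ z : ℝ, |z| * S ≤ 1 / 2 → Pi.single 0 z ∈ interior M →
      (2 * D) ^ 2 ≤ (1 + ε) * (2 * a * ((1 + C * (z * S) ^ 2) * (vp + vm) +
        (m + 2 : ℕ) * z * A)) := by
    intro z hz hzM
    have h1 := h.volume_sq_le z hzM
    have h2 := h.volume_polarAt_single_le hC hC0 hS hz hzM
    rw [hvol] at h2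
    set E := (1 + C * (z * S) ^ 2) * (vp + vm) + (m + 2 : ℕ) * z * A with hE
    have h3 := h1.trans (mul_le_mul_right (mul_le_mul_right h2 _) _)
    rw [← two_mul_volume_coordBall_inter, ← h.two_mul_axisLaw] at h3
    have hE0 : 0 ≤ E := by
      by_contra! hneg
      rw [ENNReal.ofReal_of_nonpos hneg.le, mul_zero, mul_zero, nonpos_iff_eq_zero,
        pow_eq_zero_iff two_ne_zero, mul_eq_zero] at h3
      exact h3.elim (by norm_num) axisLaw_coordBall_ne_zero
    have h4 := ENNReal.toReal_mono (by finiteness) h3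
    rw [ENNReal.toReal_pow, ENNReal.toReal_mul, ENNReal.toReal_mul, ENNReal.toReal_mul,
      ENNReal.toReal_mul, ENNReal.toReal_ofReal (by linarith), ENNReal.toReal_ofReal hE0] at h4
    exact h4
  have hsqrt := Real.sq_sqrt hε.le
  have hsq0 : 0 < √ε := Real.sqrt_pos.2 hε
  have hsq1 : √ε ≤ 1 := by
    rw [Real.sqrt_le_left zero_le_one]; linarith
  have hkey : a * |A| ≤ (4 + C) * D ^ 2 * √ε * S := by
    have hz1 : ∀ z : ℝ, |z| * S = √ε / 2 → Pi.single 0 z ∈ interior M →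
        -(2 * a * ((m + 2 : ℕ) * z * A)) ≤ D ^ 2 * ε * (4 + C) := by
      intro z hz hzM
      have h1 := hmono z (by linarith) hzM
      have h2 : (z * S) ^ 2 = ε / 4 := by
        rw [← sq_abs, abs_mul, abs_of_pos hS0, hz, div_pow, hsqrt]; norm_num
      rw [h2] at h1
      have h3 : (1 + C * (ε / 4)) * (a * vp + a * vm) ≤ (1 + C * (ε / 4)) * (2 * D ^ 2) := by
        have : 0 ≤ C * (ε / 4) := by positivity
        gcongr
        linarith
      have h4 : 4 * D ^ 2 ≤ (1 + ε) * (4 * D ^ 2 * (1 + C * (ε / 4)) +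
          2 * a * ((m + 2 : ℕ) * z * A)) := by
        calc _ = (2 * D) ^ 2 := by ring
          _ ≤ _ := h1
          _ = (1 + ε) * (2 * ((1 + C * (ε / 4)) * (a * vp + a * vm)) +
            2 * a * ((m + 2 : ℕ) * z * A)) := by ring
          _ ≤ _ := by
            refine mul_le_mul_of_nonneg_left ?_ (by linarith)
            linarith
      refine le_of_mul_le_mul_left (a := 1 + ε) ?_ (by linarith)
      nlinarith [mul_nonneg (sq_nonneg D) (sq_nonneg ε)]
    have hz2 : -(a * ((m + 2 : ℕ) * A)) ≤ (4 + C) * D ^ 2 * √ε * S := by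
      have h1 := hz1 (√ε / (2 * S)) (by rw [abs_of_pos (by positivity)]; field_simp) (by
        have e : √ε / (2 * S) = √ε / (2 * (S * σ)) * σ := by field_simp
        rw [e]
        refine h.single_mul_mem_interior hσM (by positivity) ?_
        rw [div_lt_one (by positivity)]
        linarith)
      have h2 : -(2 * a * ((m + 2 : ℕ) * (√ε / (2 * S)) * A)) =
          √ε / S * -(a * ((m + 2 : ℕ) * A)) := by field_simp
      rw [h2] at h1
      refine le_of_mul_le_mul_left (a := √ε / S) (h1.trans_eq ?_) (by positivity)
      field_simp
      exact hsqrt.symm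
    have hz3 : a * ((m + 2 : ℕ) * A) ≤ (4 + C) * D ^ 2 * √ε * S := by
      have h1 := hz1 (-(√ε / (2 * S)))
        (by rw [abs_neg, abs_of_pos (by positivity)]; field_simp) (by
        have e : -(√ε / (2 * S)) = √ε / (2 * (S * σ')) * -σ' := by field_simp
        rw [e]
        refine h.single_mul_mem_interior hσM'' (by positivity) ?_
        rw [div_lt_one (by positivity)]
        linarith)
      have h2 : -(2 * a * ((m + 2 : ℕ) * -(√ε / (2 * S)) * A)) =
          √ε / S * (a * ((m + 2 : ℕ) * A)) := by field_simp
      rw [h2] at h1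
      refine le_of_mul_le_mul_left (a := √ε / S) (h1.trans_eq ?_) (by positivity)
      field_simp
      exact hsqrt.symm
    have h1 : |a * ((m + 2 : ℕ) * A)| ≤ (4 + C) * D ^ 2 * √ε * S :=
      abs_le.2 ⟨by linarith, hz3⟩
    refine le_trans ?_ h1
    rw [abs_mul, abs_mul, abs_of_pos ha0]
    gcongr
    refine le_mul_of_one_le_left (abs_nonneg _) ?_
    rw [Nat.abs_cast]
    push_cast
    linarith [(Nat.cast_nonneg m : (0 : ℝ) ≤ m)]
  have hprob := (h.santaloPair hε (by linarith)).prob_right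
  have hprob' := (h.flip.santaloPair hε (by linarith)).prob_right
  have habs : ∀ L : Set (Fin (m + 1) → ℝ), (∀ y ∈ L, |y 0| ≤ S) →
      IsProbabilityMeasure (normalizeMeasure (axisLaw L)) →
      |∫ s, s ∂normalizeMeasure (axisLaw L)| ≤ S := by
    intro L hL _
    have := norm_integral_le_of_norm_le_const (μ := normalizeMeasure (axisLaw L))
      (f := fun s => s) (C := S) (ae_normalizeMeasure (ae_axisLaw (s := {s | |s| ≤ S})
        (measurableSet_le (by fun_prop) measurable_const) fun x hx _ => hL x hx))
    rwa [probReal_univ, mul_one, Real.norm_eq_abs] at this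
  have hspS : |sp| ≤ S := habs _ hS hprob
  have hsmS : |sm| ≤ S := by
    refine habs _ (fun y hy => ?_) hprob'
    rw [polarAt_image_coordFlip] at hy
    obtain ⟨x, hx, rfl⟩ := hy
    rw [coordFlip_same, abs_neg]
    exact hS x hx
  have hfin : D ^ 2 * |sp - sm| ≤ D ^ 2 * ((12 + C) * √ε * S) := by
    have e : D ^ 2 * (sp - sm) = a * A + (D ^ 2 - a * vp) * sp - (D ^ 2 - a * vm) * sm := by
      rw [hAeq]; ring
    have hεs : ε ≤ √ε := by nlinarith
    have hb : ∀ v s : ℝ, a * v ≤ D ^ 2 → D ^ 2 ≤ (1 + 4 * ε) * (a * v) → |s| ≤ S →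
        |(D ^ 2 - a * v) * s| ≤ 4 * √ε * D ^ 2 * S := by
      intro v s h1 h2 h3
      rw [abs_mul, abs_of_nonneg (sub_nonneg.2 h1)]
      have : D ^ 2 - a * v ≤ 4 * √ε * D ^ 2 := by
        have : ε * (a * v) ≤ √ε * D ^ 2 := by
          have : 0 ≤ a * v := by nlinarith [sq_nonneg D]
          gcongr
        linarith
      exact mul_le_mul this h3 (abs_nonneg _) (by positivity)
    have h1 := hb vp sp hp1 hp2 hspS
    have h2 := hb vm sm hm1 hm2 hsmS
    rw [← abs_of_pos (show 0 < D ^ 2 by positivity), ← abs_mul, e,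
      abs_of_pos (show 0 < D ^ 2 by positivity)]
    refine (abs_sub _ _).trans ((add_le_add_left (abs_add_le _ _) _).trans ?_)
    rw [abs_mul, abs_of_pos ha0]
    linarith
  exact le_of_mul_le_mul_left hfin (by positivity)

end IsBisectedBody

theorem sqrt_bounds_of_abs_sub_le {α β w c r : ℝ} (hα : 0 < α) (hc : 0 < c) (hr : 0 ≤ r)
    (hβ : 0 ≤ β) (hβr : β * r ≤ c / 2) (hw : |w - α ^ 2 * c| ≤ α ^ 2 * (β * r)) :
    α * (1 - β / c * r) ≤ √(w / c) ∧ √(w / c) ≤ α * (1 + β / c * r) := by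
  obtain ⟨h1, h2⟩ := abs_le.1 hw
  have hx : β / c * r ≤ 1 / 2 := by
    rw [div_mul_eq_mul_div, div_le_iff₀ hc]; linarith
  have hx0 : 0 ≤ β / c * r := by positivity
  have e : α ^ 2 * (β * r) = α ^ 2 * (β / c * r) * c := by field_simp
  rw [e] at h1 h2
  set x := β / c * r
  constructor
  · refine Real.le_sqrt_of_sq_le ?_
    rw [le_div_iff₀ hc]
    have : (α * (1 - x)) ^ 2 ≤ α ^ 2 * (1 - x) := by
      rw [mul_pow]; gcongr; nlinarith
    nlinarith
  · rw [Real.sqrt_le_left (by positivity), div_le_iff₀ hc]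
    have : α ^ 2 * (1 + x) ≤ (α * (1 + x)) ^ 2 := by
      rw [mul_pow]; gcongr; nlinarith
    nlinarith

theorem abs_variance_sub_le {α d w ρ c C₁ r : ℝ} (hc : 0 < c)
    (hc1 : c ≤ 1) (hρ : 0 < ρ) (hρ1 : ρ ≤ 1) (hr : 0 < r)
    (hd2 : d ^ 2 ≤ C₁ * r * α ^ 2) (hd3 : d ^ 2 ≤ α ^ 2)
    (hw : |w - (α ^ 2 + d ^ 2) * c| ≤ (α ^ 2 + d ^ 2) * (25 * r)) :
    |w - (ρ * d) ^ 2 - α ^ 2 * c| ≤ α ^ 2 * ((2 * C₁ + 50) * r) := by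
  have hρ2 : (ρ * d) ^ 2 ≤ C₁ * r * α ^ 2 := by
    rw [mul_pow]
    exact (mul_le_of_le_one_left (sq_nonneg d) (pow_le_one₀ hρ.le hρ1)).trans hd2
  have hρ3 : 0 ≤ (ρ * d) ^ 2 := sq_nonneg _
  obtain ⟨w1, w2⟩ := abs_le.1 hw
  have h5 : 0 ≤ d ^ 2 * c := by positivity
  have h6 : d ^ 2 * c ≤ C₁ * r * α ^ 2 := (mul_le_of_le_one_right (sq_nonneg d) hc1).trans hd2
  have h7 : d ^ 2 * r ≤ α ^ 2 * r := by gcongr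
  have h8 : 0 ≤ C₁ * r * α ^ 2 := (sq_nonneg d).trans hd2
  have e1 : (α ^ 2 + d ^ 2) * c = α ^ 2 * c + d ^ 2 * c := by ring
  have e2 : (α ^ 2 + d ^ 2) * (25 * r) = 25 * (α ^ 2 * r) + 25 * (d ^ 2 * r) := by ring
  have e3 : α ^ 2 * ((2 * C₁ + 50) * r) = 2 * (C₁ * r * α ^ 2) + 50 * (α ^ 2 * r) := by ring
  rw [e3]
  rw [e1, e2] at w1 w2
  exact abs_le.2 ⟨by linarith, by linarith⟩

theorem support_sub_le {α d σ e r X Y : ℝ} (hα : 0 < α) (hr : 0 ≤ r)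
    (hX : X ≤ 1) (hd : d ≤ X * α) (he : -e ≤ X * α) (hX0 : 0 ≤ X) (hY : r ≤ Y)
    (h1 : σ ≤ (α + d) * (1 + 120 * r)) : σ - e ≤ α * (1 + 3 * X + 240 * Y) := by
  have h2 : (α + d) * (1 + 120 * r) ≤ (α + X * α) * (1 + 120 * Y) :=
    mul_le_mul (by linarith) (by linarith) (by linarith) (by positivity)
  have hY0 : 0 ≤ Y := hr.trans hY
  have h6 : X * (α * Y) ≤ 1 * (α * Y) := mul_le_mul_of_nonneg_right hX (by positivity)
  have h7 : 0 ≤ X * α := by positivity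
  have e1 : (α + X * α) * (1 + 120 * Y) = α + X * α + 120 * (α * Y) + 120 * (X * (α * Y)) := by
    ring
  have e2 : α * (1 + 3 * X + 240 * Y) = α + 3 * (X * α) + 240 * (α * Y) := by ring
  rw [e2]
  linarith

theorem le_support_sub {α d σ e r X Y : ℝ} (hα : 0 < α) (hp : 0 < α + d) (hσ : 0 < σ)
    (hr : 0 ≤ r) (hd : -(X * α) ≤ d) (he : e ≤ X * α) (hX0 : 0 ≤ X) (hY : r ≤ Y)
    (hY1 : 120 * Y ≤ 1) (h2 : σ⁻¹ ≤ (α + d)⁻¹ * (1 + 120 * r)) :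
    α * (1 - 2 * X - 120 * Y) ≤ σ - e := by
  have hY0 : 0 ≤ Y := hr.trans hY
  have h6 : (α + d) * (1 - 120 * r) ≤ σ := by
    have h8 : α + d ≤ σ * (1 + 120 * r) := by
      have := mul_le_mul_of_nonneg_left h2 (mul_pos hp hσ).le
      have e6 : (α + d) * σ * σ⁻¹ = α + d := by field_simp
      have e7 : (α + d) * σ * ((α + d)⁻¹ * (1 + 120 * r)) = σ * (1 + 120 * r) := by field_simp
      rwa [e6, e7] at this
    have h9 := mul_le_mul_of_nonneg_right h8 (show 0 ≤ 1 - 120 * r by linarith)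
    have e8 : σ * (1 + 120 * r) * (1 - 120 * r) = σ - σ * (120 * r) ^ 2 := by ring
    have : 0 ≤ σ * (120 * r) ^ 2 := by positivity
    linarith
  have h8 : (α + d) * (1 - 120 * Y) ≤ (α + d) * (1 - 120 * r) :=
    mul_le_mul_of_nonneg_left (by linarith) hp.le
  have h9 : (α - X * α) * (1 - 120 * Y) ≤ (α + d) * (1 - 120 * Y) :=
    mul_le_mul_of_nonneg_right (by linarith) (by linarith)
  have e1 : (α - X * α) * (1 - 120 * Y) = α - X * α - 120 * (α * Y) + 120 * (X * α * Y) := by ring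
  have e2 : α * (1 - 2 * X - 120 * Y) = α - 2 * (X * α) - 120 * (α * Y) := by ring
  have : 0 ≤ X * α * Y := by positivity
  rw [e2]
  linarith

set_option maxHeartbeats 1000000 in
theorem scale_bounds {p q e w σ ρ c C₁ r : ℝ} (hp : 0 < p) (hq : 0 < q) (hc : 0 < c)
    (hc1 : c ≤ 1) (hρ : 0 < ρ) (hρ1 : ρ ≤ 1) (hr : 0 < r) (hC₁ : 0 ≤ C₁)
    (hr₁ : (8 * C₁ / c + 1000 / c) * r ≤ 1 / 2) (hpq : |p - q| ≤ C₁ * r * (p + q))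
    (hσ : 0 < σ) (h1 : σ ≤ p * (1 + 120 * r)) (h2 : σ⁻¹ ≤ p⁻¹ * (1 + 120 * r))
    (he : e = ρ * (p - q) / 2)
    (hw : |w - (p ^ 2 + q ^ 2) / 2 * c| ≤ (p ^ 2 + q ^ 2) / 2 * (25 * r)) :
    σ - e ≤ (1 + (8 * C₁ / c + 1000 / c) * r) * √((w - e ^ 2) / c) ∧
      (1 - (8 * C₁ / c + 1000 / c) * r) * √((w - e ^ 2) / c) ≤ σ - e ∧
      0 < √((w - e ^ 2) / c) := by
  obtain ⟨α, d, rfl, rfl⟩ : ∃ α d, p = α + d ∧ q = α - d :=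
    ⟨(p + q) / 2, (p - q) / 2, by ring, by ring⟩
  have hα : 0 < α := by linarith
  have hd : |d| ≤ C₁ * r * α := by
    have : |α + d - (α - d)| = 2 * |d| := by
      rw [show α + d - (α - d) = 2 * d by ring, abs_mul, abs_two]
    rw [this] at hpq
    linarith
  obtain rfl : e = ρ * d := by rw [he]; ring
  have hCc : C₁ ≤ C₁ / c := by rw [le_div_iff₀ hc]; nlinarith
  have h1c : 1 ≤ 1 / c := by rw [le_div_iff₀ hc]; linarith
  have e1 : 8 * C₁ / c + 1000 / c = 8 * (C₁ / c) + 1000 * (1 / c) := by ring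
  rw [e1] at hr₁ ⊢
  have hr2 : C₁ * r ≤ 1 / 16 := by nlinarith
  have hr3 : r ≤ 1 / 2000 := by nlinarith [mul_nonneg (hC₁.trans hCc) hr.le]
  have hd2 : d ^ 2 ≤ C₁ * r * α ^ 2 := by
    rw [← sq_abs]
    have := pow_le_pow_left₀ (abs_nonneg d) hd 2
    nlinarith [mul_nonneg (mul_nonneg hC₁ hr.le) (sq_nonneg α)]
  have hd3 : d ^ 2 ≤ α ^ 2 := by nlinarith [sq_nonneg α]
  have hρd : |ρ * d| ≤ C₁ * r * α := by
    rw [abs_mul, abs_of_pos hρ]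
    nlinarith [abs_nonneg d]
  have hw' : |w - (ρ * d) ^ 2 - α ^ 2 * c| ≤ α ^ 2 * ((2 * C₁ + 50) * r) := by
    have e2 : ((α + d) ^ 2 + (α - d) ^ 2) / 2 = α ^ 2 + d ^ 2 := by ring
    rw [e2] at hw
    exact abs_variance_sub_le hc hc1 hρ hρ1 hr hd2 hd3 hw
  have hb := sqrt_bounds_of_abs_sub_le hα hc hr.le (by positivity) (β := 2 * C₁ + 50) (by
    have := mul_le_mul_of_nonneg_left hr₁ hc.le
    have e3 : c * ((8 * (C₁ / c) + 1000 * (1 / c)) * r) = (8 * C₁ + 1000) * r := by field_simp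
    rw [e3] at this
    nlinarith [mul_nonneg hC₁ hr.le]) hw'
  set s := √((w - (ρ * d) ^ 2) / c)
  have e4 : (2 * C₁ + 50) / c * r = 2 * (C₁ / c * r) + 50 * (1 / c * r) := by ring
  rw [e4] at hb
  have e5 : (8 * (C₁ / c) + 1000 * (1 / c)) * r = 8 * (C₁ / c * r) + 1000 * (1 / c * r) := by ring
  rw [e5] at hr₁ ⊢
  have hX : C₁ * r ≤ C₁ / c * r := by gcongr
  have hY : r ≤ 1 / c * r := by nlinarith
  set X := C₁ / c * r
  set Y := 1 / c * r
  have hX0 : 0 ≤ X := (mul_nonneg hC₁ hr.le).trans hX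
  obtain ⟨b1, b2⟩ := hb
  obtain ⟨f1, f2⟩ := abs_le.1 hρd
  obtain ⟨g1, g2⟩ := abs_le.1 hd
  have hs0 : 0 < s := lt_of_lt_of_le (mul_pos hα (by linarith)) b1
  have h7 : C₁ * r * α ≤ X * α := mul_le_mul_of_nonneg_right hX hα.le
  have hu : σ - ρ * d ≤ α * (1 + 3 * X + 240 * Y) :=
    support_sub_le hα hr.le (by linarith) (by linarith) (by linarith) hX0 hY h1
  have hl : α * (1 - 2 * X - 120 * Y) ≤ σ - ρ * d :=
    le_support_sub hα hp hσ hr.le (by linarith) (by linarith) hX0 hY (by linarith) h2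
  have hY0 : 0 ≤ Y := hr.le.trans hY
  refine ⟨?_, ?_, hs0⟩
  · refine hu.trans ?_
    have h8 : 1 + 3 * X + 240 * Y ≤ (1 + (8 * X + 1000 * Y)) * (1 - (2 * X + 50 * Y)) := by
      nlinarith
    calc α * (1 + 3 * X + 240 * Y)
        ≤ α * ((1 + (8 * X + 1000 * Y)) * (1 - (2 * X + 50 * Y))) := by gcongr
      _ = (1 + (8 * X + 1000 * Y)) * (α * (1 - (2 * X + 50 * Y))) := by ring
      _ ≤ _ := by gcongr
  · refine le_trans ?_ hl
    have h8 : (1 - (8 * X + 1000 * Y)) * (1 + (2 * X + 50 * Y)) ≤ 1 - 2 * X - 120 * Y := by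
      nlinarith
    calc (1 - (8 * X + 1000 * Y)) * s
        ≤ (1 - (8 * X + 1000 * Y)) * (α * (1 + (2 * X + 50 * Y))) := by
          refine mul_le_mul_of_nonneg_left b2 (by linarith)
      _ = α * ((1 - (8 * X + 1000 * Y)) * (1 + (2 * X + 50 * Y))) := by ring
      _ ≤ _ := by gcongr

theorem abs_sub_le_of_abs_inv_sub_inv_le {p q ρ K : ℝ} (hp : 0 < p) (hq : 0 < q) (hρ : 0 < ρ)
    (h : ρ * |p⁻¹ - q⁻¹| ≤ K * (p⁻¹ + q⁻¹)) : |p - q| ≤ K / ρ * (p + q) := by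
  have h1 := mul_le_mul_of_nonneg_right h (mul_pos hp hq).le
  have e1 : ρ * |p⁻¹ - q⁻¹| * (p * q) = ρ * |p - q| := by
    nth_rw 1 [mul_assoc, ← abs_of_pos (mul_pos hp hq), ← abs_mul, abs_sub_comm p q]
    congr 2
    field_simp
  have e2 : K * (p⁻¹ + q⁻¹) * (p * q) = K * (p + q) := by
    field_simp
    ring
  rw [e1, e2] at h1
  rw [div_mul_eq_mul_div, le_div_iff₀ hρ, mul_comm]
  exact h1

/-- The second moment of the first coordinate of the unit ball. -/
def ballSecondMoment (m : ℕ) : ℝ :=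
  ∫ t, t ^ 2 ∂normalizeMeasure (axisLaw (coordBall (m + 1)))

namespace IsBisectedBody

variable {m : ℕ} {ε : ℝ} {M : Set (Fin (m + 1) → ℝ)}

theorem ballSecondMoment_mem (h : IsBisectedBody ε M) (hε : 0 < ε) (hε' : ε ≤ 1 / 2) :
    0 < ballSecondMoment m ∧ ballSecondMoment m ≤ 1 := by
  have hS := h.santaloPair hε hε'
  have := hS.prob_ref
  have hr := hS.ref_mem
  have hr' := hr.mono fun r hr => And.intro hr.1 hr.2.le
  have hi : Integrable (fun t : ℝ => t ^ 2) (normalizeMeasure (axisLaw (coordBall (m + 1)))) :=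
    integrable_of_ae_mem hr' (continuous_pow 2)
  constructor
  · unfold ballSecondMoment
    rw [integral_pos_iff_support_of_nonneg (fun t => sq_nonneg t) hi]
    have : Function.support (fun t : ℝ => t ^ 2)
        =ᵐ[normalizeMeasure (axisLaw (coordBall (m + 1)))] Set.univ :=
      hr.mono fun t ht => by
        apply propext
        exact ⟨fun _ => trivial, fun _ => (pow_pos ht.1 2).ne'⟩
    rw [measure_congr this]
    simp
  · unfold ballSecondMoment
    calc ∫ t, t ^ 2 ∂normalizeMeasure (axisLaw (coordBall (m + 1)))
        ≤ ∫ _, (1 : ℝ) ∂normalizeMeasure (axisLaw (coordBall (m + 1))) :=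
          integral_mono_ae hi (integrable_const _) (hr.mono fun t ht => by
            exact pow_le_one₀ ht.1.le ht.2.le)
      _ = 1 := by simp

theorem real_axisLaw (h : IsBisectedBody ε M) :
    (axisLaw M).real Set.univ = volume.real M / 2 ∧
      (axisLaw (coordFlip 0 '' M)).real Set.univ = volume.real M / 2 := by
  have h1 := congrArg ENNReal.toReal h.two_mul_axisLaw
  have h2 := congrArg ENNReal.toReal h.two_mul_axisLaw_flip
  rw [ENNReal.toReal_mul, ENNReal.toReal_ofNat] at h1 h2
  simp only [measureReal_def]
  constructor <;> linarith

/-- The first coordinate of a bisected body of almost maximal volume product has support and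
variance almost as for a ball. -/
theorem exists_axis_bounds (m : ℕ) : ∃ B r₁ : ℝ, 0 < r₁ ∧
    ∀ (ε : ℝ) (M : Set (Fin (m + 1) → ℝ)) (r e w : ℝ), IsBisectedBody ε M → 0 < ε → 0 < r →
      r ≤ r₁ → √ε ≤ r ^ (m + 3) → volume.real M * e = ∫ x in M, x 0 →
      volume.real M * w = ∫ x in M, x 0 ^ 2 →
      0 < ballSecondMoment m ∧ 0 < √((w - e ^ 2) / ballSecondMoment m) ∧
      (∀ x ∈ M, x 0 - e ≤ (1 + B * r) * √((w - e ^ 2) / ballSecondMoment m)) ∧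
      ∃ x ∈ M, (1 - B * r) * √((w - e ^ 2) / ballSecondMoment m) ≤ x 0 - e := by
  obtain ⟨C, hC0, hC⟩ := exists_inv_one_sub_pow_le (m + 2)
  set lam := normalizeMeasure (axisLaw (coordBall (m + 1))) with hlam
  set ρ := ∫ t, t ∂lam with hρ
  set c := ballSecondMoment m with hc
  set C₁ := (42 + 2 * C) / ρ with hC₁
  set B := 8 * C₁ / c + 1000 / c with hB
  refine ⟨B, min (1 / 240) (1 / (2 * (|B| + 1))), by positivity, ?_⟩
  intro ε M r e w h hε hr hr₁ hεr hI1 hI2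
  have hr240 : r ≤ 1 / 240 := hr₁.trans (min_le_left _ _)
  have hεle : √ε ≤ r := hεr.trans (by
    calc r ^ (m + 3) ≤ r ^ 1 := pow_le_pow_of_le_one hr.le (by linarith) (by omega)
      _ = r := pow_one r)
  have hε4 : ε ≤ 1 / 4 := by
    have h0 := Real.sqrt_nonneg ε
    have h1 := Real.sq_sqrt hε.le
    nlinarith
  obtain ⟨hc0, hc1⟩ := h.ballSecondMoment_mem hε (by linarith)
  have hS := h.santaloPair hε (by linarith)
  rw [← hlam] at hS
  obtain ⟨hρ0, hρ1⟩ := hS.integral_ref_mem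
  rw [← hρ] at hρ0 hρ1
  have hC₁0 : 0 ≤ C₁ := by positivity
  have hBr : B * r ≤ 1 / 2 := by
    have : r ≤ 1 / (2 * (|B| + 1)) := hr₁.trans (min_le_right _ _)
    rw [le_div_iff₀ (by positivity)] at this
    have : B * r ≤ |B| * r := mul_le_mul_of_nonneg_right (le_abs_self B) hr.le
    linarith
  obtain ⟨σ, p, hσ, hp, hσM, hMσ, hp1, hp2, hp3, hp4, hp5⟩ :=
    h.exists_scale hε hr hr240 hεr hlam
  obtain ⟨τ, q, hτ, hq, hτM, hMτ, hq1, hq2, hq3, hq4, hq5⟩ :=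
    h.flip.exists_scale hε hr hr240 hεr hlam
  have hV : 0 < volume.real M :=
    ENNReal.toReal_pos h.volume_ne_zero h.isCompact.measure_lt_top.ne
  obtain ⟨ha1, ha2⟩ := h.real_axisLaw
  have he : e = ρ * (p - q) / 2 := by
    rw [setIntegral_eval_zero h.isCompact.isBounded (f := fun t => t) continuous_id, ha1, ha2,
      integral_neg, hp1, hq1] at hI1
    refine mul_left_cancel₀ hV.ne' (hI1.trans ?_)
    ring
  have hw : w = ((∫ t, t ^ 2 ∂normalizeMeasure (axisLaw M)) +
      ∫ t, t ^ 2 ∂normalizeMeasure (axisLaw (coordFlip 0 '' M))) / 2 := by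
    rw [setIntegral_eval_zero h.isCompact.isBounded (f := fun t => t ^ 2) (continuous_pow 2),
      ha1, ha2] at hI2
    simp only [neg_sq] at hI2
    refine mul_left_cancel₀ hV.ne' (hI2.trans ?_)
    ring
  have hw' : |w - (p ^ 2 + q ^ 2) / 2 * c| ≤ (p ^ 2 + q ^ 2) / 2 * (25 * r) := by
    change |_ - p ^ 2 * c| ≤ _ at hp5
    change |_ - q ^ 2 * c| ≤ _ at hq5
    rw [hw]
    obtain ⟨u1, u2⟩ := abs_le.1 hp5
    obtain ⟨u3, u4⟩ := abs_le.1 hq5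
    exact abs_le.2 ⟨by linarith, by linarith⟩
  have hpS : ∀ y ∈ polarAt M 0, |y 0| ≤ 2 * (p⁻¹ + q⁻¹) := by
    intro y hy
    have h1 : y 0 ≤ σ⁻¹ := by
      have := hy _ hσM
      rw [sub_zero, single_dotProduct] at this
      rw [← one_div, le_div_iff₀ hσ, mul_comm]
      exact this
    have h2 : - y 0 ≤ τ⁻¹ := by
      obtain ⟨x, hx, hxτ⟩ := hτM
      have hx' : x = Pi.single 0 (-τ) := by
        rw [← coordFlip_coordFlip 0 x, hxτ]
        ext i
        by_cases hi : i = 0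
        · subst hi; simp [coordFlip]
        · simp [coordFlip, hi]
      have := hy _ hx
      rw [hx', sub_zero, single_dotProduct] at this
      rw [← one_div, le_div_iff₀ hτ]
      linarith
    have h3 : 0 < p⁻¹ := by positivity
    have h4 : 0 < q⁻¹ := by positivity
    have h5 : p⁻¹ * (1 + 120 * r) ≤ p⁻¹ * 2 := by gcongr; linarith
    have h6 : q⁻¹ * (1 + 120 * r) ≤ q⁻¹ * 2 := by gcongr; linarith
    exact abs_le.2 ⟨by linarith, by linarith⟩
  have hcmp := h.abs_integral_sub_integral_le hε hε4 hC hC0 (by positivity) hpS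
  have hpq : |p - q| ≤ C₁ * r * (p + q) := by
    have h1 : ρ * |p⁻¹ - q⁻¹| ≤ (42 + 2 * C) * √ε * (p⁻¹ + q⁻¹) := by
      nth_rw 1 [← abs_of_pos hρ0, ← abs_mul]
      obtain ⟨u1, u2⟩ := abs_le.1 hp4
      obtain ⟨u3, u4⟩ := abs_le.1 hq4
      obtain ⟨u5, u6⟩ := abs_le.1 hcmp
      refine abs_le.2 ⟨?_, ?_⟩ <;> linarith
    refine (abs_sub_le_of_abs_inv_sub_inv_le hp hq hρ0 h1).trans ?_
    have : (42 + 2 * C) * √ε / ρ = C₁ * √ε := by rw [hC₁]; ring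
    rw [this]
    gcongr
  obtain ⟨b1, b2, b3⟩ :=
    scale_bounds hp hq hc0 hc1 hρ0 hρ1 hr hC₁0 hBr hpq hσ hp2 hp3 he hw'
  refine ⟨hc0, b3, fun x hx => ?_, Pi.single 0 σ, hσM, ?_⟩
  · exact (sub_le_sub_right (hMσ x hx) e).trans b1
  · rw [Pi.single_eq_same]
    exact b2

end IsBisectedBody

theorem setIntegral_eq_of_lintegral_eq {α β : Type*} [MeasurableSpace α] [MeasurableSpace β]
    {μ : Measure α} {ν : Measure β} {X : α → ℝ} {Y : β → ℝ} (hX : Measurable X)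
    (hY : Measurable Y)
    (h : ∀ g : ℝ → ℝ≥0∞, Measurable g → ∫⁻ x, g (X x) ∂μ = ∫⁻ y, g (Y y) ∂ν)
    {f : ℝ → ℝ} (hf : Continuous f) : ∫ x, f (X x) ∂μ = ∫ y, f (Y y) ∂ν := by
  have : μ.map X = ν.map Y := by
    refine Measure.ext_of_lintegral _ fun g hg => ?_
    rw [lintegral_map hg hX, lintegral_map hg hY, h g hg]
  rw [← integral_map hX.aemeasurable hf.aestronglyMeasurable, this,
    integral_map hY.aemeasurable hf.aestronglyMeasurable]

theorem axisLaw_image_coordFlip_univ {m : ℕ} {M : Set (Fin (m + 1) → ℝ)} (hM : MeasurableSet M) :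
    axisLaw (coordFlip 0 '' M) Set.univ = volume (M ∩ {x | x 0 < 0}) := by
  have hm : MeasurableSet (M ∩ {x : Fin (m + 1) → ℝ | x 0 < 0}) :=
    hM.inter (measurableSet_lt (measurable_pi_apply 0) measurable_const)
  rw [axisLaw_univ, ← IsBisectedBody.volume_image_coordFlip 0 hm]
  congr 1
  ext x
  constructor
  · rintro ⟨⟨y, hy, rfl⟩, hx⟩
    refine ⟨y, ⟨hy, ?_⟩, rfl⟩
    have : 0 < coordFlip 0 y 0 := hx
    simp only [coordFlip, Function.update_self] at this
    exact neg_pos.1 this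
  · rintro ⟨y, ⟨hy, hy0⟩, rfl⟩
    refine ⟨⟨y, hy, rfl⟩, ?_⟩
    have : y 0 < 0 := hy0
    change 0 < coordFlip 0 y 0
    simpa [coordFlip] using this

/-- In every coordinate direction a convex body of almost maximal volume product has support and
variance almost as for a ball. -/
theorem exists_coord_bounds (m : ℕ) : ∃ B r₁ : ℝ, 0 < r₁ ∧
    ∀ (ε : ℝ) (K : Set (Fin (m + 1) → ℝ)) (r g : ℝ), IsCompact K → Convex ℝ K →
      (interior K).Nonempty → 0 < ε → 0 < r → r ≤ r₁ → √ε ≤ r ^ (m + 3) →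
      (∀ w ∈ interior K, volume (coordBall (m + 1)) ^ 2 ≤
        ENNReal.ofReal (1 + ε) * (volume K * volume (polarAt K w))) →
      volume.real K * g = ∫ x in K, x 0 →
      0 < ballSecondMoment m ∧
      0 < √((∫ x in K, (x 0 - g) ^ 2) / (volume.real K * ballSecondMoment m)) ∧
      (∀ x ∈ K, x 0 - g ≤ (1 + B * r) *
        √((∫ x in K, (x 0 - g) ^ 2) / (volume.real K * ballSecondMoment m))) ∧
      ∃ x ∈ K, (1 - B * r) *
        √((∫ x in K, (x 0 - g) ^ 2) / (volume.real K * ballSecondMoment m)) ≤ x 0 - g := by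
  obtain ⟨B, r₁, hr₁, H⟩ := IsBisectedBody.exists_axis_bounds m
  refine ⟨B, r₁, hr₁, ?_⟩
  intro ε K r g hK hc hi hε hr hrr hεr hP hg
  obtain ⟨ζ, M, hM1, hM2, hM3, hM4, hlaw, himg, hv1, hv2, hM5⟩ :=
    exists_centered_coordFlip_invariant hK hc hi
  have hvol : volume M = volume K := by
    simpa using hlaw (fun _ => 1) measurable_const
  have hM : IsBisectedBody ε M := by
    refine ⟨hM1, hM2, hM3, hM4, ?_, ?_, fun z hz => ?_⟩
    · rw [axisLaw_univ, hv1, hvol]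
    · rw [axisLaw_image_coordFlip_univ hM1.measurableSet, hv2, hvol]
    · obtain ⟨w, hw, hwz⟩ := hM5 z hz
      refine (hP w hw).trans ?_
      rw [hvol]
      gcongr
  have hKf : volume K ≠ ∞ := hK.measure_lt_top.ne
  have hV : 0 < volume.real K := ENNReal.toReal_pos
    ((isOpen_interior.measure_pos _ hi).trans_le (measure_mono interior_subset)).ne' hKf
  have hVM : volume.real M = volume.real K := congrArg ENNReal.toReal hvol
  have htrans : ∀ f : ℝ → ℝ, Continuous f → ∫ x in M, f (x 0) = ∫ x in K, f (x 0 - ζ) :=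
    fun f hf => setIntegral_eq_of_lintegral_eq (measurable_pi_apply 0)
      (by fun_prop) hlaw hf
  have hint : ∀ f : (Fin (m + 1) → ℝ) → ℝ, Continuous f → IntegrableOn f K :=
    fun f hf => hf.continuousOn.integrableOn_compact hK
  have hI1 : ∫ x in K, (x 0 - ζ) = volume.real K * (g - ζ) := by
    rw [integral_sub (hint _ (by fun_prop)) (hint _ (by fun_prop)), ← hg, setIntegral_const,
      smul_eq_mul]
    ring
  have hI2 : ∫ x in K, (x 0 - g) ^ 2 =
      (∫ x in K, (x 0 - ζ) ^ 2) - volume.real K * (g - ζ) ^ 2 := by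
    have e : ∀ x : Fin (m + 1) → ℝ, (x 0 - g) ^ 2 =
        (x 0 - ζ) ^ 2 - (2 * (g - ζ) * (x 0 - ζ) - (g - ζ) ^ 2) := fun x => by ring
    simp_rw [e]
    rw [integral_sub (hint _ (by fun_prop)) (hint _ (by fun_prop)),
      integral_sub (hint _ (by fun_prop)) (hint _ (by fun_prop)), integral_const_mul, hI1,
      setIntegral_const, smul_eq_mul]
    ring
  obtain ⟨h0, h1, h2, x, hx, h3⟩ := H ε M r (g - ζ)
    ((∫ x in K, (x 0 - ζ) ^ 2) / volume.real K) hM hε hr hrr hεr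
    (by rw [hVM, htrans (fun t => t) continuous_id, hI1])
    (by rw [hVM, htrans (fun t => t ^ 2) (continuous_pow 2), mul_div_cancel₀ _ hV.ne'])
  have hs : ((∫ x in K, (x 0 - ζ) ^ 2) / volume.real K - (g - ζ) ^ 2) / ballSecondMoment m =
      (∫ x in K, (x 0 - g) ^ 2) / (volume.real K * ballSecondMoment m) := by
    rw [hI2]
    field_simp
  rw [hs] at h1 h2 h3
  refine ⟨h0, h1, fun y hy => ?_, ?_⟩
  · obtain ⟨y', hy', hyy⟩ : y 0 - ζ ∈ (fun x : Fin (m + 1) → ℝ => x 0) '' M := by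
      rw [himg]; exact ⟨y, hy, rfl⟩
    have := h2 y' hy'
    have e : y' 0 = y 0 - ζ := hyy
    rw [e] at this
    linarith
  · obtain ⟨y, hy, hyy⟩ : x 0 ∈ (fun x : Fin (m + 1) → ℝ => x 0 - ζ) '' K := by
      rw [← himg]; exact ⟨x, hx, rfl⟩
    refine ⟨y, hy, ?_⟩
    have e : y 0 - ζ = x 0 := hyy
    linarith

theorem volume_coordBall (n : ℕ) : volume (coordBall n) =
    volume (Metric.closedBall (0 : EuclideanSpace ℝ (Fin n)) 1) := by
  rw [← (PiLp.volume_preserving_ofLp (Fin n)).measure_preimage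
    (isClosed_coordBall n).measurableSet.nullMeasurableSet]
  congr 1
  ext x
  rw [mem_closedBall_zero_iff, EuclideanSpace.norm_eq, Real.sqrt_le_one]
  simp only [Real.norm_eq_abs, sq_abs]
  rfl

theorem inv_smul_add_mem_polarSet {n : ℕ} {z b : EuclideanSpace ℝ (Fin n)} (hz : ‖z‖ < 1)
    (hb : ‖b‖ ≤ 1) : (1 - ‖z‖ ^ 2)⁻¹ • z + b ∈
      polarSet ((fun x => x - z) '' Metric.closedBall (0 : EuclideanSpace ℝ (Fin n)) 1) := by
  rintro _ ⟨x, hx, rfl⟩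
  rw [mem_closedBall_zero_iff] at hx
  have hD : 0 < 1 - ‖z‖ ^ 2 := by nlinarith [norm_nonneg z]
  set y := (1 - ‖z‖ ^ 2)⁻¹ • z + b with hy
  have h1 : ⟪x, y⟫_ℝ ≤ ‖y‖ := (real_inner_le_norm x y).trans
    (mul_le_of_le_one_left (norm_nonneg y) hx)
  have hβ : |⟪z, b⟫_ℝ| ≤ 1 := (abs_real_inner_le_norm z b).trans
    (mul_le_one₀ hz.le (norm_nonneg b) hb)
  have hzy : ⟪z, y⟫_ℝ = (1 - ‖z‖ ^ 2)⁻¹ - 1 + ⟪z, b⟫_ℝ := by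
    rw [hy, inner_add_right, inner_smul_right, real_inner_self_eq_norm_sq]
    field_simp
    ring
  have hD1 : 1 ≤ (1 - ‖z‖ ^ 2)⁻¹ := (one_le_inv₀ hD).2 (by nlinarith [norm_nonneg z])
  have hyn : ‖y‖ ^ 2 ≤ (1 + ⟪z, y⟫_ℝ) ^ 2 := by
    have e1 : ‖y‖ ^ 2 = (1 - ‖z‖ ^ 2)⁻¹ ^ 2 * ‖z‖ ^ 2 + 2 * ((1 - ‖z‖ ^ 2)⁻¹ * ⟪z, b⟫_ℝ) +
        ‖b‖ ^ 2 := by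
      rw [hy, norm_add_sq_real, norm_smul, Real.norm_eq_abs, abs_of_pos (inv_pos.2 hD), mul_pow,
        real_inner_smul_left]
    have e2 : (1 - ‖z‖ ^ 2)⁻¹ ^ 2 * ‖z‖ ^ 2 = (1 - ‖z‖ ^ 2)⁻¹ ^ 2 - (1 - ‖z‖ ^ 2)⁻¹ := by
      field_simp
      ring
    have hb2 : ‖b‖ ^ 2 ≤ 1 := pow_le_one₀ (norm_nonneg b) hb
    rw [e1, e2, hzy]
    nlinarith [sq_nonneg ⟪z, b⟫_ℝ]
  have h2 : ‖y‖ ≤ 1 + ⟪z, y⟫_ℝ := by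
    refine abs_le_of_sq_le_sq' hyn ?_ |>.2
    rw [hzy]
    linarith [(abs_le.1 hβ).1]
  rw [inner_sub_left]
  linarith

theorem volume_closedBall_sq_le (n : ℕ) :
    volume (Metric.closedBall (0 : EuclideanSpace ℝ (Fin n)) 1) ^ 2 ≤
      volumeProduct (Metric.closedBall (0 : EuclideanSpace ℝ (Fin n)) 1) := by
  rw [volumeProduct, sq]
  gcongr
  refine le_iInf fun ⟨z, hz⟩ => ?_
  rw [interior_closedBall _ one_ne_zero, mem_ball_zero_iff] at hz
  set v := (1 - ‖z‖ ^ 2)⁻¹ • z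
  rw [← measure_preimage_add volume (-v)]
  refine measure_mono fun y hy => ?_
  have : ‖-v + y‖ ≤ 1 := by
    rw [neg_add_eq_sub, ← dist_eq_norm]
    simpa using hy
  have := inv_smul_add_mem_polarSet hz this
  simpa [v] using this

/-- A volume preserving linear identification of Euclidean space with coordinate space that maps a
given unit vector to the first basis vector. -/
theorem exists_coordinates {m : ℕ} {u : EuclideanSpace ℝ (Fin (m + 1))} (hu : ‖u‖ = 1) :
    ∃ Φ : EuclideanSpace ℝ (Fin (m + 1)) ≃L[ℝ] (Fin (m + 1) → ℝ),
      MeasurePreserving Φ ∧ (∀ x y, Φ x ⬝ᵥ Φ y = ⟪x, y⟫_ℝ) ∧ ∀ x, Φ x 0 = ⟪x, u⟫_ℝ := by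
  set e : EuclideanSpace ℝ (Fin (m + 1)) := EuclideanSpace.single 0 1
  have he : ‖e‖ = 1 := by simp [e]
  set U := (ℝ ∙ (u - e))ᗮ.reflection
  have hUu : U u = e := Submodule.reflection_sub (hu.trans he.symm)
  refine ⟨U.toContinuousLinearEquiv.trans (PiLp.continuousLinearEquiv 2 ℝ _), ?_, ?_, ?_⟩
  · exact (PiLp.volume_preserving_ofLp (Fin (m + 1))).comp U.measurePreserving
  · intro x y
    rw [← U.inner_map_map x y, EuclideanSpace.inner_eq_star_dotProduct, dotProduct_comm]
    rfl
  · intro x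
    rw [← U.inner_map_map x u, hUu]
    simp [e, EuclideanSpace.inner_single_right]

theorem volume_polarAt_image {m : ℕ} {Φ : EuclideanSpace ℝ (Fin (m + 1)) ≃L[ℝ] (Fin (m + 1) → ℝ)}
    (hΦ : MeasurePreserving Φ) (hin : ∀ x y, Φ x ⬝ᵥ Φ y = ⟪x, y⟫_ℝ)
    (K : Set (EuclideanSpace ℝ (Fin (m + 1)))) (z : EuclideanSpace ℝ (Fin (m + 1))) :
    volume (polarAt (Φ '' K) (Φ z)) = volume (polarSet ((fun x => x - z) '' K)) := by
  rw [← hΦ.measure_preimage (isClosed_polarAt _ _).measurableSet.nullMeasurableSet]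
  congr 1
  ext y
  constructor
  · rintro hy _ ⟨x, hx, rfl⟩
    have : (Φ x - Φ z) ⬝ᵥ Φ y ≤ 1 := hy (Φ x) ⟨x, hx, rfl⟩
    rwa [← map_sub, hin] at this
  · rintro hy _ ⟨x, hx, rfl⟩
    rw [← map_sub, hin]
    exact hy _ ⟨x, hx, rfl⟩

/-- In every direction a convex body of almost maximal volume product has support and
variance almost as for a ball. -/
theorem exists_direction_bounds (m : ℕ) : ∃ B r₁ : ℝ, 0 < r₁ ∧
    ∀ (ε r : ℝ) (K : Set (EuclideanSpace ℝ (Fin (m + 1))))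
      (G u : EuclideanSpace ℝ (Fin (m + 1))), IsConvexBody K →
      0 < ε → 0 < r → r ≤ r₁ → √ε ≤ r ^ (m + 3) →
      volumeProduct (Metric.closedBall (0 : EuclideanSpace ℝ (Fin (m + 1))) 1) ≤
          ENNReal.ofReal (1 + ε) * volumeProduct K →
      volume.real K • G = ∫ x in K, x → ‖u‖ = 1 →
      0 < ballSecondMoment m ∧
      0 < √((∫ x in K, ⟪x - G, u⟫_ℝ ^ 2) / (volume.real K * ballSecondMoment m)) ∧
      (∀ x ∈ K, ⟪x - G, u⟫_ℝ ≤ (1 + B * r) *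
        √((∫ x in K, ⟪x - G, u⟫_ℝ ^ 2) / (volume.real K * ballSecondMoment m))) ∧
      ∃ x ∈ K, (1 - B * r) *
        √((∫ x in K, ⟪x - G, u⟫_ℝ ^ 2) / (volume.real K * ballSecondMoment m)) ≤
          ⟪x - G, u⟫_ℝ := by
  obtain ⟨B, r₁, hr₁, H⟩ := exists_coord_bounds m
  refine ⟨B, r₁, hr₁, ?_⟩
  intro ε r K G u hK hε hr hrr hεr hP hG hu
  obtain ⟨Φ, hΦ, hin, hΦ0⟩ := exists_coordinates hu
  have hemb : MeasurableEmbedding Φ := Φ.toHomeomorph.measurableEmbedding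
  have hvol : volume (Φ '' K) = volume K := by
    rw [← hΦ.measure_preimage_emb hemb, Set.preimage_image_eq _ Φ.injective]
  have hvolr : volume.real (Φ '' K) = volume.real K := congrArg ENNReal.toReal hvol
  have hint : interior (Φ '' K) = Φ '' interior K := (Φ.toHomeomorph.image_interior K).symm
  have htrans : ∀ f : (Fin (m + 1) → ℝ) → ℝ, ∫ y in Φ '' K, f y = ∫ x in K, f (Φ x) :=
    fun f => hΦ.setIntegral_image_emb hemb f K
  have hid : IntegrableOn (fun x : EuclideanSpace ℝ (Fin (m + 1)) => x) K :=
    continuous_id.continuousOn.integrableOn_compact hK.isCompact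
  have hg : volume.real (Φ '' K) * ⟪G, u⟫_ℝ = ∫ y in Φ '' K, y 0 := by
    rw [htrans, hvolr, ← real_inner_smul_left, hG, real_inner_comm, ← integral_inner hid]
    simp_rw [hΦ0, real_inner_comm]
  have hQ : ∫ y in Φ '' K, (y 0 - ⟪G, u⟫_ℝ) ^ 2 = ∫ x in K, ⟪x - G, u⟫_ℝ ^ 2 := by
    rw [htrans]
    simp_rw [hΦ0, inner_sub_left]
  obtain ⟨h0, h1, h2, y, hy, h3⟩ := H ε (Φ '' K) r ⟪G, u⟫_ℝ (hK.isCompact.image Φ.continuous)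
    (hK.convex.linear_image (Φ : EuclideanSpace ℝ (Fin (m + 1)) →ₗ[ℝ] (Fin (m + 1) → ℝ)))
    (hint ▸ hK.nonempty_interior.image Φ) hε hr hrr hεr (by
      intro w hw
      rw [hint] at hw
      obtain ⟨z, hz, rfl⟩ := hw
      rw [volume_coordBall, hvol, volume_polarAt_image hΦ hin]
      refine (volume_closedBall_sq_le _).trans (hP.trans ?_)
      rw [volumeProduct]
      gcongr
      exact iInf_le (fun z : interior K => volume (polarSet ((fun x => x -
        (z : EuclideanSpace ℝ (Fin (m + 1)))) '' K))) ⟨z, hz⟩) hg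
  rw [hvolr, hQ] at h1 h2 h3
  refine ⟨h0, h1, fun x hx => ?_, ?_⟩
  · have := h2 (Φ x) ⟨x, hx, rfl⟩
    rwa [hΦ0, ← inner_sub_left] at this
  · obtain ⟨x, hx, rfl⟩ := hy
    rw [hΦ0, ← inner_sub_left] at h3
    exact ⟨x, hx, h3⟩

open scoped MatrixOrder in
theorem Matrix.PosSemidef.exists_norm_sq_eq {n : ℕ} {A : Matrix (Fin n) (Fin n) ℝ}
    (hA : A.PosSemidef) : ∃ L : EuclideanSpace ℝ (Fin n) →ₗ[ℝ] EuclideanSpace ℝ (Fin n),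
      ∀ u, ‖L u‖ ^ 2 = u.ofLp ⬝ᵥ (A.mulVec u.ofLp) := by
  obtain ⟨y, hy⟩ := CStarAlgebra.nonneg_iff_eq_star_mul_self.mp hA.nonneg
  refine ⟨Matrix.toLpLin 2 2 y, fun u => ?_⟩
  rw [← real_inner_self_eq_norm_sq, EuclideanSpace.inner_eq_star_dotProduct,
    Matrix.ofLp_toLpLin, Matrix.toLin'_apply, hy, star_trivial, Matrix.dotProduct_mulVec,
    Matrix.star_eq_conjTranspose, Matrix.conjTranspose_eq_transpose_of_trivial,
    ← Matrix.mulVec_mulVec, Matrix.dotProduct_mulVec u.ofLp, Matrix.vecMul_transpose,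
    ← Matrix.dotProduct_mulVec]

/-- The covariance form of a compact set is the square of the norm of a linear map. -/
theorem exists_norm_sq_eq_setIntegral {n : ℕ} {K : Set (EuclideanSpace ℝ (Fin n))}
    (hK : IsCompact K) (G : EuclideanSpace ℝ (Fin n)) {a : ℝ} (ha : 0 ≤ a) :
    ∃ L : EuclideanSpace ℝ (Fin n) →ₗ[ℝ] EuclideanSpace ℝ (Fin n),
      ∀ u, ‖L u‖ ^ 2 = (∫ x in K, ⟪x - G, u⟫_ℝ ^ 2) * a := by
  set A : Matrix (Fin n) (Fin n) ℝ := fun i j => (∫ x in K, (x - G) i * (x - G) j) * a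
  have hint : ∀ f : EuclideanSpace ℝ (Fin n) → ℝ, Continuous f → IntegrableOn f K :=
    fun f hf => hf.continuousOn.integrableOn_compact hK
  have hA : ∀ u : EuclideanSpace ℝ (Fin n),
      u.ofLp ⬝ᵥ (A.mulVec u.ofLp) = (∫ x in K, ⟪x - G, u⟫_ℝ ^ 2) * a := by
    intro u
    have e : ∀ x : EuclideanSpace ℝ (Fin n), ⟪x - G, u⟫_ℝ ^ 2 =
        ∑ i, ∑ j, u i * u j * ((x - G) i * (x - G) j) := by
      intro x
      rw [EuclideanSpace.inner_eq_star_dotProduct, star_trivial, dotProduct, sq,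
        Finset.sum_mul_sum]
      exact Finset.sum_congr rfl fun i _ => Finset.sum_congr rfl fun j _ => by ring
    simp_rw [e]
    rw [integral_finsetSum _ fun i _ => hint _ (by fun_prop), Finset.sum_mul]
    simp only [dotProduct, Matrix.mulVec]
    refine Finset.sum_congr rfl fun i _ => ?_
    rw [integral_finsetSum _ fun j _ => hint _ (by fun_prop), Finset.sum_mul, Finset.mul_sum]
    refine Finset.sum_congr rfl fun j _ => ?_
    rw [integral_const_mul]
    ring
  obtain ⟨L, hL⟩ := Matrix.PosSemidef.exists_norm_sq_eq (A := A)
    (Matrix.PosSemidef.of_dotProduct_mulVec_nonneg (by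
      ext i j
      rw [Matrix.conjTranspose_apply, star_trivial]
      simp only [A, mul_comm]) fun x => by
      rw [star_trivial, show x = (WithLp.toLp 2 x).ofLp from rfl, hA]
      exact mul_nonneg (integral_nonneg fun _ => sq_nonneg _) ha)
  exact ⟨L, fun u => (hL u).trans (hA u)⟩

/-- A body whose support function is close to that of an ellipsoid is Banach-Mazur close to the
ball. -/
theorem banachMazurDist_closedBall_le {n : ℕ} {K : Set (EuclideanSpace ℝ (Fin n))}
    (hK : IsConvexBody K) (G : EuclideanSpace ℝ (Fin n)) {x : ℝ} (hx0 : 0 ≤ x) (hx : x < 1)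
    (L : EuclideanSpace ℝ (Fin n) →ₗ[ℝ] EuclideanSpace ℝ (Fin n))
    (hL : ∀ u, u ≠ 0 → L u ≠ 0)
    (h1 : ∀ u, ∀ y ∈ K, ⟪y - G, u⟫_ℝ ≤ (1 + x) * ‖L u‖)
    (h2 : ∀ u, ∃ y ∈ K, (1 - x) * ‖L u‖ ≤ ⟪y - G, u⟫_ℝ) :
    banachMazurDist K (Metric.closedBall 0 1) ≤ (1 + x) / (1 - x) := by
  have hinj : Function.Injective L := (injective_iff_map_eq_zero L).2 fun u hu => by
    by_contra h
    exact hL u h hu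
  have hsurj : Function.Surjective L := LinearMap.injective_iff_surjective.1 hinj
  set T := LinearMap.adjoint L
  have hT : ∀ y u, ⟪T y, u⟫_ℝ = ⟪y, L u⟫_ℝ := fun y u => LinearMap.adjoint_inner_left L u y
  have hTinj : Function.Injective T := (injective_iff_map_eq_zero T).2 fun y hy => by
    obtain ⟨u, rfl⟩ := hsurj y
    have := hT (L u) u
    rw [hy, inner_zero_left, eq_comm, inner_self_eq_zero] at this
    exact this
  have hx1 : 0 < 1 - x := by linarith
  have hx2 : 0 < 1 + x := by linarith
  let e : EuclideanSpace ℝ (Fin n) ≃ₗ[ℝ] EuclideanSpace ℝ (Fin n) :=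
    (LinearEquiv.ofInjectiveEndo T hTinj).trans
      (LinearEquiv.smulOfNeZero ℝ (EuclideanSpace ℝ (Fin n)) (1 + x) hx2.ne')
  have he : ∀ y, e y = (1 + x) • T y := fun y => rfl
  refine csInf_le ⟨0, fun d hd => hd.1.le⟩ ⟨by positivity, e, G, 0, ?_, ?_⟩
  · rintro _ ⟨y, hy, rfl⟩
    obtain ⟨v, hv⟩ := e.surjective (y - G)
    refine ⟨v, ⟨v, ?_, sub_zero v⟩, hv⟩
    rw [mem_closedBall_zero_iff]
    obtain ⟨u, hu⟩ := hsurj v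
    have := h1 u y hy
    rw [← hv, he, real_inner_smul_left, hT, hu, real_inner_self_eq_norm_sq] at this
    have h3 := le_of_mul_le_mul_left this hx2
    by_contra! hcon
    nlinarith
  · rintro _ ⟨_, ⟨v, hv, rfl⟩, rfl⟩
    rw [mem_closedBall_zero_iff] at hv
    have hmem : G + (1 - x) • T v ∈ K := by
      by_contra hcon
      obtain ⟨f, s, hf, hs⟩ :=
        geometric_hahn_banach_closed_point hK.convex hK.isCompact.isClosed hcon
      obtain ⟨u, rfl⟩ := (InnerProductSpace.toDual ℝ (EuclideanSpace ℝ (Fin n))).surjective f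
      simp only [InnerProductSpace.toDual_apply_apply] at hf hs
      obtain ⟨y, hy, hyu⟩ := h2 u
      have h4 := hf y hy
      rw [inner_add_right, inner_smul_right, real_inner_comm (T v) u, hT] at hs
      rw [inner_sub_left, real_inner_comm u y, real_inner_comm u G] at hyu
      have h5 : ⟪v, L u⟫_ℝ ≤ ‖L u‖ := (real_inner_le_norm v (L u)).trans
        (mul_le_of_le_one_left (norm_nonneg _) hv)
      have h6 := mul_le_mul_of_nonneg_left h5 hx1.le
      linarith
    refine ⟨(1 - x) • T v, ⟨_, hmem, add_sub_cancel_left _ _⟩, ?_⟩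
    simp only [sub_zero]
    rw [he, smul_smul, div_mul_cancel₀ _ hx1.ne']

theorem exists_banachMazurDist_le (m : ℕ) : ∃ B r₁ : ℝ, 0 ≤ B ∧ 0 < r₁ ∧
    ∀ (ε r : ℝ) (K : Set (EuclideanSpace ℝ (Fin (m + 1)))), IsConvexBody K →
      0 < ε → 0 < r → r ≤ r₁ → √ε ≤ r ^ (m + 3) → B * r < 1 →
      volumeProduct (Metric.closedBall (0 : EuclideanSpace ℝ (Fin (m + 1))) 1) ≤
          ENNReal.ofReal (1 + ε) * volumeProduct K →
      banachMazurDist K (Metric.closedBall 0 1) ≤ (1 + B * r) / (1 - B * r) := by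
  obtain ⟨B, r₁, hr₁, H⟩ := exists_direction_bounds m
  refine ⟨|B|, r₁, abs_nonneg B, hr₁, fun ε r K hK hε hr hrr hεr hBr hP => ?_⟩
  have hV : 0 < volume.real K := ENNReal.toReal_pos
    ((isOpen_interior.measure_pos _ hK.nonempty_interior).trans_le
      (measure_mono interior_subset)).ne' hK.isCompact.measure_lt_top.ne
  set G := (volume.real K)⁻¹ • ∫ x in K, x
  have hG : volume.real K • G = ∫ x in K, x := smul_inv_smul₀ hV.ne' _
  have hH := fun u => H ε r K G u hK hε hr hrr hεr hP hG
  have hc : 0 < ballSecondMoment m := (hH (EuclideanSpace.single 0 1) (by simp)).1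
  obtain ⟨L, hL⟩ := exists_norm_sq_eq_setIntegral hK.isCompact G
    (inv_nonneg.2 (mul_pos hV hc).le)
  have hLs : ∀ u, √((∫ x in K, ⟪x - G, u⟫_ℝ ^ 2) / (volume.real K * ballSecondMoment m)) =
      ‖L u‖ := fun u => by
    rw [div_eq_mul_inv, ← hL, Real.sqrt_sq (norm_nonneg _)]
  simp_rw [hLs] at hH
  have hunit : ∀ u : EuclideanSpace ℝ (Fin (m + 1)), u ≠ 0 → ∃ v, ‖v‖ = 1 ∧ u = ‖u‖ • v :=
    fun u hu => ⟨‖u‖⁻¹ • u, norm_smul_inv_norm hu, (smul_inv_smul₀ (norm_ne_zero_iff.2 hu) u).symm⟩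
  have hBB : B * r ≤ |B| * r := mul_le_mul_of_nonneg_right (le_abs_self B) hr.le
  refine banachMazurDist_closedBall_le hK G (by positivity) hBr L ?_ ?_ ?_
  · intro u hu
    obtain ⟨v, hv, huv⟩ := hunit u hu
    rw [huv, map_smul]
    exact smul_ne_zero (norm_ne_zero_iff.2 hu) (norm_pos_iff.1 (hH v hv).2.1)
  · intro u y hy
    by_cases hu : u = 0
    · simp [hu]
    obtain ⟨v, hv, huv⟩ := hunit u hu
    have h1 := (hH v hv).2.2.1 y hy
    have h2 : (1 + B * r) * ‖L v‖ ≤ (1 + |B| * r) * ‖L v‖ :=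
      mul_le_mul_of_nonneg_right (by linarith) (norm_nonneg _)
    rw [huv, map_smul, norm_smul, norm_norm, inner_smul_right]
    have h3 := mul_le_mul_of_nonneg_left (h1.trans h2) (norm_nonneg u)
    linarith
  · intro u
    by_cases hu : u = 0
    · obtain ⟨y, hy⟩ := hK.nonempty_interior
      exact ⟨y, interior_subset hy, by simp [hu]⟩
    obtain ⟨v, hv, huv⟩ := hunit u hu
    obtain ⟨y, hy, h1⟩ := (hH v hv).2.2.2
    refine ⟨y, hy, ?_⟩
    have h2 : (1 - |B| * r) * ‖L v‖ ≤ (1 - B * r) * ‖L v‖ :=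
      mul_le_mul_of_nonneg_right (by linarith) (norm_nonneg _)
    rw [huv, map_smul, norm_smul, norm_norm, inner_smul_right]
    have h3 := mul_le_mul_of_nonneg_left (h2.trans h1) (norm_nonneg u)
    linarith

theorem log_le_of_le_div {d x : ℝ} (hd : 0 ≤ d) (hx0 : 0 ≤ x) (hx : x ≤ 1 / 2)
    (h : d ≤ (1 + x) / (1 - x)) : Real.log d ≤ 4 * x := by
  rcases hd.eq_or_lt with rfl | hd
  · rw [Real.log_zero]
    positivity
  refine (Real.log_le_sub_one_of_pos hd).trans ((sub_le_sub_right h 1).trans ?_)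
  rw [sub_le_iff_le_add, div_le_iff₀ (by linarith)]
  nlinarith

theorem sqrt_le_rpow_pow {ε : ℝ} (hε : 0 < ε) (hε1 : ε ≤ 1) (m : ℕ) :
    √ε ≤ (ε ^ (1 / (3 * ((m : ℝ) + 2)))) ^ (m + 3) := by
  rw [Real.sqrt_eq_rpow, ← Real.rpow_natCast, ← Real.rpow_mul hε.le]
  refine Real.rpow_le_rpow_of_exponent_ge hε hε1 ?_
  have hm : (0 : ℝ) ≤ m := m.cast_nonneg
  rw [one_div, inv_mul_eq_div, div_le_div_iff₀ (by positivity) (by norm_num)]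
  push_cast
  linarith

/-- Ball–Böröczky stability of the Blaschke–Santaló inequality. -/
theorem ball_boroczky_stability (n : ℕ) (hn : 3 ≤ n) :
    ∃ (c ε₀ : ℝ), 0 < c ∧ 0 < ε₀ ∧
      ∀ (K : Set (EuclideanSpace ℝ (Fin n))) (ε : ℝ), IsConvexBody K →
        0 < ε → ε < ε₀ →
        volumeProduct (Metric.closedBall (0 : EuclideanSpace ℝ (Fin n)) 1) ≤
          ENNReal.ofReal (1 + ε) * volumeProduct K →
        Real.log (banachMazurDist K (Metric.closedBall (0 : EuclideanSpace ℝ (Fin n)) 1)) ≤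
          c * ε ^ (1 / (3 * ((n : ℝ) + 1))) *
            |Real.log ε| ^ (2 / (3 * ((n : ℝ) + 1))) := by
  obtain ⟨m, rfl⟩ : ∃ m, n = m + 1 := ⟨n - 1, by omega⟩
  obtain ⟨B, r₁, hB, hr₁, H⟩ := exists_banachMazurDist_le m
  have hm : (0 : ℝ) < 3 * ((m : ℝ) + 2) := by positivity
  have hcast : 3 * (((m + 1 : ℕ) : ℝ) + 1) = 3 * ((m : ℝ) + 2) := by
    push_cast
    ring
  set r₂ := min r₁ (1 / (2 * (B + 1)))
  have hr₂ : 0 < r₂ := by positivity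
  refine ⟨4 * B + 1, min (r₂ ^ (3 * ((m : ℝ) + 2))) (Real.exp (-1)), by positivity,
    by positivity, fun K ε hK hε hεlt hP => ?_⟩
  rw [hcast]
  set r := ε ^ (1 / (3 * ((m : ℝ) + 2)))
  have hr : 0 < r := by positivity
  have hr2 : r ≤ r₂ := by
    have := Real.rpow_le_rpow hε.le (hεlt.trans_le (min_le_left _ _)).le
      (show 0 ≤ 1 / (3 * ((m : ℝ) + 2)) by positivity)
    rwa [← Real.rpow_mul hr₂.le, mul_one_div_cancel hm.ne', Real.rpow_one] at this
  have hεe : ε < Real.exp (-1) := hεlt.trans_le (min_le_right _ _)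
  have hε1 : ε ≤ 1 := hεe.le.trans (Real.exp_le_one_iff.2 (by norm_num))
  have hBr : B * r ≤ 1 / 2 := by
    have : r ≤ 1 / (2 * (B + 1)) := hr2.trans (min_le_right _ _)
    rw [le_div_iff₀ (by positivity)] at this
    linarith
  have hd := H ε r K hK hε hr (hr2.trans (min_le_left _ _)) (sqrt_le_rpow_pow hε hε1 m)
    (by linarith) hP
  refine (log_le_of_le_div (Real.sInf_nonneg fun d hd => hd.1.le) (by positivity) hBr hd).trans ?_
  have hlog : 1 ≤ |Real.log ε| := by
    have : Real.log ε ≤ -1 := (Real.log_le_iff_le_exp hε).2 hεe.le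
    rw [le_abs]
    right
    linarith
  have h1 : 1 ≤ |Real.log ε| ^ (2 / (3 * ((m : ℝ) + 2))) :=
    Real.one_le_rpow hlog (by positivity)
  calc 4 * (B * r) ≤ (4 * B + 1) * r := by linarith
    _ ≤ _ := le_mul_of_one_le_right (by positivity) h1
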